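/- arXiv:1904.07174 — 2 statements merged into one kernel-verified Lean document; each statement's English description precedes it below -/
import Mathlib

section
/- Suppose K = Θ(n^C) for some constant C ∈ (0, 1/2). Let α ∈ (0,1) satisfy α > 1 − (5/2 − √6)·(1−C)/C, and set γ = h⁻¹(log 2 − (log binom(n,K) − K^α·log n)/binom(K,2)). Then there exists δ > 0 small enough such that E[Ẑ_{K,γ,δ}²]/E[Ẑ_{K,γ,δ}]² = 1 + o(1); in particular, Z_{K,γ} ≥ Ẑ_{K,γ,δ} ≥ 1 with high probability as n → ∞. -/
open Filter MeasureTheory Finset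

noncomputable section

/-- Edge index type: unordered pairs of vertices of `Fin n`, encoded as ordered pairs `i < j`. -/
abbrev EdgeIdx (n : ℕ) := {p : Fin n × Fin n // p.1 < p.2}

/-- A graph on the vertex set `Fin n`, given by a boolean indicator on the possible edges. -/
abbrev ERGraph (n : ℕ) := EdgeIdx n → Bool

/-- The number of edges of the subgraph of `g` induced on the vertex set `A`. -/
def edgeCount {n : ℕ} (g : ERGraph n) (A : Finset (Fin n)) : ℕ :=
  (Finset.univ.filter (fun p : EdgeIdx n => p.1.1 ∈ A ∧ p.1.2 ∈ A ∧ g p = true)).card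

/-- The Erdős–Rényi `G(n,1/2)` distribution: the uniform measure over all graphs on `n`
labeled vertices (each edge present independently with probability `1/2`). -/
noncomputable def erMeasure (n : ℕ) : Measure (ERGraph n) :=
  (PMF.uniformOfFintype (ERGraph n)).toMeasure

/-- `d_{ER,K}(g)`: the number of edges of the densest `K`-vertex subgraph of `g`. -/
def dER (n K : ℕ) (g : ERGraph n) : ℕ :=
  (Finset.powersetCard K (Finset.univ : Finset (Fin n))).sup (edgeCount g)

/-- The natural-log binary entropy function. -/
noncomputable def binEnt (x : ℝ) : ℝ := -(x * Real.log x) - (1 - x) * Real.log (1 - x)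

/-- The inverse of the binary entropy restricted to `[1/2, 1]`. -/
noncomputable def binEntInv (y : ℝ) : ℝ :=
  Function.invFunOn binEnt (Set.Icc (1/2 : ℝ) 1) y

/-- The quantity `D_K(ℓ,δ)` from the definition of `(γ,δ)`-flatness. -/
noncomputable def DK (K ℓ : ℕ) (γ δ : ℝ) : ℝ :=
  if (ℓ : ℝ) < 2 * (K : ℝ) / 3 then
    Real.sqrt (2 * γ * (2 + δ) *
      min ((K.choose 2 : ℝ) - (ℓ.choose 2 : ℝ)) (ℓ.choose 2 : ℝ) *
      (Real.log (K.choose ℓ : ℝ) + 2 * Real.log K))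
  else
    Real.sqrt (2 * γ * (1 + δ) *
      min ((K.choose 2 : ℝ) - (ℓ.choose 2 : ℝ)) (ℓ.choose 2 : ℝ) *
      (Real.log (K.choose ℓ : ℝ) + 2 * Real.log K))

/-- The subgraph of `g` induced on the `K`-element vertex set `A` is `(γ,δ)`-flat. -/
def IsFlatOn {n : ℕ} (g : ERGraph n) (K : ℕ) (γ δ : ℝ) (A : Finset (Fin n)) : Prop :=
  edgeCount g A = ⌈γ * (K.choose 2 : ℝ)⌉₊ ∧
  ∀ B ⊆ A, 2 ≤ B.card → B.card ≤ K - 1 →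
    (edgeCount g B : ℝ) ≤ (⌈γ * (B.card.choose 2 : ℝ)⌉₊ : ℝ) + DK K B.card γ δ

open Classical in
/-- `Ẑ_{K,γ,δ}`: the number of `K`-vertex subsets inducing a `(γ,δ)`-flat subgraph. -/
noncomputable def flatCount (n K : ℕ) (γ δ : ℝ) (g : ERGraph n) : ℕ :=
  ((Finset.powersetCard K (Finset.univ : Finset (Fin n))).filter (IsFlatOn g K γ δ)).card

open Classical in
/-- `Z_{K,γ}`: the number of `K`-vertex subsets inducing at least `γ C(K,2)` edges. -/
noncomputable def denseCount (n K : ℕ) (γ : ℝ) (g : ERGraph n) : ℕ :=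
  ((Finset.powersetCard K (Finset.univ : Finset (Fin n))).filter
    (fun A => γ * (K.choose 2 : ℝ) ≤ (edgeCount g A : ℝ))).card

/-- Expectation with respect to the uniform (Erdős–Rényi `G(n,1/2)`) distribution. -/
noncomputable def erExp (n : ℕ) (f : ERGraph n → ℝ) : ℝ :=
  (∑ g : ERGraph n, f g) / (Fintype.card (ERGraph n) : ℝ)

/-- The density threshold `γ = h⁻¹(log 2 − (log C(n,K) − K^α log n)/C(K,2))`. -/
noncomputable def gammaSeq (K : ℕ → ℕ) (α : ℝ) (n : ℕ) : ℝ :=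
  binEntInv (Real.log 2 -
    (Real.log (n.choose (K n) : ℝ) - (K n : ℝ) ^ α * Real.log n) / ((K n).choose 2 : ℝ))

/-! ### Expectations and probabilities over the uniform graph -/

open Classical in
/-- The probability of an event under the uniform distribution on graphs. -/
def erProb (n : ℕ) (s : ERGraph n → Prop) : ℝ := erExp n (fun g => if s g then 1 else 0)

lemma erExp_mono {n : ℕ} {f f' : ERGraph n → ℝ} (h : ∀ g, f g ≤ f' g) :
    erExp n f ≤ erExp n f' := by
  unfold erExp
  gcongr with g
  exact h g

lemma erExp_const_mul {n : ℕ} (c : ℝ) (f : ERGraph n → ℝ) :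
    erExp n (fun g => c * f g) = c * erExp n f := by
  unfold erExp
  rw [← Finset.mul_sum, mul_div_assoc]

lemma erExp_sum {n : ℕ} {ι : Type*} (s : Finset ι) (f : ι → ERGraph n → ℝ) :
    erExp n (fun g => ∑ i ∈ s, f i g) = ∑ i ∈ s, erExp n (f i) := by
  unfold erExp
  rw [Finset.sum_comm, Finset.sum_div]

lemma erProb_nonneg {n : ℕ} (s : ERGraph n → Prop) : 0 ≤ erProb n s := by
  unfold erProb erExp
  apply div_nonneg _ (by positivity)
  apply Finset.sum_nonneg
  intro g _
  split_ifs <;> norm_num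

lemma erProb_le_one {n : ℕ} (s : ERGraph n → Prop) : erProb n s ≤ 1 := by
  unfold erProb erExp
  apply div_le_one_of_le₀ _ (by positivity)
  calc _ ≤ ∑ g : ERGraph n, (1 : ℝ) := by
        apply Finset.sum_le_sum
        intro g _
        split_ifs <;> norm_num
    _ = _ := by simp

lemma erProb_le_erExp {n : ℕ} {s : ERGraph n → Prop} {f : ERGraph n → ℝ}
    (h0 : ∀ g, 0 ≤ f g) (h1 : ∀ g, s g → 1 ≤ f g) : erProb n s ≤ erExp n f := by
  classical
  apply erExp_mono
  intro g
  split_ifs with h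
  · exact h1 g h
  · exact h0 g

lemma erProb_mono {n : ℕ} {s t : ERGraph n → Prop} (h : ∀ g, s g → t g) :
    erProb n s ≤ erProb n t := by
  classical
  apply erExp_mono
  intro g
  by_cases hs : s g
  · simp [hs, h g hs]
  · simp only [hs, if_false]
    split_ifs <;> norm_num

lemma erProb_le_add_sum {n : ℕ} {ι : Type*} {s t : ERGraph n → Prop} (F : Finset ι)
    (u : ι → ERGraph n → Prop) (h : ∀ g, s g → t g ∨ ∃ i ∈ F, u i g) :
    erProb n s ≤ erProb n t + ∑ i ∈ F, erProb n (u i) := by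
  classical
  unfold erProb
  rw [← erExp_sum]
  unfold erExp
  rw [← add_div, ← Finset.sum_add_distrib]
  gcongr with g
  have hnn : 0 ≤ ∑ i ∈ F, (if u i g then (1 : ℝ) else 0) := by
    apply Finset.sum_nonneg
    intro i _
    split_ifs <;> norm_num
  by_cases hs : s g
  · rcases h g hs with ht | ⟨i, hi, hu⟩
    · simp only [hs, ht, if_true]; linarith
    · have : (1 : ℝ) ≤ ∑ i ∈ F, (if u i g then (1 : ℝ) else 0) := by
        calc (1 : ℝ) = if u i g then (1 : ℝ) else 0 := by simp [hu]
          _ ≤ _ := Finset.single_le_sum (f := fun i => if u i g then (1 : ℝ) else 0)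
            (fun j _ => by split_ifs <;> norm_num) hi
      have : (0 : ℝ) ≤ if t g then 1 else 0 := by split_ifs <;> norm_num
      simp only [hs, if_true]; linarith
  · have : (0 : ℝ) ≤ if t g then 1 else 0 := by split_ifs <;> norm_num
    simp only [hs, if_false]; linarith

lemma erExp_prod {n : ℕ} (a : EdgeIdx n → ℝ) :
    erExp n (fun g => ∏ e, if g e then a e else 1) = ∏ e, ((1 + a e) / 2) := by
  unfold erExp
  have h := Finset.prod_univ_sum (R := ℝ) (fun _ : EdgeIdx n => (Finset.univ : Finset Bool))
    (fun e b => if b then a e else 1)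
  simp only [Fintype.piFinset_univ] at h
  rw [← h, Fintype.card_pi]
  push_cast
  rw [← Finset.prod_div_distrib]
  apply Finset.prod_congr rfl
  intro e _
  simp [add_comm]

/-- The number of edges of `g` among the edge slots in `S`. -/
def cnt {n : ℕ} (S : Finset (EdgeIdx n)) (g : ERGraph n) : ℕ := (S.filter (fun e => g e = true)).card

lemma cnt_le_card {n : ℕ} (S : Finset (EdgeIdx n)) (g : ERGraph n) : cnt S g ≤ S.card :=
  Finset.card_filter_le _ _

lemma cnt_congr {n : ℕ} {S : Finset (EdgeIdx n)} {g g' : ERGraph n}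
    (h : ∀ e ∈ S, g e = g' e) : cnt S g = cnt S g' := by
  unfold cnt
  congr 1
  apply Finset.filter_congr
  intro e he
  rw [h e he]

lemma cnt_union {n : ℕ} {S T : Finset (EdgeIdx n)} (h : Disjoint S T) (g : ERGraph n) :
    cnt (S ∪ T) g = cnt S g + cnt T g := by
  unfold cnt
  rw [Finset.filter_union, Finset.card_union_of_disjoint]
  exact Finset.disjoint_filter_filter h

lemma cnt_sdiff_add {n : ℕ} {S T : Finset (EdgeIdx n)} (h : T ⊆ S) (g : ERGraph n) :
    cnt T g + cnt (S \ T) g = cnt S g := by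
  rw [← cnt_union Finset.disjoint_sdiff, Finset.union_sdiff_of_subset h]

lemma pow_cnt {n : ℕ} (S : Finset (EdgeIdx n)) (z : ℝ) (g : ERGraph n) :
    z ^ cnt S g = ∏ e, if g e then (if e ∈ S then z else 1) else 1 := by
  unfold cnt
  rw [← Finset.prod_const, Finset.prod_filter, ← Finset.prod_subset (Finset.subset_univ S)]
  · apply Finset.prod_congr rfl
    intro e he
    simp [he]
  · intro e _ he
    simp [he]

lemma erExp_pow_cnt_mul {n : ℕ} {S T : Finset (EdgeIdx n)} (h : Disjoint S T) (w z : ℝ) :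
    erExp n (fun g => w ^ cnt S g * z ^ cnt T g) =
      ((1 + w) / 2) ^ S.card * ((1 + z) / 2) ^ T.card := by
  have h1 : (fun g : ERGraph n => w ^ cnt S g * z ^ cnt T g) =
      fun g => ∏ e, if g e then ((if e ∈ S then w else 1) * (if e ∈ T then z else 1)) else 1 := by
    funext g
    rw [pow_cnt, pow_cnt, ← Finset.prod_mul_distrib]
    apply Finset.prod_congr rfl
    intro e _
    by_cases hg : g e <;> simp [hg]
  rw [h1, erExp_prod]
  have h2 : ∀ e : EdgeIdx n, (1 + (if e ∈ S then w else 1) * (if e ∈ T then z else 1)) / 2 =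
      (if e ∈ S then (1 + w) / 2 else 1) * (if e ∈ T then (1 + z) / 2 else 1) := by
    intro e
    by_cases hS : e ∈ S
    · have hT : e ∉ T := Finset.disjoint_left.mp h hS
      simp [hS, hT]
    · by_cases hT : e ∈ T <;> simp [hS, hT]
  simp_rw [h2]
  rw [Finset.prod_mul_distrib]
  simp [Finset.prod_ite_mem, div_pow]

lemma erExp_pow_cnt {n : ℕ} (S : Finset (EdgeIdx n)) (z : ℝ) :
    erExp n (fun g => z ^ cnt S g) = ((1 + z) / 2) ^ S.card := by
  simpa [cnt] using erExp_pow_cnt_mul (Finset.disjoint_empty_right S) z 1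

open Polynomial in
lemma erProb_cnt_eq {n : ℕ} (S : Finset (EdgeIdx n)) (k : ℕ) :
    erProb n (fun g => cnt S g = k) = (S.card.choose k : ℝ) / 2 ^ S.card := by
  classical
  by_cases hk : k ≤ S.card
  swap
  · rw [Nat.choose_eq_zero_of_lt (by omega)]
    have : ∀ g : ERGraph n, cnt S g ≠ k := fun g hg => hk (hg ▸ cnt_le_card S g)
    simp [erProb, erExp, this]
  let P : ℝ[X] := ∑ j ∈ Finset.range (S.card + 1), C (erProb n (fun g => cnt S g = j)) * X ^ j
  let Q : ℝ[X] := ∑ j ∈ Finset.range (S.card + 1), C ((S.card.choose j : ℝ) / 2 ^ S.card) * X ^ j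
  have hPQ : P = Q := by
    apply Polynomial.funext
    intro z
    have h1 : P.eval z = erExp n (fun g => z ^ cnt S g) := by
      simp only [P, eval_finsetSum, eval_mul, eval_C, eval_pow, eval_X]
      have : (fun g : ERGraph n => z ^ cnt S g) =
          fun g => ∑ j ∈ Finset.range (S.card + 1), z ^ j * (if cnt S g = j then 1 else 0) := by
        funext g
        simp only [mul_ite, mul_one, mul_zero]
        rw [Finset.sum_ite_eq, if_pos]
        have := cnt_le_card S g
        simp; omega
      rw [this, erExp_sum]
      apply Finset.sum_congr rfl
      intro j _
      rw [erExp_const_mul, erProb, mul_comm]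
      congr!
    rw [h1, erExp_pow_cnt, div_pow, add_comm 1 z, add_pow]
    simp only [Q, eval_finsetSum, eval_mul, eval_C, eval_pow, eval_X]
    rw [Finset.sum_div]
    apply Finset.sum_congr rfl
    intro j _
    ring
  have := congrArg (fun p => Polynomial.coeff p k) hPQ
  simp only [P, Q, finsetSum_coeff, coeff_C_mul, coeff_X_pow, mul_ite, mul_one, mul_zero] at this
  rw [Finset.sum_ite_eq, if_pos (by simp; omega), Finset.sum_ite_eq, if_pos (by simp; omega)] at this
  exact this

/-! ### Decoupling events on edge sets with small intersection -/

lemma erProb_eq_card {n : ℕ} (s : ERGraph n → Prop) [DecidablePred s] :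
    erProb n s = ((Finset.univ.filter s).card : ℝ) / (Fintype.card (ERGraph n) : ℝ) := by
  unfold erProb erExp
  congr 1
  rw [Finset.card_filter]
  push_cast
  apply Finset.sum_congr rfl
  intro g _
  congr

lemma card_agreeing {n : ℕ} (I : Finset (EdgeIdx n)) (g : ERGraph n) :
    (Finset.univ.filter (fun g' : ERGraph n => ∀ e ∈ I, g' e = g e)).card * 2 ^ I.card =
      Fintype.card (ERGraph n) := by
  classical
  have h1 : (Finset.univ.filter (fun g' : ERGraph n => ∀ e ∈ I, g' e = g e)) =
      Fintype.piFinset (fun e => if e ∈ I then {g e} else Finset.univ) := by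
    ext g'
    simp only [Finset.mem_filter, Finset.mem_univ, true_and, Fintype.mem_piFinset]
    constructor
    · intro h e
      by_cases he : e ∈ I <;> simp [he, h]
    · intro h e he
      simpa [he] using h e
  rw [h1, Fintype.card_piFinset, Fintype.card_pi]
  have h2 : (2 : ℕ) ^ I.card = ∏ e : EdgeIdx n, if e ∈ I then 2 else 1 := by
    rw [Finset.prod_ite_mem]; simp
  rw [h2, ← Finset.prod_mul_distrib]
  apply Finset.prod_congr rfl
  intro e _
  by_cases he : e ∈ I <;> simp [he]

lemma erProb_and_le {n : ℕ} {S T : Finset (EdgeIdx n)} {P Q : ERGraph n → Prop}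
    (hP : ∀ g g', (∀ e ∈ S, g e = g' e) → (P g → P g'))
    (hQ : ∀ g g', (∀ e ∈ T, g e = g' e) → (Q g → Q g')) :
    erProb n (fun g => P g ∧ Q g) ≤ 2 ^ (S ∩ T).card * (erProb n P * erProb n Q) := by
  classical
  set N : ℕ := Fintype.card (ERGraph n) with hN
  set X := (Finset.univ.filter (fun g => P g ∧ Q g)).sigma
    (fun g => Finset.univ.filter (fun g' : ERGraph n => ∀ e ∈ S ∩ T, g' e = g e)) with hX
  have hXc : X.card * 2 ^ (S ∩ T).card = (Finset.univ.filter (fun g => P g ∧ Q g)).card * N := by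
    rw [hX, Finset.card_sigma, Finset.sum_mul]
    simp_rw [card_agreeing]
    simp [hN]
  have hle : X.card ≤ (Finset.univ.filter P).card * (Finset.univ.filter Q).card := by
    rw [← Finset.card_product]
    apply Finset.card_le_card_of_injOn
      (fun x : (_ : ERGraph n) × ERGraph n =>
        ((fun e => if e ∈ S then x.1 e else x.2 e), (fun e => if e ∈ S then x.2 e else x.1 e)))
    · rintro ⟨g, g'⟩ hx
      simp only [hX, Finset.coe_sigma, Set.mem_sigma_iff, Finset.mem_coe, Finset.mem_filter,
        Finset.mem_univ, true_and] at hx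
      obtain ⟨⟨hPg, hQg⟩, hag⟩ := hx
      simp only [Finset.coe_product, Set.mem_prod, Finset.mem_coe, Finset.mem_filter,
        Finset.mem_univ, true_and]
      refine ⟨hP g _ (fun e he => by simp [he]) hPg, hQ g _ (fun e he => ?_) hQg⟩
      by_cases hS : e ∈ S
      · simp [hS, hag e (Finset.mem_inter.mpr ⟨hS, he⟩)]
      · simp [hS]
    · rintro ⟨g, g'⟩ _ ⟨k, k'⟩ _ h
      simp only [Prod.mk.injEq] at h
      obtain ⟨h1, h2⟩ := h
      have e1 : g = k := by
        funext e
        have a := congrFun h1 e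
        have b := congrFun h2 e
        by_cases hS : e ∈ S <;> simp [hS] at a b <;> assumption
      have e2 : g' = k' := by
        funext e
        have a := congrFun h1 e
        have b := congrFun h2 e
        by_cases hS : e ∈ S <;> simp [hS] at a b <;> assumption
      subst e1; subst e2; rfl
  have hNpos : (0 : ℝ) < N := by
    rw [hN]; exact_mod_cast Fintype.card_pos
  rw [erProb_eq_card, erProb_eq_card, erProb_eq_card, ← hN, div_mul_div_comm, ← mul_div_assoc,
    div_le_div_iff₀ hNpos (by positivity)]
  have h3 : ((Finset.univ.filter (fun g => P g ∧ Q g)).card : ℝ) * N ≤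
      2 ^ (S ∩ T).card * ((Finset.univ.filter P).card * (Finset.univ.filter Q).card) := by
    have : (Finset.univ.filter (fun g => P g ∧ Q g)).card * N ≤
      2 ^ (S ∩ T).card * ((Finset.univ.filter P).card * (Finset.univ.filter Q).card) := by
      rw [← hXc, mul_comm]
      exact Nat.mul_le_mul_left _ hle
    exact_mod_cast this
  calc _ = ((Finset.univ.filter (fun g => P g ∧ Q g)).card : ℝ) * N * N := by ring
    _ ≤ _ := by gcongr

/-! ### Edge slots inside a vertex set -/

/-- The edge slots with both endpoints in `A`. -/
def edgeSlots {n : ℕ} (A : Finset (Fin n)) : Finset (EdgeIdx n) :=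
  Finset.univ.filter (fun p : EdgeIdx n => p.1.1 ∈ A ∧ p.1.2 ∈ A)

lemma edgeCount_eq_cnt {n : ℕ} (g : ERGraph n) (A : Finset (Fin n)) :
    edgeCount g A = cnt (edgeSlots A) g := by
  unfold edgeCount cnt edgeSlots
  rw [Finset.filter_filter]
  simp only [and_assoc]

lemma edgeSlots_inter {n : ℕ} (A B : Finset (Fin n)) :
    edgeSlots A ∩ edgeSlots B = edgeSlots (A ∩ B) := by
  ext p
  simp only [edgeSlots, Finset.mem_inter, Finset.mem_filter, Finset.mem_univ, true_and]
  tauto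

lemma edgeSlots_mono {n : ℕ} {A B : Finset (Fin n)} (h : A ⊆ B) : edgeSlots A ⊆ edgeSlots B := by
  intro p
  simp only [edgeSlots, Finset.mem_filter, Finset.mem_univ, true_and]
  exact fun hp => ⟨h hp.1, h hp.2⟩

lemma card_edgeSlots {n : ℕ} (A : Finset (Fin n)) : (edgeSlots A).card = A.card.choose 2 := by
  rw [← Finset.card_powersetCard]
  apply Finset.card_bij (fun p _ => ({p.1.1, p.1.2} : Finset (Fin n)))
  · rintro ⟨⟨i, j⟩, hij⟩ hp
    simp only [edgeSlots, Finset.mem_filter, Finset.mem_univ, true_and] at hp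
    rw [Finset.mem_powersetCard]
    refine ⟨?_, Finset.card_pair hij.ne⟩
    intro x hx
    rcases Finset.mem_insert.mp hx with rfl | hx
    · exact hp.1
    · rw [Finset.mem_singleton.mp hx]; exact hp.2
  · rintro ⟨⟨i, j⟩, hij⟩ _ ⟨⟨k, l⟩, hkl⟩ _ h
    simp only at hij hkl h
    have hi : i ∈ ({k, l} : Finset (Fin n)) := by rw [← h]; simp
    have hj : j ∈ ({k, l} : Finset (Fin n)) := by rw [← h]; simp
    simp only [Finset.mem_insert, Finset.mem_singleton] at hi hj
    have : i = k ∧ j = l := by omega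
    obtain ⟨rfl, rfl⟩ := this
    rfl
  · intro s hs
    rw [Finset.mem_powersetCard] at hs
    obtain ⟨hsA, hc⟩ := hs
    obtain ⟨x, y, hxy, rfl⟩ := Finset.card_eq_two.mp hc
    have hx : x ∈ A := hsA (by simp)
    have hy : y ∈ A := hsA (by simp)
    rcases lt_or_gt_of_ne hxy with h | h
    · exact ⟨⟨(x, y), h⟩, by simp [edgeSlots, hx, hy], rfl⟩
    · exact ⟨⟨(y, x), h⟩, by simp [edgeSlots, hx, hy], Finset.pair_comm _ _⟩

/-! ### Binomial point probabilities and exponential tilting -/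

lemma binomial_term_le_mode {M E : ℕ} (hE : E < M) {k : ℕ} (hk : k ≤ M) :
    M.choose k * E ^ k * (M - E) ^ (M - k) ≤ M.choose E * E ^ E * (M - E) ^ (M - E) := by
  obtain ⟨F, rfl⟩ : ∃ F, M = E + F := ⟨M - E, by omega⟩
  have hF : 0 < F := by omega
  rw [Nat.add_sub_cancel_left]
  set t : ℕ → ℕ := fun k => (E + F).choose k * E ^ k * F ^ (E + F - k) with ht
  have key : ∀ k, k < E + F → t (k + 1) * ((k + 1) * F) = t k * ((E + F - k) * E) := by
    intro k hk
    have h1 := Nat.choose_succ_right_eq (E + F) k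
    have h2 : F ^ (E + F - k) = F ^ (E + F - (k + 1)) * F := by
      rw [← pow_succ]; congr 1; omega
    simp only [ht]
    rw [h2, pow_succ]
    calc _ = ((E + F).choose (k + 1) * (k + 1)) * (E ^ k * E * F ^ (E + F - (k + 1)) * F) := by ring
      _ = _ := by rw [h1]; ring
  have hup : ∀ k, k < E → t k ≤ t (k + 1) := by
    intro k hkE
    have h := key k (by omega)
    have h2 : (k + 1) * F ≤ (E + F - k) * E := by
      calc (k + 1) * F ≤ E * F := Nat.mul_le_mul_right _ hkE
        _ = F * E := mul_comm _ _
        _ ≤ _ := Nat.mul_le_mul_right _ (by omega)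
    have h3 : t k * ((k + 1) * F) ≤ t (k + 1) * ((k + 1) * F) := by
      rw [h]; exact Nat.mul_le_mul_left _ h2
    exact Nat.le_of_mul_le_mul_right h3 (by positivity)
  have hdown : ∀ k, E ≤ k → k < E + F → t (k + 1) ≤ t k := by
    intro k hkE hk
    have h := key k hk
    have h2 : (E + F - k) * E ≤ (k + 1) * F := by
      calc (E + F - k) * E ≤ F * E := Nat.mul_le_mul_right _ (by omega)
        _ = E * F := mul_comm _ _
        _ ≤ _ := Nat.mul_le_mul_right _ (by omega)
    have h3 : t (k + 1) * ((k + 1) * F) ≤ t k * ((k + 1) * F) := by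
      rw [h]; exact Nat.mul_le_mul_left _ h2
    exact Nat.le_of_mul_le_mul_right h3 (by positivity)
  have hu : ∀ j, j ≤ E → t (E - j) ≤ t E := by
    intro j
    induction j with
    | zero => simp
    | succ j ih =>
      intro hj
      have := hup (E - (j + 1)) (by omega)
      rw [show E - (j + 1) + 1 = E - j by omega] at this
      exact this.trans (ih (by omega))
  have hd : ∀ j, j ≤ F → t (E + j) ≤ t E := by
    intro j
    induction j with
    | zero => simp
    | succ j ih =>
      intro hj
      exact (hdown (E + j) (by omega) (by omega)).trans (ih (by omega))
  have hfin : t k ≤ t E := by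
    rcases le_total k E with h | h
    · have := hu (E - k) (by omega)
      rwa [show E - (E - k) = k by omega] at this
    · have := hd (k - E) (by omega)
      rwa [show E + (k - E) = k by omega] at this
  simpa [ht] using hfin

lemma pow_self_le_mode {M E : ℕ} (hE : E < M) :
    M ^ M ≤ (M + 1) * (M.choose E * E ^ E * (M - E) ^ (M - E)) := by
  calc M ^ M = (E + (M - E)) ^ M := by rw [Nat.add_sub_cancel' hE.le]
    _ = ∑ k ∈ Finset.range (M + 1), E ^ k * (M - E) ^ (M - k) * M.choose k := by rw [add_pow]; rfl
    _ ≤ ∑ k ∈ Finset.range (M + 1), M.choose E * E ^ E * (M - E) ^ (M - E) := by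
        apply Finset.sum_le_sum
        intro k hk
        have := binomial_term_le_mode hE (k := k) (by simp at hk; omega)
        calc _ = M.choose k * E ^ k * (M - E) ^ (M - k) := by ring
          _ ≤ _ := this
    _ = _ := by simp

/-- The odds ratio of the density `E / M`. -/
def odds (E M : ℕ) : ℝ := (E : ℝ) / ((M : ℝ) - E)

/-- The probability that a `Bin(M, 1/2)` variable equals `E`. -/
def binProb (E M : ℕ) : ℝ := (M.choose E : ℝ) / 2 ^ M

lemma odds_pos {E M : ℕ} (h0 : 0 < E) (hE : E < M) : 0 < odds E M := by
  have h1 : (E : ℝ) < M := by exact_mod_cast hE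
  have h2 : (0 : ℝ) < E := by exact_mod_cast h0
  exact div_pos h2 (by linarith)

lemma one_add_odds {E M : ℕ} (hE : E < M) : 1 + odds E M = (M : ℝ) / ((M : ℝ) - E) := by
  have h1 : (E : ℝ) < M := by exact_mod_cast hE
  unfold odds
  have : (M : ℝ) - E ≠ 0 := by linarith
  field_simp
  ring

lemma binProb_pos {E M : ℕ} (hE : E ≤ M) : 0 < binProb E M := by
  unfold binProb
  have : 0 < M.choose E := Nat.choose_pos hE
  positivity

lemma tilt_le_binProb {E M : ℕ} (h0 : 0 < E) (hE : E < M) :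
    ((1 + odds E M) / 2) ^ M ≤ (M + 1) * odds E M ^ E * binProb E M := by
  have h1 : (0 : ℝ) < (M : ℝ) - E := by
    have : (E : ℝ) < M := by exact_mod_cast hE
    linarith
  have h2 : (0 : ℝ) < E := by exact_mod_cast h0
  rw [one_add_odds hE]
  unfold odds binProb
  have key : (M : ℝ) ^ M ≤ (M + 1) * (M.choose E * E ^ E * ((M : ℝ) - E) ^ (M - E)) := by
    have := pow_self_le_mode hE
    have h3 : ((M : ℝ) - E) = ((M - E : ℕ) : ℝ) := by rw [Nat.cast_sub hE.le]
    rw [h3]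
    exact_mod_cast this
  have h4 : ((M : ℝ) - E) ^ M = ((M : ℝ) - E) ^ (M - E) * ((M : ℝ) - E) ^ E := by
    rw [← pow_add]; congr 1; omega
  rw [div_pow, div_pow, div_pow]
  calc (M : ℝ) ^ M / ((M : ℝ) - E) ^ M / 2 ^ M
      ≤ ((M + 1) * (M.choose E * E ^ E * ((M : ℝ) - E) ^ (M - E))) / ((M : ℝ) - E) ^ M / 2 ^ M := by
        gcongr
    _ = _ := by
        rw [h4]
        field_simp

lemma erProb_cnt_eq_binProb {n : ℕ} {S : Finset (EdgeIdx n)} {E M : ℕ} (hS : S.card = M) :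
    erProb n (fun g => cnt S g = E) = binProb E M := by
  rw [erProb_cnt_eq, hS, binProb]

lemma erProb_pair_le {n : ℕ} {S T : Finset (EdgeIdx n)} {E M : ℕ} (h0 : 0 < E) (hE : E < M)
    (hS : S.card = M) (hT : T.card = M) {w c : ℝ} (hw : 0 < w) (hc : 0 ≤ c)
    (ev : ERGraph n → Prop)
    (hev : ∀ g, ev g → cnt S g = E ∧ cnt T g = E ∧
      odds E M ^ (2 * cnt (S ∩ T) g) ≤ c * w ^ cnt (S ∩ T) g) :
    erProb n ev ≤ c * ((M + 1) * binProb E M) ^ 2 *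
      (((1 + w) / 2) / ((1 + odds E M) / 2) ^ 2) ^ (S ∩ T).card := by
  set z := odds E M with hz
  have hz0 : 0 < z := odds_pos h0 hE
  set I := S ∩ T with hI
  set D := (S \ I) ∪ (T \ I) with hD
  have hdis : Disjoint (S \ I) (T \ I) := by
    rw [Finset.disjoint_left]
    intro e he he'
    simp [hI] at he he'
    tauto
  have hdisI : Disjoint I D := by
    rw [Finset.disjoint_left]
    intro e he he'
    simp [hI, hD] at he he'
    tauto
  have hIS : I ⊆ S := Finset.inter_subset_left
  have hIT : I ⊆ T := Finset.inter_subset_right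
  have hDc : D.card + 2 * I.card = 2 * M := by
    rw [hD, Finset.card_union_of_disjoint hdis, Finset.card_sdiff_of_subset hIS,
      Finset.card_sdiff_of_subset hIT, hS, hT]
    have := Finset.card_le_card hIS
    omega
  have step1 : erProb n ev ≤ (c / z ^ (2 * E)) *
      (((1 + w) / 2) ^ I.card * ((1 + z) / 2) ^ D.card) := by
    rw [← erExp_pow_cnt_mul hdisI, ← erExp_const_mul]
    apply erProb_le_erExp
    · intro g; positivity
    · intro g hg
      obtain ⟨h1, h2, h3⟩ := hev g hg
      have hcount : 2 * cnt I g + cnt D g = 2 * E := by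
        rw [hD, cnt_union hdis]
        have a := cnt_sdiff_add hIS g
        have b := cnt_sdiff_add hIT g
        omega
      rw [div_mul_eq_mul_div, le_div_iff₀ (by positivity), one_mul, ← hcount, pow_add, ← mul_assoc]
      gcongr
  have step2 := tilt_le_binProb h0 hE
  rw [← hz] at step2
  have step3 : ((1 + z) / 2) ^ (2 * M) ≤ ((M + 1) * z ^ E * binProb E M) ^ 2 := by
    rw [mul_comm 2 M, pow_mul]
    gcongr
  calc _ ≤ _ := step1
    _ = (c / z ^ (2 * E)) * (((1 + w) / 2) / ((1 + z) / 2) ^ 2) ^ I.card *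
        ((1 + z) / 2) ^ (2 * M) := by
        rw [← hDc, pow_add, div_pow ((1 + w) / 2) (((1 + z) / 2) ^ 2), ← pow_mul]
        field_simp
    _ ≤ (c / z ^ (2 * E)) * (((1 + w) / 2) / ((1 + z) / 2) ^ 2) ^ I.card *
        ((M + 1) * z ^ E * binProb E M) ^ 2 := by gcongr
    _ = _ := by
        rw [mul_comm 2 E, pow_mul]
        field_simp

lemma erProb_pair_le_sq {n : ℕ} {S T : Finset (EdgeIdx n)} {E M : ℕ} (h0 : 0 < E) (hE : E < M)
    (hS : S.card = M) (hT : T.card = M) (ev : ERGraph n → Prop)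
    (hev : ∀ g, ev g → cnt S g = E ∧ cnt T g = E) :
    erProb n ev ≤ ((M + 1) * binProb E M) ^ 2 *
      (((1 + odds E M ^ 2) / 2) / ((1 + odds E M) / 2) ^ 2) ^ (S ∩ T).card := by
  have hz0 := odds_pos h0 hE
  have := erProb_pair_le h0 hE hS hT (w := odds E M ^ 2) (c := 1) (by positivity) zero_le_one ev
    (fun g hg => ⟨(hev g hg).1, (hev g hg).2, by rw [one_mul, pow_mul]⟩)
  simpa using this

lemma erProb_pair_le_truncated {n : ℕ} {S T : Finset (EdgeIdx n)} {E M : ℕ} (h0 : 0 < E)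
    (hE : E < M) (hz1 : 1 ≤ odds E M) (hS : S.card = M) (hT : T.card = M) (τ : ℝ)
    (ev : ERGraph n → Prop)
    (hev : ∀ g, ev g → cnt S g = E ∧ cnt T g = E ∧ (cnt (S ∩ T) g : ℝ) ≤ τ) :
    erProb n ev ≤ odds E M ^ τ * ((M + 1) * binProb E M) ^ 2 *
      (2 / (1 + odds E M)) ^ (S ∩ T).card := by
  have hz0 := odds_pos h0 hE
  have := erProb_pair_le h0 hE hS hT (w := odds E M) (c := odds E M ^ τ) hz0 (by positivity) ev
    (fun g hg => ⟨(hev g hg).1, (hev g hg).2.1, by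
      rw [two_mul, pow_add]
      gcongr
      rw [← Real.rpow_natCast]
      exact Real.rpow_le_rpow_of_exponent_le hz1 (hev g hg).2.2⟩)
  have h2 : ((1 + odds E M) / 2) / ((1 + odds E M) / 2) ^ 2 = 2 / (1 + odds E M) := by
    field_simp
  rwa [h2] at this

/-! ### Concentration of edge counts given the total -/

lemma bernoulli_mgf_le {p : ℝ} (hp0 : 0 ≤ p) (hp1 : p ≤ 1) (l : ℝ) :
    1 - p + p * Real.exp l ≤ Real.exp (l * p + l ^ 2 / 8) := by
  let μ : Measure ℝ := ENNReal.ofReal (1 - p) • Measure.dirac 0 + ENNReal.ofReal p • Measure.dirac 1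
  have hμ : IsProbabilityMeasure μ := by
    constructor
    simp only [μ, Measure.coe_add, Measure.coe_smul, Pi.add_apply, Pi.smul_apply, measure_univ,
      smul_eq_mul, mul_one]
    rw [← ENNReal.ofReal_add (by linarith) hp0]
    simp
  have hint : ∀ f : ℝ → ℝ, ∫ x, f x ∂μ = (1 - p) * f 0 + p * f 1 := by
    intro f
    rw [integral_add_measure, integral_smul_measure, integral_smul_measure, integral_dirac,
      integral_dirac, ENNReal.toReal_ofReal (by linarith), ENNReal.toReal_ofReal hp0]
    · simp
    · exact (integrable_dirac (by simp)).smul_measure (by simp)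
    · exact (integrable_dirac (by simp)).smul_measure (by simp)
  have hae : ∀ᵐ x ∂μ, x ∈ Set.Icc (0 : ℝ) 1 := by
    rw [ae_add_measure_iff]
    constructor <;> apply Measure.ae_smul_measure <;> rw [ae_dirac_eq] <;> simp
  have h := (ProbabilityTheory.hasSubgaussianMGF_of_mem_Icc (μ := μ) (X := fun x => x)
    aemeasurable_id hae).mgf_le l
  rw [ProbabilityTheory.mgf, hint, hint] at h
  simp only [mul_zero, mul_one, zero_add, zero_sub, sub_zero, NNReal.coe_pow, NNReal.coe_div,
    coe_nnnorm, norm_one, NNReal.coe_ofNat] at h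
  have h2 : Real.exp (l * p + l ^ 2 / 8) = Real.exp ((1 / 2) ^ 2 * l ^ 2 / 2) * Real.exp (l * p) := by
    rw [← Real.exp_add]; ring_nf
  have h3 : 1 - p + p * Real.exp l =
      ((1 - p) * Real.exp (l * -p) + p * Real.exp (l * (1 - p))) * Real.exp (l * p) := by
    rw [add_mul, mul_assoc, mul_assoc, ← Real.exp_add, ← Real.exp_add]
    ring_nf
    simp
    ring
  rw [h2, h3]
  gcongr

lemma erProb_tail_le {n : ℕ} {S R : Finset (EdgeIdx n)} {E M : ℕ} (h0 : 0 < E)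
    (hE : E < M) (hS : S.card = M) (hR : R ⊆ S) (l τ : ℝ) :
    erProb n (fun g => cnt S g = E ∧ τ ≤ l * (cnt R g - (E / M : ℝ) * R.card)) ≤
      (M + 1) * binProb E M * Real.exp (-τ + l ^ 2 * R.card / 8) := by
  set z := odds E M with hz
  have hz0 : 0 < z := odds_pos h0 hE
  set p : ℝ := (E / M : ℝ) with hp
  have hE' : (E : ℝ) < M := by exact_mod_cast hE
  have hM0 : (0 : ℝ) < M := by linarith [(Nat.cast_nonneg E : (0 : ℝ) ≤ E)]
  have hp0 : 0 ≤ p := by positivity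
  have hp1 : p ≤ 1 := by rw [hp, div_le_one hM0]; exact hE'.le
  have step1 : erProb n (fun g => cnt S g = E ∧ τ ≤ l * (cnt R g - p * R.card)) ≤
      (Real.exp (-l * p * R.card - τ) / z ^ E) *
      (((1 + z * Real.exp l) / 2) ^ R.card * ((1 + z) / 2) ^ (S \ R).card) := by
    rw [← erExp_pow_cnt_mul Finset.disjoint_sdiff, ← erExp_const_mul]
    apply erProb_le_erExp
    · intro g; positivity
    · rintro g ⟨h1, h2⟩
      have hc := cnt_sdiff_add hR g
      have : z ^ E = z ^ cnt R g * z ^ cnt (S \ R) g := by rw [← pow_add, hc, h1]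
      rw [this, mul_pow, ← Real.exp_nat_mul]
      have e1 : Real.exp (-l * p * R.card - τ) / (z ^ cnt R g * z ^ cnt (S \ R) g) *
          (z ^ cnt R g * Real.exp (cnt R g * l) * z ^ cnt (S \ R) g) =
          Real.exp (-l * p * R.card - τ) * Real.exp (cnt R g * l) := by
        field_simp
      rw [e1, ← Real.exp_add]
      apply Real.one_le_exp
      linarith
  have step2 := tilt_le_binProb h0 hE
  rw [← hz] at step2
  have hmgf : (1 + z * Real.exp l) / (1 + z) ≤ Real.exp (l * p + l ^ 2 / 8) := by
    have := bernoulli_mgf_le hp0 hp1 l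
    have e : (1 + z * Real.exp l) / (1 + z) = 1 - p + p * Real.exp l := by
      rw [hz, one_add_odds hE, hp]
      unfold odds
      have : (M : ℝ) - E ≠ 0 := by linarith
      field_simp
    rwa [e]
  have hcard : M = R.card + (S \ R).card := by
    rw [← hS, Finset.card_sdiff_of_subset hR]
    have := Finset.card_le_card hR
    omega
  have hb := binProb_pos hE.le
  calc _ ≤ _ := step1
    _ = (Real.exp (-l * p * R.card - τ) / z ^ E) * ((1 + z * Real.exp l) / (1 + z)) ^ R.card *
        ((1 + z) / 2) ^ M := by
        rw [show ((1 + z) / 2) ^ M = ((1 + z) / 2) ^ (R.card + (S \ R).card) by rw [← hcard],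
          pow_add, div_pow, div_pow (1 + z * Real.exp l) (1 + z), div_pow (1 + z) 2]
        field_simp
        rw [div_pow]
        field_simp
    _ ≤ (Real.exp (-l * p * R.card - τ) / z ^ E) * Real.exp (l * p + l ^ 2 / 8) ^ R.card *
        ((M + 1) * z ^ E * binProb E M) := by gcongr
    _ = (M + 1) * binProb E M *
        (Real.exp (-l * p * R.card - τ) * Real.exp (l * p + l ^ 2 / 8) ^ R.card) := by
        field_simp
    _ = _ := by
        rw [← Real.exp_nat_mul, ← Real.exp_add]
        ring_nf

/-! ### Flat subgraphs are typical among those with the right edge count -/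

lemma DK_nonneg (K ℓ : ℕ) (γ δ : ℝ) : 0 ≤ DK K ℓ γ δ := by
  unfold DK
  split_ifs <;> exact Real.sqrt_nonneg _

lemma log_choose_nonneg (K ℓ : ℕ) : 0 ≤ Real.log (K.choose ℓ : ℝ) := Real.log_natCast_nonneg _

lemma min_choose_two_nonneg {K ℓ : ℕ} (hℓ : ℓ ≤ K) :
    0 ≤ min ((K.choose 2 : ℝ) - (ℓ.choose 2 : ℝ)) (ℓ.choose 2 : ℝ) := by
  apply le_min _ (Nat.cast_nonneg _)
  have : ℓ.choose 2 ≤ K.choose 2 := Nat.choose_le_choose 2 hℓ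
  have : (ℓ.choose 2 : ℝ) ≤ (K.choose 2 : ℝ) := by exact_mod_cast this
  linarith

lemma le_DK_sq {K ℓ : ℕ} {γ δ : ℝ} (hγ : 1 / 2 ≤ γ) (hδ : 0 ≤ δ) (hℓ : ℓ ≤ K) :
    min ((K.choose 2 : ℝ) - (ℓ.choose 2 : ℝ)) (ℓ.choose 2 : ℝ) *
      (Real.log (K.choose ℓ : ℝ) + 2 * Real.log K) ≤ DK K ℓ γ δ ^ 2 := by
  have h1 := min_choose_two_nonneg hℓ
  have h2 : 0 ≤ Real.log (K.choose ℓ : ℝ) + 2 * Real.log K := by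
    have := log_choose_nonneg K ℓ
    have := Real.log_natCast_nonneg K
    linarith
  have h3 := mul_nonneg h1 h2
  have key : ∀ c : ℝ, 1 ≤ c → min ((K.choose 2 : ℝ) - (ℓ.choose 2 : ℝ)) (ℓ.choose 2 : ℝ) *
      (Real.log (K.choose ℓ : ℝ) + 2 * Real.log K) ≤
      Real.sqrt (2 * γ * (c + δ) * min ((K.choose 2 : ℝ) - (ℓ.choose 2 : ℝ)) (ℓ.choose 2 : ℝ) *
        (Real.log (K.choose ℓ : ℝ) + 2 * Real.log K)) ^ 2 := by
    intro c hc
    have h4 : 1 ≤ 2 * γ * (c + δ) := by nlinarith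
    rw [mul_assoc (2 * γ * (c + δ)), Real.sq_sqrt (by positivity)]
    nlinarith
  unfold DK
  split_ifs
  · exact key 2 (by norm_num)
  · exact key 1 (by norm_num)

lemma le_choose_of_mem {K ℓ : ℕ} (h1 : 1 ≤ ℓ) (h2 : ℓ ≤ K - 1) (hK : 1 ≤ K) :
    K ≤ K.choose ℓ := by
  induction K generalizing ℓ with
  | zero => omega
  | succ K ih =>
    obtain ⟨j, rfl⟩ : ∃ j, ℓ = j + 1 := ⟨ℓ - 1, by omega⟩
    rw [Nat.choose_succ_succ']
    rcases Nat.lt_or_ge (j + 1) K with h | h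
    · have := ih (ℓ := j + 1) (by omega) (by omega) (by omega)
      have : 0 < K.choose j := Nat.choose_pos (by omega)
      omega
    · have : j + 1 = K := by omega
      subst this
      simp

lemma erProb_excess_le {n K : ℕ} {γ δ : ℝ} {A B : Finset (Fin n)} (hA : A.card = K)
    (hBA : B ⊆ A) (hB2 : 2 ≤ B.card) (hBK : B.card ≤ K - 1) (hγ : 1 / 2 ≤ γ) (hδ : 0 ≤ δ)
    (hK : 100 ≤ 3 * Real.log K) (hE : ⌈γ * (K.choose 2 : ℝ)⌉₊ < K.choose 2) :
    erProb n (fun g => edgeCount g A = ⌈γ * (K.choose 2 : ℝ)⌉₊ ∧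
        (⌈γ * (B.card.choose 2 : ℝ)⌉₊ : ℝ) + DK K B.card γ δ < edgeCount g B) ≤
      ((K.choose 2 : ℕ) + 1) * binProb ⌈γ * (K.choose 2 : ℝ)⌉₊ (K.choose 2) *
        Real.exp (-(3 / 2) * (Real.log (K.choose B.card : ℝ) + 2 * Real.log K)) := by
  set M := K.choose 2 with hM
  set E := ⌈γ * (M : ℝ)⌉₊ with hEdef
  set ℓ := B.card with hℓ
  set m := ℓ.choose 2 with hm
  set D := DK K ℓ γ δ with hD
  set Λ := Real.log (K.choose ℓ : ℝ) + 2 * Real.log K with hΛ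
  set p : ℝ := (E / M : ℝ) with hp
  have hK1 : 1 ≤ K := by omega
  have hm1 : 1 ≤ m := Nat.choose_pos hB2
  have hmM : m + 1 ≤ M := by
    have h1 : m ≤ (K - 1).choose 2 := Nat.choose_le_choose 2 hBK
    have h2 : K.choose 2 = (K - 1).choose 1 + (K - 1).choose 2 := by
      conv_lhs => rw [show K = (K - 1) + 1 by omega]
      exact Nat.choose_succ_succ _ _
    rw [Nat.choose_one_right] at h2
    omega
  have hmR : (1 : ℝ) ≤ m := by exact_mod_cast hm1
  have hmMR : (m : ℝ) + 1 ≤ M := by exact_mod_cast hmM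
  have hM0 : (0 : ℝ) < M := by linarith
  have hE0 : 0 < E := by
    rw [hEdef, Nat.ceil_pos]
    have : (0 : ℝ) < γ := by linarith
    positivity
  have hpm : p * m ≤ γ * m + 1 := by
    have h1 : (E : ℝ) < γ * M + 1 := Nat.ceil_lt_add_one (by positivity)
    have h2 : p ≤ γ + 1 / M := by
      rw [hp, div_le_iff₀ hM0]
      have : (γ + 1 / (M : ℝ)) * M = γ * M + 1 := by field_simp
      linarith
    calc p * m ≤ (γ + 1 / M) * m := by gcongr
      _ = γ * m + m / M := by ring
      _ ≤ γ * m + 1 := by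
        have : (m : ℝ) / M ≤ 1 := by rw [div_le_one hM0]; linarith
        linarith
  set μ : ℝ := min ((M : ℝ) - m) m with hμ
  have hμ1 : 1 ≤ μ := le_min (by linarith) hmR
  have hD2 : μ * Λ ≤ D ^ 2 := le_DK_sq hγ hδ (by omega)
  have hΛ1 : 100 ≤ Λ := by
    have h1 := le_choose_of_mem (by omega : 1 ≤ ℓ) hBK hK1
    have h2 : Real.log K ≤ Real.log (K.choose ℓ : ℝ) :=
      Real.log_le_log (by exact_mod_cast hK1) (by exact_mod_cast h1)
    rw [hΛ]; linarith
  have hD0 : 0 ≤ D := DK_nonneg _ _ _ _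
  have hD10 : 10 ≤ D := by nlinarith
  set t := D - 1 with ht
  have ht2 : 3 / 2 * Λ * μ ≤ 2 * t ^ 2 := by nlinarith
  have hAc : (edgeSlots A).card = M := by rw [card_edgeSlots, hA]
  have hBc : (edgeSlots B).card = m := by rw [card_edgeSlots]
  have hsub : edgeSlots B ⊆ edgeSlots A := edgeSlots_mono hBA
  have hb := binProb_pos hE.le
  have fin : ∀ (s : ℝ), s = μ → 1 ≤ s →
      ((M : ℝ) + 1) * binProb E M * Real.exp (-(4 * t ^ 2 / s) + (4 * t / s) ^ 2 * s / 8) ≤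
      ((M : ℝ) + 1) * binProb E M * Real.exp (-(3 / 2) * Λ) := by
    intro s hs hs1
    have hs0 : (0 : ℝ) < s := by linarith
    have e : -(4 * t ^ 2 / s) + (4 * t / s) ^ 2 * s / 8 = -(2 * t ^ 2 / s) := by
      field_simp
      ring
    rw [e]
    have : 3 / 2 * Λ ≤ 2 * t ^ 2 / s := by
      rw [le_div_iff₀ hs0, hs]; exact ht2
    gcongr
    linarith
  rcases le_total (m : ℝ) ((M : ℝ) - m) with hle | hle
  · refine le_trans (erProb_mono (t := fun g => cnt (edgeSlots A) g = E ∧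
      4 * t ^ 2 / m ≤ (4 * t / m) * (cnt (edgeSlots B) g - (E / M : ℝ) * (edgeSlots B).card)) ?_) ?_
    · rintro g ⟨h1, h2⟩
      refine ⟨by rw [← edgeCount_eq_cnt]; exact h1, ?_⟩
      rw [hBc, ← edgeCount_eq_cnt]
      have h3 : γ * m ≤ (⌈γ * (m : ℝ)⌉₊ : ℝ) := Nat.le_ceil _
      have h4 : t ≤ (edgeCount g B : ℝ) - E / M * m := by rw [← hp]; linarith
      have h5 : 0 ≤ 4 * t / m := by apply div_nonneg _ (by linarith); linarith
      calc 4 * t ^ 2 / m = 4 * t / m * t := by ring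
        _ ≤ _ := by gcongr
    · refine le_trans (erProb_tail_le hE0 hE hAc hsub _ _) ?_
      rw [hBc]
      exact fin m (by rw [hμ, min_eq_right hle]) hmR
  · have hRc : (edgeSlots A \ edgeSlots B).card = M - m := by
      rw [Finset.card_sdiff_of_subset hsub, hAc, hBc]
    have hcast : ((M - m : ℕ) : ℝ) = (M : ℝ) - m := by rw [Nat.cast_sub (by omega)]
    have hs1 : (1 : ℝ) ≤ (M : ℝ) - m := by linarith
    refine le_trans (erProb_mono (t := fun g => cnt (edgeSlots A) g = E ∧
      4 * t ^ 2 / ((M : ℝ) - m) ≤ (-(4 * t / ((M : ℝ) - m))) *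
        (cnt (edgeSlots A \ edgeSlots B) g - (E / M : ℝ) * (edgeSlots A \ edgeSlots B).card)) ?_) ?_
    · rintro g ⟨h1, h2⟩
      rw [edgeCount_eq_cnt] at h1
      refine ⟨h1, ?_⟩
      have hc := cnt_sdiff_add hsub g
      rw [h1, ← edgeCount_eq_cnt] at hc
      have hcR : (edgeCount g B : ℝ) + cnt (edgeSlots A \ edgeSlots B) g = E := by exact_mod_cast hc
      rw [hRc, hcast]
      have h3 : γ * m ≤ (⌈γ * (m : ℝ)⌉₊ : ℝ) := Nat.le_ceil _
      have h6 : E / M * ((M : ℝ) - m) = E - p * m := by rw [hp]; field_simp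
      have h4 : t ≤ -((cnt (edgeSlots A \ edgeSlots B) g : ℝ) - E / M * ((M : ℝ) - m)) := by
        rw [h6]; linarith
      have h5 : 0 ≤ 4 * t / ((M : ℝ) - m) := by apply div_nonneg _ (by linarith); linarith
      calc 4 * t ^ 2 / ((M : ℝ) - m) = 4 * t / ((M : ℝ) - m) * t := by ring
        _ ≤ 4 * t / ((M : ℝ) - m) *
          -((cnt (edgeSlots A \ edgeSlots B) g : ℝ) - E / M * ((M : ℝ) - m)) := by gcongr
        _ = _ := by ring
    · refine le_trans (erProb_tail_le hE0 hE hAc Finset.sdiff_subset _ _) ?_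
      rw [hRc, hcast, neg_sq]
      exact fin _ (by rw [hμ, min_eq_left hle]) hs1

lemma half_binProb_le_erProb_flat {n K : ℕ} {γ δ : ℝ} {A : Finset (Fin n)} (hA : A.card = K)
    (hγ : 1 / 2 ≤ γ) (hδ : 0 ≤ δ)
    (hK : 100 ≤ 3 * Real.log K) (hE : ⌈γ * (K.choose 2 : ℝ)⌉₊ < K.choose 2) :
    binProb ⌈γ * (K.choose 2 : ℝ)⌉₊ (K.choose 2) / 2 ≤
      erProb n (fun g => IsFlatOn g K γ δ A) := by
  set M := K.choose 2 with hM
  set E := ⌈γ * (M : ℝ)⌉₊ with hEdef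
  have hK0 : 0 < K := by
    rcases Nat.eq_zero_or_pos K with h | h
    · rw [h] at hK; norm_num at hK
    · exact h
  have hKR : (0 : ℝ) < K := by exact_mod_cast hK0
  have hK4 : (4 : ℝ) ≤ K := by
    by_contra h
    have : Real.log K ≤ K - 1 := Real.log_le_sub_one_of_pos hKR
    linarith
  have hb := binProb_pos hE.le
  set F := A.powerset.filter (fun B => 2 ≤ B.card ∧ B.card ≤ K - 1) with hF
  have h1 : binProb E M ≤ erProb n (fun g => IsFlatOn g K γ δ A) + ∑ B ∈ F,
      erProb n (fun g => edgeCount g A = E ∧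
        (⌈γ * (B.card.choose 2 : ℝ)⌉₊ : ℝ) + DK K B.card γ δ < edgeCount g B) := by
    rw [← erProb_cnt_eq_binProb (n := n) (S := edgeSlots A) (by rw [card_edgeSlots, hA])]
    apply erProb_le_add_sum
    intro g hg
    rw [← edgeCount_eq_cnt] at hg
    by_cases h : ∃ B ∈ F, edgeCount g A = E ∧
        (⌈γ * (B.card.choose 2 : ℝ)⌉₊ : ℝ) + DK K B.card γ δ < edgeCount g B
    · exact Or.inr h
    · left
      refine ⟨hg, fun B hBA hB2 hBK => ?_⟩
      by_contra hlt
      exact h ⟨B, by simp [hF, hBA, hB2, hBK], hg, not_le.mp hlt⟩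
  have hMK : (M : ℝ) + 1 ≤ (K : ℝ) ^ 2 := by
    rw [hM, Nat.cast_choose_two]
    nlinarith
  have h2 : ∑ B ∈ F, erProb n (fun g => edgeCount g A = E ∧
        (⌈γ * (B.card.choose 2 : ℝ)⌉₊ : ℝ) + DK K B.card γ δ < edgeCount g B) ≤ binProb E M / 2 := by
    calc _ ≤ ∑ B ∈ F, ((M : ℝ) + 1) * binProb E M *
        Real.exp (-(3 / 2) * (Real.log (K.choose B.card : ℝ) + 2 * Real.log K)) := by
          apply Finset.sum_le_sum
          intro B hB
          simp only [hF, Finset.mem_filter, Finset.mem_powerset] at hB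
          exact erProb_excess_le hA hB.1 hB.2.1 hB.2.2 hγ hδ hK hE
      _ = ∑ ℓ ∈ Finset.Icc 2 (K - 1), ∑ B ∈ F.filter (fun B => B.card = ℓ),
          ((M : ℝ) + 1) * binProb E M *
          Real.exp (-(3 / 2) * (Real.log (K.choose B.card : ℝ) + 2 * Real.log K)) := by
          rw [Finset.sum_fiberwise_of_maps_to]
          intro B hB
          simp only [hF, Finset.mem_filter, Finset.mem_powerset] at hB
          simp [hB.2]
      _ ≤ ∑ ℓ ∈ Finset.Icc 2 (K - 1), (binProb E M * (1 / (2 * K))) := by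
          apply Finset.sum_le_sum
          intro ℓ hℓ
          rw [Finset.mem_Icc] at hℓ
          have hch : K ≤ K.choose ℓ := le_choose_of_mem (by omega) hℓ.2 hK0
          have hchR : (K : ℝ) ≤ (K.choose ℓ : ℝ) := by exact_mod_cast hch
          have hch0 : (0 : ℝ) < (K.choose ℓ : ℝ) := by linarith
          have hcard : ((F.filter (fun B => B.card = ℓ)).card : ℝ) ≤ (K.choose ℓ : ℝ) := by
            have : F.filter (fun B => B.card = ℓ) ⊆ Finset.powersetCard ℓ A := by
              intro B hB
              simp only [hF, Finset.mem_filter, Finset.mem_powerset] at hB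
              rw [Finset.mem_powersetCard]
              exact ⟨hB.1.1, hB.2⟩
            have := Finset.card_le_card this
            rw [Finset.card_powersetCard, hA] at this
            exact_mod_cast this
          have hexp : Real.exp (-(3 / 2) * (Real.log (K.choose ℓ : ℝ) + 2 * Real.log K)) =
              Real.exp (-(1 / 2) * Real.log (K.choose ℓ : ℝ)) / ((K.choose ℓ : ℝ) * (K : ℝ) ^ 3) := by
            have hprod : (K.choose ℓ : ℝ) * (K : ℝ) ^ 3 =
                Real.exp (Real.log (K.choose ℓ : ℝ) + 3 * Real.log K) := by
              rw [Real.exp_add, Real.exp_log hch0, ← Real.log_rpow hKR,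
                Real.exp_log (by positivity)]
              norm_cast
            rw [eq_div_iff (by positivity), hprod, ← Real.exp_add]
            congr 1
            ring
          have hhalf : Real.exp (-(1 / 2) * Real.log (K.choose ℓ : ℝ)) ≤ 1 / 2 := by
            have : Real.log 4 ≤ Real.log (K.choose ℓ : ℝ) :=
              Real.log_le_log (by norm_num) (by linarith)
            have h4 : Real.log 4 = 2 * Real.log 2 := by
              rw [show (4 : ℝ) = 2 ^ 2 by norm_num, Real.log_pow]; norm_num
            calc _ ≤ Real.exp (-Real.log 2) := by
                  apply Real.exp_le_exp.mpr; linarith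
              _ = 1 / 2 := by rw [Real.exp_neg, Real.exp_log (by norm_num)]; norm_num
          calc _ = ∑ B ∈ F.filter (fun B => B.card = ℓ), ((M : ℝ) + 1) * binProb E M *
                Real.exp (-(3 / 2) * (Real.log (K.choose ℓ : ℝ) + 2 * Real.log K)) := by
                apply Finset.sum_congr rfl
                intro B hB
                rw [(Finset.mem_filter.mp hB).2]
            _ = ((F.filter (fun B => B.card = ℓ)).card : ℝ) * (((M : ℝ) + 1) * binProb E M *
                Real.exp (-(3 / 2) * (Real.log (K.choose ℓ : ℝ) + 2 * Real.log K))) := by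
                rw [Finset.sum_const, nsmul_eq_mul]
            _ ≤ (K.choose ℓ : ℝ) * ((K : ℝ) ^ 2 * binProb E M *
                ((1 / 2) / ((K.choose ℓ : ℝ) * (K : ℝ) ^ 3))) := by
                rw [hexp]
                gcongr
            _ = _ := by field_simp
      _ = ((K - 1 + 1 - 2 : ℕ) : ℝ) * (binProb E M * (1 / (2 * K))) := by
          rw [Finset.sum_const, Nat.card_Icc, nsmul_eq_mul]
      _ ≤ (K : ℝ) * (binProb E M * (1 / (2 * K))) := by
          gcongr
          omega
      _ = _ := by field_simp
  linarith

/-! ### The second moment -/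

lemma erExp_flatCount {n K : ℕ} {γ δ : ℝ} :
    erExp n (fun g => (flatCount n K γ δ g : ℝ)) =
      ∑ A ∈ Finset.powersetCard K (Finset.univ : Finset (Fin n)),
        erProb n (fun g => IsFlatOn g K γ δ A) := by
  classical
  unfold erProb
  rw [← erExp_sum]
  congr 1
  funext g
  rw [flatCount, Finset.card_filter]
  push_cast
  rfl

lemma erExp_flatCount_sq {n K : ℕ} {γ δ : ℝ} :
    erExp n (fun g => (flatCount n K γ δ g : ℝ) ^ 2) =
      ∑ A ∈ Finset.powersetCard K (Finset.univ : Finset (Fin n)),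
      ∑ B ∈ Finset.powersetCard K (Finset.univ : Finset (Fin n)),
        erProb n (fun g => IsFlatOn g K γ δ A ∧ IsFlatOn g K γ δ B) := by
  classical
  unfold erProb
  simp_rw [← erExp_sum]
  congr 1
  funext g
  rw [flatCount, Finset.card_filter, sq]
  push_cast
  rw [Finset.sum_mul_sum]
  apply Finset.sum_congr rfl
  intro A _
  apply Finset.sum_congr rfl
  intro B _
  by_cases h1 : IsFlatOn g K γ δ A <;> by_cases h2 : IsFlatOn g K γ δ B <;> simp [h1, h2]

lemma card_filter_card_inter_le {n K ℓ : ℕ} {A : Finset (Fin n)} (hA : A.card = K) :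
    ((Finset.powersetCard K (Finset.univ : Finset (Fin n))).filter
      (fun B => (A ∩ B).card = ℓ)).card ≤ K.choose ℓ * (n - K).choose (K - ℓ) := by
  have h1 : (Finset.powersetCard ℓ A ×ˢ Finset.powersetCard (K - ℓ) Aᶜ).card =
      K.choose ℓ * (n - K).choose (K - ℓ) := by
    rw [Finset.card_product, Finset.card_powersetCard, Finset.card_powersetCard, hA,
      Finset.card_compl, hA, Fintype.card_fin]
  rw [← h1]
  apply Finset.card_le_card_of_injOn (fun B => (A ∩ B, B \ A))
  · intro B hB
    simp only [Finset.coe_filter, Finset.mem_powersetCard, Finset.subset_univ, true_and,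
      Set.mem_ofPred_eq] at hB
    simp only [Finset.coe_product, Set.mem_prod, Finset.mem_coe, Finset.mem_powersetCard]
    refine ⟨⟨Finset.inter_subset_left, hB.2⟩, ?_, ?_⟩
    · intro x hx
      simp at hx ⊢
      exact hx.2
    · have := Finset.card_sdiff_add_card_inter B A
      rw [Finset.inter_comm] at this
      omega
  · intro B _ B' _ h
    simp only [Prod.mk.injEq] at h
    ext x
    have h1 := Finset.ext_iff.mp h.1 x
    have h2 := Finset.ext_iff.mp h.2 x
    simp at h1 h2
    tauto

lemma erProb_flat_le {n K : ℕ} {γ δ : ℝ} {A : Finset (Fin n)} (hA : A.card = K) :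
    erProb n (fun g => IsFlatOn g K γ δ A) ≤
      binProb ⌈γ * (K.choose 2 : ℝ)⌉₊ (K.choose 2) := by
  rw [← erProb_cnt_eq_binProb (n := n) (S := edgeSlots A) (by rw [card_edgeSlots, hA])]
  apply erProb_mono
  intro g hg
  rw [← edgeCount_eq_cnt]
  exact hg.1

lemma erProb_flat_pair_le {n K : ℕ} {γ δ : ℝ} (A B : Finset (Fin n)) :
    erProb n (fun g => IsFlatOn g K γ δ A ∧ IsFlatOn g K γ δ B) ≤
      2 ^ ((A ∩ B).card.choose 2) * (erProb n (fun g => IsFlatOn g K γ δ A) *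
        erProb n (fun g => IsFlatOn g K γ δ B)) := by
  rw [← card_edgeSlots, ← edgeSlots_inter]
  have key : ∀ A : Finset (Fin n), ∀ g g' : ERGraph n, (∀ e ∈ edgeSlots A, g e = g' e) →
      (IsFlatOn g K γ δ A → IsFlatOn g' K γ δ A) := by
    intro A g g' h hg
    have hc : ∀ B ⊆ A, edgeCount g B = edgeCount g' B := by
      intro B hB
      rw [edgeCount_eq_cnt, edgeCount_eq_cnt]
      exact cnt_congr fun e he => h e (edgeSlots_mono hB he)
    refine ⟨by rw [← hc A subset_rfl]; exact hg.1, fun B hB h2 hK => ?_⟩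
    rw [← hc B hB]
    exact hg.2 B hB h2 hK
  exact erProb_and_le (key A) (key B)

lemma erExp_flatCount_sq_le {n K : ℕ} {γ δ : ℝ} {ρ : ℕ → ℝ} (hKn : K ≤ n)
    (hγ : 1 / 2 ≤ γ) (hδ : 0 ≤ δ) (hK : 100 ≤ 3 * Real.log K)
    (hE : ⌈γ * (K.choose 2 : ℝ)⌉₊ < K.choose 2) (hρ0 : ∀ ℓ, 0 ≤ ρ ℓ)
    (hρ : ∀ A B : Finset (Fin n), A.card = K → B.card = K → 2 ≤ (A ∩ B).card →
      erProb n (fun g => IsFlatOn g K γ δ A ∧ IsFlatOn g K γ δ B) ≤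
        ρ (A ∩ B).card * binProb ⌈γ * (K.choose 2 : ℝ)⌉₊ (K.choose 2) ^ 2) :
    erExp n (fun g => (flatCount n K γ δ g : ℝ) ^ 2) ≤
      erExp n (fun g => (flatCount n K γ δ g : ℝ)) ^ 2 * (1 + 4 * ∑ ℓ ∈ Finset.Icc 2 K,
        ((K.choose ℓ : ℝ) * ((n - K).choose (K - ℓ) : ℝ) / (n.choose K : ℝ)) * ρ ℓ) := by
  classical
  set q := binProb ⌈γ * (K.choose 2 : ℝ)⌉₊ (K.choose 2) with hq
  have hq0 : 0 < q := binProb_pos hE.le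
  set W := Finset.powersetCard K (Finset.univ : Finset (Fin n)) with hW
  have hWc : W.card = n.choose K := by rw [hW, Finset.card_powersetCard, Finset.card_fin]
  have hWm : ∀ A ∈ W, A.card = K := fun A hA => (Finset.mem_powersetCard.mp hA).2
  set a : Finset (Fin n) → ℝ := fun A => erProb n (fun g => IsFlatOn g K γ δ A) with ha
  have hN0 : (0 : ℝ) < (n.choose K : ℝ) := by exact_mod_cast Nat.choose_pos hKn
  set X := ∑ A ∈ W, a A with hX
  have hXlow : (n.choose K : ℝ) * q ≤ 2 * X := by
    have : ∑ A ∈ W, q / 2 ≤ X :=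
      Finset.sum_le_sum fun A hA => half_binProb_le_erProb_flat (hWm A hA) hγ hδ hK hE
    rw [Finset.sum_const, nsmul_eq_mul, hWc] at this
    linarith
  rw [erExp_flatCount, erExp_flatCount_sq]
  have hpt : ∀ A ∈ W, ∀ B ∈ W, erProb n (fun g => IsFlatOn g K γ δ A ∧ IsFlatOn g K γ δ B) ≤
      a A * a B + if 2 ≤ (A ∩ B).card then ρ (A ∩ B).card * q ^ 2 else 0 := by
    intro A hA B hB
    split_ifs with h
    · have := hρ A B (hWm A hA) (hWm B hB) h
      have := mul_nonneg (erProb_nonneg (fun g : ERGraph n => IsFlatOn g K γ δ A))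
        (erProb_nonneg (fun g : ERGraph n => IsFlatOn g K γ δ B))
      simp only [ha]
      linarith
    · have := erProb_flat_pair_le (K := K) (γ := γ) (δ := δ) A B
      rw [Nat.choose_eq_zero_of_lt (by omega), pow_zero, one_mul] at this
      simpa using this
  have hrow : ∀ A ∈ W, ∑ B ∈ W, (if 2 ≤ (A ∩ B).card then ρ (A ∩ B).card * q ^ 2 else 0) ≤
      ∑ ℓ ∈ Finset.Icc 2 K, (K.choose ℓ : ℝ) * ((n - K).choose (K - ℓ) : ℝ) * (ρ ℓ * q ^ 2) := by
    intro A hA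
    rw [← Finset.sum_filter]
    rw [← Finset.sum_fiberwise_of_maps_to (g := fun B => (A ∩ B).card) (t := Finset.Icc 2 K)]
    · apply Finset.sum_le_sum
      intro ℓ hℓ
      calc _ = ∑ B ∈ (W.filter (fun B => 2 ≤ (A ∩ B).card)).filter (fun B => (A ∩ B).card = ℓ),
            ρ ℓ * q ^ 2 := by
            apply Finset.sum_congr rfl
            intro B hB
            rw [(Finset.mem_filter.mp hB).2]
        _ = (((W.filter (fun B => 2 ≤ (A ∩ B).card)).filter
              (fun B => (A ∩ B).card = ℓ)).card : ℝ) * (ρ ℓ * q ^ 2) := by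
            rw [Finset.sum_const, nsmul_eq_mul]
        _ ≤ _ := by
            have h1 : ((W.filter (fun B => 2 ≤ (A ∩ B).card)).filter
              (fun B => (A ∩ B).card = ℓ)).card ≤ K.choose ℓ * (n - K).choose (K - ℓ) := by
              refine le_trans (Finset.card_le_card ?_) (card_filter_card_inter_le (hWm A hA))
              exact Finset.filter_subset_filter _ (Finset.filter_subset _ _)
            have h2 : (((W.filter (fun B => 2 ≤ (A ∩ B).card)).filter
              (fun B => (A ∩ B).card = ℓ)).card : ℝ) ≤
                (K.choose ℓ : ℝ) * ((n - K).choose (K - ℓ) : ℝ) := by exact_mod_cast h1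
            have := hρ0 ℓ
            gcongr
    · intro B hB
      rw [Finset.mem_filter] at hB
      rw [Finset.mem_Icc]
      refine ⟨hB.2, ?_⟩
      rw [← hWm A hA]
      exact Finset.card_le_card Finset.inter_subset_left
  set ov := ∑ ℓ ∈ Finset.Icc 2 K,
        ((K.choose ℓ : ℝ) * ((n - K).choose (K - ℓ) : ℝ) / (n.choose K : ℝ)) * ρ ℓ with hS
  have hS0 : 0 ≤ ov := by
    apply Finset.sum_nonneg
    intro ℓ _
    have := hρ0 ℓ
    positivity
  have hSrow : ∑ ℓ ∈ Finset.Icc 2 K, (K.choose ℓ : ℝ) * ((n - K).choose (K - ℓ) : ℝ) * (ρ ℓ * q ^ 2)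
      = (n.choose K : ℝ) * q ^ 2 * ov := by
    rw [hS, Finset.mul_sum]
    apply Finset.sum_congr rfl
    intro ℓ _
    field_simp
  calc _ ≤ ∑ A ∈ W, ∑ B ∈ W, (a A * a B +
        if 2 ≤ (A ∩ B).card then ρ (A ∩ B).card * q ^ 2 else 0) :=
        Finset.sum_le_sum fun A hA => Finset.sum_le_sum fun B hB => hpt A hA B hB
    _ = X ^ 2 + ∑ A ∈ W, ∑ B ∈ W,
        (if 2 ≤ (A ∩ B).card then ρ (A ∩ B).card * q ^ 2 else 0) := by
        simp_rw [Finset.sum_add_distrib]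
        rw [sq X, hX, Finset.sum_mul_sum]
    _ ≤ X ^ 2 + ∑ A ∈ W, (n.choose K : ℝ) * q ^ 2 * ov := by
        gcongr with A hA
        rw [← hSrow]
        exact hrow A hA
    _ = X ^ 2 + ((n.choose K : ℝ) * q) ^ 2 * ov := by
        rw [Finset.sum_const, nsmul_eq_mul, hWc]; ring
    _ ≤ X ^ 2 + (2 * X) ^ 2 * ov := by gcongr
    _ = _ := by ring

lemma erExp_flatCount_pos {n K : ℕ} {γ δ : ℝ} (hKn : K ≤ n)
    (hγ : 1 / 2 ≤ γ) (hδ : 0 ≤ δ) (hK : 100 ≤ 3 * Real.log K)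
    (hE : ⌈γ * (K.choose 2 : ℝ)⌉₊ < K.choose 2) :
    0 < erExp n (fun g => (flatCount n K γ δ g : ℝ)) := by
  rw [erExp_flatCount]
  apply Finset.sum_pos
  · intro A hA
    have := half_binProb_le_erProb_flat (n := n) (δ := δ) (Finset.mem_powersetCard.mp hA).2 hγ hδ hK hE
    have := binProb_pos hE.le
    linarith
  · rw [Finset.powersetCard_nonempty, Finset.card_fin]
    exact hKn

lemma sq_erExp_le {n : ℕ} (f : ERGraph n → ℝ) (s : ERGraph n → Prop) (hf : ∀ g, ¬ s g → f g = 0) :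
    erExp n f ^ 2 ≤ erExp n (fun g => f g ^ 2) * erProb n s := by
  classical
  unfold erProb erExp
  rw [div_pow, div_mul_div_comm, ← sq]
  gcongr
  calc (∑ g, f g) ^ 2 = (∑ g, f g * (if s g then 1 else 0)) ^ 2 := by
        congr 1
        apply Finset.sum_congr rfl
        intro g _
        by_cases h : s g
        · simp [h]
        · simp [h, hf g h]
    _ ≤ (∑ g, f g ^ 2) * ∑ g, (if s g then (1 : ℝ) else 0) ^ 2 := Finset.sum_mul_sq_le_sq_mul_sq _ _ _
    _ = _ := by simp

lemma erMeasure_eq_erProb {n : ℕ} (s : ERGraph n → Prop) :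
    erMeasure n {g | s g} = ENNReal.ofReal (erProb n s) := by
  classical
  unfold erMeasure
  rw [PMF.toMeasure_uniformOfFintype_apply _ (Set.toFinite _).measurableSet, erProb_eq_card]
  rw [ENNReal.ofReal_div_of_pos (by exact_mod_cast Fintype.card_pos), ENNReal.ofReal_natCast,
    ENNReal.ofReal_natCast]
  congr 2
  rw [Fintype.card_subtype]
  congr 1

lemma flatCount_le_denseCount {n K : ℕ} {γ δ : ℝ} (g : ERGraph n) :
    flatCount n K γ δ g ≤ denseCount n K γ g := by
  classical
  apply Finset.card_le_card
  intro A hA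
  rw [Finset.mem_filter] at hA ⊢
  refine ⟨hA.1, ?_⟩
  rw [hA.2.1]
  exact Nat.le_ceil _

/-! ### Binomial coefficient estimates -/

lemma choose_mul_pow_le {K n : ℕ} (hKn : K ≤ n) (ℓ : ℕ) :
    K.choose ℓ * n ^ ℓ ≤ n.choose ℓ * K ^ ℓ := by
  induction ℓ with
  | zero => simp
  | succ ℓ ih =>
    have h1 := Nat.choose_succ_right_eq K ℓ
    have h2 := Nat.choose_succ_right_eq n ℓ
    have h3 : (K - ℓ) * n ≤ (n - ℓ) * K := by
      rw [Nat.sub_mul, Nat.sub_mul, mul_comm n K]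
      have : ℓ * K ≤ ℓ * n := Nat.mul_le_mul_left _ hKn
      omega
    have h4 : K.choose (ℓ + 1) * n ^ (ℓ + 1) * (ℓ + 1) ≤
        n.choose (ℓ + 1) * K ^ (ℓ + 1) * (ℓ + 1) := by
      calc _ = (K.choose (ℓ + 1) * (ℓ + 1)) * n ^ ℓ * n := by ring
        _ = (K.choose ℓ * n ^ ℓ) * ((K - ℓ) * n) := by rw [h1]; ring
        _ ≤ (n.choose ℓ * K ^ ℓ) * ((n - ℓ) * K) := Nat.mul_le_mul ih h3
        _ = (n.choose (ℓ + 1) * (ℓ + 1)) * K ^ ℓ * K := by rw [h2]; ring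
        _ = _ := by ring
    exact Nat.le_of_mul_le_mul_right h4 (by omega)

lemma choose_sub_div_choose_le {K n ℓ : ℕ} (hKn : K ≤ n) (hℓ : ℓ ≤ K) (hn : 0 < n) :
    ((n - K).choose (K - ℓ) : ℝ) / (n.choose K : ℝ) ≤ ((K : ℝ) / n) ^ ℓ := by
  have h1 : (n - K).choose (K - ℓ) ≤ (n - ℓ).choose (K - ℓ) := Nat.choose_le_choose _ (by omega)
  have h2 := Nat.choose_mul (n := n) hℓ
  have h3 := choose_mul_pow_le hKn ℓ
  have h4 : 0 < n.choose ℓ := Nat.choose_pos (by omega)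
  have h5 : (n - K).choose (K - ℓ) * n ^ ℓ ≤ K ^ ℓ * n.choose K := by
    apply Nat.le_of_mul_le_mul_right _ h4
    calc (n - K).choose (K - ℓ) * n ^ ℓ * n.choose ℓ
        ≤ (n - ℓ).choose (K - ℓ) * n ^ ℓ * n.choose ℓ := by gcongr
      _ = (n.choose ℓ * (n - ℓ).choose (K - ℓ)) * n ^ ℓ := by ring
      _ = n.choose K * (K.choose ℓ * n ^ ℓ) := by rw [← h2]; ring
      _ ≤ n.choose K * (n.choose ℓ * K ^ ℓ) := by gcongr
      _ = _ := by ring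
  have h6 : (0 : ℝ) < n.choose K := by exact_mod_cast Nat.choose_pos hKn
  have h7 : (0 : ℝ) < n := by exact_mod_cast hn
  rw [div_pow, div_le_div_iff₀ h6 (by positivity)]
  exact_mod_cast h5

lemma log_choose_le {n y : ℕ} (hy : 1 ≤ y) (hn : y ≤ n) :
    Real.log (n.choose y : ℝ) ≤ y * (1 + Real.log (n / y)) := by
  have h1 : (n.choose y : ℝ) ≤ (n : ℝ) ^ y / (y.factorial : ℝ) := Nat.choose_le_pow_div y n
  have hy0 : (0 : ℝ) < y := by exact_mod_cast hy
  have hn0 : (0 : ℝ) < n := by exact_mod_cast (by omega : 0 < n)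
  have h2 : (y : ℝ) ^ y / (y.factorial : ℝ) ≤ Real.exp y :=
    Real.pow_div_factorial_le_exp (y : ℝ) hy0.le y
  have hc0 : (0 : ℝ) < n.choose y := by exact_mod_cast Nat.choose_pos hn
  have h3 : (n.choose y : ℝ) ≤ Real.exp y * ((n : ℝ) / y) ^ y := by
    calc (n.choose y : ℝ) ≤ (n : ℝ) ^ y / (y.factorial : ℝ) := h1
      _ = ((y : ℝ) ^ y / (y.factorial : ℝ)) * ((n : ℝ) / y) ^ y := by
        rw [div_pow]; field_simp
      _ ≤ _ := by gcongr
  calc Real.log (n.choose y : ℝ) ≤ Real.log (Real.exp y * ((n : ℝ) / y) ^ y) :=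
        Real.log_le_log hc0 h3
    _ = _ := by
        rw [Real.log_mul (by positivity) (by positivity), Real.log_exp, Real.log_pow]
        ring

lemma log_choose_le_mul_log {n y : ℕ} (hn : y ≤ n) :
    Real.log (n.choose y : ℝ) ≤ y * Real.log n := by
  have hc0 : (0 : ℝ) < n.choose y := by exact_mod_cast Nat.choose_pos hn
  rw [← Real.log_pow]
  apply Real.log_le_log hc0
  exact_mod_cast Nat.choose_le_pow n y

lemma mul_log_div_le_log_choose {K n : ℕ} (hK : 1 ≤ K) (hKn : K ≤ n) :
    K * Real.log (n / K) ≤ Real.log (n.choose K : ℝ) := by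
  have h := choose_mul_pow_le hKn K
  rw [Nat.choose_self, one_mul] at h
  have hK0 : (0 : ℝ) < K := by exact_mod_cast hK
  have hn0 : (0 : ℝ) < n := by exact_mod_cast (by omega : 0 < n)
  rw [← Real.log_pow]
  apply Real.log_le_log (by positivity)
  rw [div_pow, div_le_iff₀ (by positivity)]
  exact_mod_cast h

/-! ### The entropy deficit -/

/-- The entropy deficit `log 2 - h(x)`. -/
def entDeficit (x : ℝ) : ℝ := Real.log 2 - binEnt x

lemma gibbs {a b : ℝ} (ha0 : 0 < a) (ha1 : a < 1) (hb0 : 0 < b) (hb1 : b < 1) :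
    a * Real.log b + (1 - a) * Real.log (1 - b) ≤ a * Real.log a + (1 - a) * Real.log (1 - a) := by
  have h1 : Real.log (b / a) ≤ b / a - 1 := Real.log_le_sub_one_of_pos (by positivity)
  have h2 : Real.log ((1 - b) / (1 - a)) ≤ (1 - b) / (1 - a) - 1 :=
    Real.log_le_sub_one_of_pos (div_pos (by linarith) (by linarith))
  rw [Real.log_div hb0.ne' ha0.ne'] at h1
  rw [Real.log_div (by linarith) (by linarith)] at h2
  have h3 : a * (Real.log b - Real.log a) ≤ a * (b / a - 1) := by gcongr
  have h4 : (1 - a) * (Real.log (1 - b) - Real.log (1 - a)) ≤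
      (1 - a) * ((1 - b) / (1 - a) - 1) := mul_le_mul_of_nonneg_left h2 (by linarith)
  have h5 : a * (b / a - 1) = b - a := by field_simp
  have h6 : (1 - a) * ((1 - b) / (1 - a) - 1) = a - b := by
    have : 1 - a ≠ 0 := by linarith
    field_simp
    ring
  linarith

lemma two_mul_sq_le_entDeficit {p : ℝ} (hp0 : 1 / 2 ≤ p) (hp1 : p < 1) :
    2 * (p - 1 / 2) ^ 2 ≤ entDeficit p := by
  set l := 4 * (p - 1 / 2) with hl
  have hE := Real.exp_pos l
  have hb0 : 0 < Real.exp l / (1 + Real.exp l) := by positivity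
  have hb1 : Real.exp l / (1 + Real.exp l) < 1 := by
    rw [div_lt_one (by positivity)]; linarith
  have h := gibbs (by linarith : 0 < p) hp1 hb0 hb1
  have e1 : Real.log (Real.exp l / (1 + Real.exp l)) = l - Real.log (1 + Real.exp l) := by
    rw [Real.log_div (by positivity) (by positivity), Real.log_exp]
  have e2 : Real.log (1 - Real.exp l / (1 + Real.exp l)) = -Real.log (1 + Real.exp l) := by
    rw [← Real.log_inv]
    congr 1
    field_simp
    ring
  rw [e1, e2] at h
  have hm := bernoulli_mgf_le (p := 1 / 2) (by norm_num) (by norm_num) l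
  have hm2 : Real.log (1 + Real.exp l) ≤ Real.log 2 + (l * (1 / 2) + l ^ 2 / 8) := by
    rw [← Real.log_exp (l * (1 / 2) + l ^ 2 / 8), ← Real.log_mul (by norm_num) (by positivity)]
    apply Real.log_le_log (by positivity)
    linarith
  unfold entDeficit binEnt
  have : l * p - l / 2 - l ^ 2 / 8 = 2 * (p - 1 / 2) ^ 2 := by rw [hl]; ring
  linarith

lemma entDeficit_le_add {γ p : ℝ} (hγ0 : 0 < γ) (hγ1 : γ < 1) (hp0 : 0 < p) (hp1 : p < 1) :
    entDeficit p ≤ entDeficit γ + (p - γ) * Real.log (p / (1 - p)) := by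
  have h := gibbs hγ0 hγ1 hp0 hp1
  rw [Real.log_div hp0.ne' (by linarith)]
  unfold entDeficit binEnt
  linarith

lemma entDeficit_eq {p : ℝ} (hp0 : 0 < p) (hp1 : p < 1) :
    entDeficit p = p * Real.log (p / (1 - p)) + Real.log (2 * (1 - p)) := by
  rw [Real.log_div hp0.ne' (by linarith), Real.log_mul (by norm_num) (by linarith)]
  unfold entDeficit binEnt
  ring

lemma odds_eq {E M : ℕ} (hE : E < M) : odds E M = ((E : ℝ) / M) / (1 - (E : ℝ) / M) := by
  have h1 : (E : ℝ) < M := by exact_mod_cast hE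
  have hM0 : (0 : ℝ) < M := by linarith [(Nat.cast_nonneg E : (0 : ℝ) ≤ E)]
  have h2 : (M : ℝ) - E ≠ 0 := by linarith
  unfold odds
  rw [show 1 - (E : ℝ) / M = ((M : ℝ) - E) / M by field_simp]
  field_simp

lemma tilt_sq_eq {E M : ℕ} (hE : E < M) :
    ((1 + odds E M ^ 2) / 2) / ((1 + odds E M) / 2) ^ 2 = 1 + 4 * ((E : ℝ) / M - 1 / 2) ^ 2 := by
  have h1 : (E : ℝ) < M := by exact_mod_cast hE
  have hM0 : (0 : ℝ) < M := by linarith [(Nat.cast_nonneg E : (0 : ℝ) ≤ E)]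
  have h2 : (M : ℝ) - E ≠ 0 := by linarith
  rw [one_add_odds hE]
  unfold odds
  field_simp
  ring

lemma truncated_tilt_le {E M m : ℕ} {γ D : ℝ} (hE : E < M) (hγ : 1 / 2 ≤ γ) (hγ1 : γ < 1)
    (hEγ : E = ⌈γ * (M : ℝ)⌉₊) (hz : 1 ≤ odds E M) (hm : m ≤ M) :
    odds E M ^ ((⌈γ * (m : ℝ)⌉₊ : ℝ) + D) * (2 / (1 + odds E M)) ^ m ≤
      Real.exp (m * entDeficit γ + (2 + D) * Real.log (odds E M)) := by
  have h1 : (E : ℝ) < M := by exact_mod_cast hE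
  have hM0 : (0 : ℝ) < M := by linarith [(Nat.cast_nonneg E : (0 : ℝ) ≤ E)]
  have hz0 : 0 < odds E M := by linarith
  set lo := Real.log (odds E M) with hlo
  have hlo0 : 0 ≤ lo := Real.log_nonneg hz
  set p : ℝ := (E : ℝ) / M with hp
  have hp1 : p < 1 := by rw [hp, div_lt_one hM0]; exact h1
  have hγp : γ ≤ p := by
    rw [hp, le_div_iff₀ hM0, hEγ]; exact Nat.le_ceil _
  have hp0 : 0 < p := by linarith
  have hpγ : p - γ ≤ 1 / M := by
    have : (E : ℝ) < γ * M + 1 := by rw [hEγ]; exact Nat.ceil_lt_add_one (by positivity)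
    rw [sub_le_iff_le_add, hp, div_le_iff₀ hM0]
    have : (1 / (M : ℝ) + γ) * M = γ * M + 1 := by field_simp; ring
    linarith
  have hlop : lo = Real.log (p / (1 - p)) := by rw [hlo, odds_eq hE]
  have hmM : (m : ℝ) / M ≤ 1 := by
    rw [div_le_one hM0]; exact_mod_cast hm
  have e2 : 2 / (1 + odds E M) = 2 * (1 - p) := by
    rw [one_add_odds hE, hp]
    have : (M : ℝ) - E ≠ 0 := by linarith
    field_simp
  have e3 : (2 * (1 - p)) ^ m = Real.exp (m * Real.log (2 * (1 - p))) := by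
    rw [← Real.log_pow, Real.exp_log]
    have : 0 < 1 - p := by linarith
    positivity
  rw [e2, e3, Real.rpow_def_of_pos hz0, ← Real.exp_add]
  apply Real.exp_le_exp.mpr
  have h3 : (⌈γ * (m : ℝ)⌉₊ : ℝ) ≤ p * m + 1 := by
    have a1 : (⌈γ * (m : ℝ)⌉₊ : ℝ) < γ * m + 1 := Nat.ceil_lt_add_one (by positivity)
    have a2 : γ * m ≤ p * m := by gcongr
    linarith
  have h4 := entDeficit_eq hp0 hp1
  rw [← hlop] at h4
  have h5 := entDeficit_le_add (by linarith : 0 < γ) hγ1 hp0 hp1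
  rw [← hlop] at h5
  have h6 : (m : ℝ) * entDeficit p ≤ m * entDeficit γ + lo := by
    calc (m : ℝ) * entDeficit p ≤ m * (entDeficit γ + (1 / M) * lo) := by
          gcongr
          refine h5.trans ?_
          gcongr
      _ = m * entDeficit γ + (m / M) * lo := by ring
      _ ≤ m * entDeficit γ + 1 * lo := by gcongr
      _ = _ := by ring
  calc lo * ((⌈γ * (m : ℝ)⌉₊ : ℝ) + D) + m * Real.log (2 * (1 - p))
      ≤ lo * ((p * m + 1) + D) + m * Real.log (2 * (1 - p)) := by gcongr
    _ = m * entDeficit p + (1 + D) * lo := by rw [h4]; ring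
    _ ≤ _ := by linarith

/-- Quantitative form, with error parameter `e`, of the asymptotic relations between `n`, the
subgraph size `K ≈ n ^ C` and the density `γ`. -/
structure AsympBounds (C α : ℝ) (n K : ℕ) (γ e : ℝ) : Prop where
  e_pos : 0 < e
  one_le : 1 ≤ K
  le_n : K ≤ n
  log_K_ge_const : 100 ≤ 3 * Real.log K
  log_n_ge : 1 ≤ e * Real.log n
  rpow_ge : 1 ≤ e * (K : ℝ) ^ α
  K_ge : 1 ≤ e * (K : ℝ)
  log_K_ge : (C - e) * Real.log n ≤ Real.log K
  log_K_le : Real.log K ≤ (C + e) * Real.log n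
  gamma_ge : 1 / 2 ≤ γ
  gamma_lt : γ < 1
  gamma_le : 2 * γ ≤ 1 + e
  ceil_lt : ⌈γ * (K.choose 2 : ℝ)⌉₊ < K.choose 2
  log_choose_eq : Real.log (n.choose K : ℝ) =
    (K.choose 2 : ℝ) * entDeficit γ + (K : ℝ) ^ α * Real.log n
  entDeficit_ge : (2 * (1 - C) - e) * Real.log n ≤ K * entDeficit γ
  one_le_odds : 1 ≤ odds ⌈γ * (K.choose 2 : ℝ)⌉₊ (K.choose 2)
  log_odds_le : Real.log (odds ⌈γ * (K.choose 2 : ℝ)⌉₊ (K.choose 2)) ≤ 1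
  sq_log_odds_le : K * Real.log (odds ⌈γ * (K.choose 2 : ℝ)⌉₊ (K.choose 2)) ^ 2 ≤
    (16 * (1 - C) + e) * Real.log n
  sq_bias_le : K * (4 * ((⌈γ * (K.choose 2 : ℝ)⌉₊ : ℝ) / (K.choose 2 : ℝ) - 1 / 2) ^ 2) ≤
    (4 * (1 - C) + e) * Real.log n

namespace AsympBounds

variable {C α : ℝ} {n K : ℕ} {γ e : ℝ}

lemma K_pos (h : AsympBounds C α n K γ e) : (0 : ℝ) < K := by exact_mod_cast h.one_le

lemma mono (h : AsympBounds C α n K γ e) {e' : ℝ} (he : e ≤ e') : AsympBounds C α n K γ e' := by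
  have hN := Real.log_natCast_nonneg n
  have hK := h.K_pos
  have hKα : 0 < (K : ℝ) ^ α := by positivity
  refine { h with
    e_pos := h.e_pos.trans_le he
    log_n_ge := h.log_n_ge.trans (by gcongr)
    rpow_ge := h.rpow_ge.trans (by gcongr)
    K_ge := h.K_ge.trans (by gcongr)
    log_K_ge := le_trans (by gcongr) h.log_K_ge
    log_K_le := h.log_K_le.trans (by gcongr)
    gamma_le := h.gamma_le.trans (by gcongr)
    entDeficit_ge := le_trans (by gcongr) h.entDeficit_ge
    sq_log_odds_le := h.sq_log_odds_le.trans (by gcongr)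
    sq_bias_le := h.sq_bias_le.trans (by gcongr) }

lemma log_K_le_log_n (h : AsympBounds C α n K γ e) : Real.log K ≤ Real.log n :=
  Real.log_le_log h.K_pos (by exact_mod_cast h.le_n)

lemma log_odds_nonneg (h : AsympBounds C α n K γ e) :
    0 ≤ Real.log (odds ⌈γ * (K.choose 2 : ℝ)⌉₊ (K.choose 2)) := Real.log_nonneg h.one_le_odds

lemma entDeficit_nonneg (h : AsympBounds C α n K γ e) : 0 ≤ entDeficit γ :=
  le_trans (by positivity) (two_mul_sq_le_entDeficit h.gamma_ge h.gamma_lt)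

lemma choose_two_add_one_sq_le (h : AsympBounds C α n K γ e) :
    ((K.choose 2 : ℝ) + 1) ^ 2 ≤ Real.exp (4 * Real.log n) := by
  have hK := h.K_pos
  have h1 : (K.choose 2 : ℝ) + 1 ≤ (K : ℝ) ^ 2 := by
    have h2 : (1 : ℝ) ≤ K := by exact_mod_cast h.one_le
    rw [Nat.cast_choose_two]
    nlinarith
  calc ((K.choose 2 : ℝ) + 1) ^ 2 ≤ ((K : ℝ) ^ 2) ^ 2 := by gcongr
    _ = (K : ℝ) ^ 4 := by ring
    _ = Real.exp (4 * Real.log K) := by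
      rw [← Real.rpow_natCast, Real.rpow_def_of_pos hK]; congr 1; push_cast; ring
    _ ≤ _ := by
      apply Real.exp_le_exp.mpr
      linarith [h.log_K_le_log_n]

end AsympBounds

/-- The probability that two `K`-subsets of an `n`-set meet in exactly `ℓ` points. -/
def overlapProb (n K ℓ : ℕ) : ℝ :=
  (K.choose ℓ : ℝ) * ((n - K).choose (K - ℓ) : ℝ) / (n.choose K : ℝ)

lemma overlapProb_nonneg (n K ℓ : ℕ) : 0 ≤ overlapProb n K ℓ := by
  unfold overlapProb; positivity

lemma overlapProb_le_choose_mul_exp {n K ℓ : ℕ} (hK : 1 ≤ K) (hKn : K ≤ n) (hℓ : ℓ ≤ K) :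
    overlapProb n K ℓ ≤
      (K.choose ℓ : ℝ) * Real.exp (ℓ * (Real.log K - Real.log n)) := by
  have hK0 : (0 : ℝ) < K := by exact_mod_cast hK
  have hn0 : (0 : ℝ) < n := by exact_mod_cast (by omega : 0 < n)
  have h1 := choose_sub_div_choose_le hKn hℓ (by omega)
  unfold overlapProb
  rw [mul_div_assoc]
  gcongr
  refine h1.trans (le_of_eq ?_)
  rw [← Real.log_div hK0.ne' hn0.ne', ← Real.log_pow, Real.exp_log (by positivity)]

lemma overlapProb_le_exp {n K ℓ : ℕ} (hKn : K ≤ n) (hℓ : ℓ ≤ K) :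
    overlapProb n K ℓ ≤ Real.exp (Real.log (K.choose (K - ℓ) : ℝ) +
      Real.log (n.choose (K - ℓ) : ℝ) - Real.log (n.choose K : ℝ)) := by
  have h1 : (0 : ℝ) < K.choose (K - ℓ) := by exact_mod_cast Nat.choose_pos (by omega)
  have h2 : (0 : ℝ) < n.choose (K - ℓ) := by exact_mod_cast Nat.choose_pos (by omega)
  have h3 : (0 : ℝ) < n.choose K := by exact_mod_cast Nat.choose_pos hKn
  rw [Real.exp_sub, Real.exp_add, Real.exp_log h1, Real.exp_log h2, Real.exp_log h3,
    Nat.choose_symm hℓ]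
  unfold overlapProb
  gcongr
  omega

namespace AsympBounds

variable {C α : ℝ} {n K : ℕ} {γ e : ℝ}

lemma overlapProb_le_exp_mul (h : AsympBounds C α n K γ e) {ℓ : ℕ} (hℓ : ℓ ≤ K) :
    overlapProb n K ℓ ≤ Real.exp (ℓ * ((2 * C + 2 * e - 1) * Real.log n)) := by
  have hK := h.K_pos
  refine (overlapProb_le_choose_mul_exp h.one_le h.le_n hℓ).trans ?_
  have h1 : (K.choose ℓ : ℝ) ≤ Real.exp (ℓ * Real.log K) := by
    rw [← Real.log_pow, Real.exp_log (by positivity)]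
    exact_mod_cast Nat.choose_le_pow K ℓ
  calc _ ≤ Real.exp (ℓ * Real.log K) * Real.exp (ℓ * (Real.log K - Real.log n)) := by gcongr
    _ = Real.exp (ℓ * (2 * Real.log K - Real.log n)) := by rw [← Real.exp_add]; congr 1; ring
    _ ≤ _ := by
      apply Real.exp_le_exp.mpr
      gcongr
      linarith [h.log_K_le]

lemma overlapProb_mul_two_pow_le (h : AsympBounds C α n K γ e) {ℓ L : ℕ} (h2 : 2 ≤ ℓ)
    (hℓ : ℓ ≤ K) (hL : ℓ ≤ L) (he : 4 * e ≤ 1 - 2 * C) :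
    overlapProb n K ℓ * 2 ^ (ℓ.choose 2) ≤
      2 ^ (L ^ 2) * Real.exp (-(1 - 2 * C) * Real.log n) := by
  have hN := Real.log_natCast_nonneg n
  have h1 : ℓ.choose 2 ≤ L ^ 2 := (Nat.choose_le_pow ℓ 2).trans (Nat.pow_le_pow_left hL 2)
  have h3 := h.overlapProb_le_exp_mul hℓ
  have h4 : (ℓ : ℝ) * ((2 * C + 2 * e - 1) * Real.log n) ≤ -(1 - 2 * C) * Real.log n := by
    have h5 : (2 : ℝ) ≤ ℓ := by exact_mod_cast h2
    have h6 : (2 * C + 2 * e - 1) * Real.log n ≤ -((1 - 2 * C) / 2) * Real.log n := by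
      gcongr; linarith
    have hc : 0 ≤ (1 - 2 * C) / 2 * Real.log n := by
      have := h.e_pos
      apply mul_nonneg _ hN; linarith
    nlinarith
  rw [mul_comm]
  gcongr
  · exact overlapProb_nonneg n K ℓ
  · norm_num
  · exact h3.trans (Real.exp_le_exp.mpr h4)

lemma tilt_pow_le (h : AsympBounds C α n K γ e) (m : ℕ) {c : ℝ} (hm : (m : ℝ) ≤ c * K) :
    (1 + 4 * ((⌈γ * (K.choose 2 : ℝ)⌉₊ : ℝ) / (K.choose 2 : ℝ) - 1 / 2) ^ 2) ^ m ≤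
      Real.exp (c * ((4 * (1 - C) + e) * Real.log n)) := by
  have hK := h.K_pos
  set b := 4 * ((⌈γ * (K.choose 2 : ℝ)⌉₊ : ℝ) / (K.choose 2 : ℝ) - 1 / 2) ^ 2 with hb
  have hb0 : 0 ≤ b := by positivity
  have hc : 0 ≤ c := by
    have : (0 : ℝ) ≤ m := Nat.cast_nonneg m
    by_contra hc
    push Not at hc
    nlinarith
  calc (1 + b) ^ m ≤ Real.exp b ^ m := by
        gcongr
        linarith [Real.add_one_le_exp b]
    _ = Real.exp (m * b) := by rw [← Real.exp_nat_mul]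
    _ ≤ _ := by
      apply Real.exp_le_exp.mpr
      calc (m : ℝ) * b ≤ (c * K) * b := by gcongr
        _ = c * (K * b) := by ring
        _ ≤ _ := mul_le_mul_of_nonneg_left h.sq_bias_le hc

lemma cast_choose_two_le (ℓ : ℕ) : (ℓ.choose 2 : ℝ) ≤ (ℓ : ℝ) ^ 2 / 2 := by
  rw [Nat.cast_choose_two]
  have : (0 : ℝ) ≤ ℓ := Nat.cast_nonneg ℓ
  nlinarith

/-- Small proportional overlaps, bounding the number of intersections crudely by powers. -/
lemma overlapProb_mul_tilt_le_of_small (h : AsympBounds C α n K γ e) {ℓ : ℕ} {η : ℝ}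
    (hC : 0 < C) (hℓ : ℓ ≤ K)
    (hη0 : 0 ≤ η) (hη : (ℓ : ℝ) ≤ η * K) (hηC : 10 * η ≤ 1 - 2 * C) (he : 8 * e ≤ 1 - 2 * C)
    (hL : 24 ≤ (1 - 2 * C) * ℓ) :
    overlapProb n K ℓ * (((K.choose 2 : ℝ) + 1) ^ 2 *
      (1 + 4 * ((⌈γ * (K.choose 2 : ℝ)⌉₊ : ℝ) / (K.choose 2 : ℝ) - 1 / 2) ^ 2) ^ (ℓ.choose 2)) ≤
      Real.exp (-2 * Real.log n) := by
  have hN := Real.log_natCast_nonneg n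
  have hℓ0 : (0 : ℝ) ≤ ℓ := Nat.cast_nonneg ℓ
  have he0 := h.e_pos
  have hm : (ℓ.choose 2 : ℝ) ≤ (ℓ * η / 2) * K := by
    refine (cast_choose_two_le ℓ).trans ?_
    nlinarith
  calc _ ≤ Real.exp (ℓ * ((2 * C + 2 * e - 1) * Real.log n)) * (Real.exp (4 * Real.log n) *
        Real.exp ((ℓ * η / 2) * ((4 * (1 - C) + e) * Real.log n))) := by
        gcongr
        · exact h.overlapProb_le_exp_mul hℓ
        · exact h.choose_two_add_one_sq_le
        · exact h.tilt_pow_le _ hm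
    _ = Real.exp ((ℓ * (2 * C + 2 * e - 1 + η / 2 * (4 * (1 - C) + e)) + 4) * Real.log n) := by
        rw [← Real.exp_add, ← Real.exp_add]; congr 1; ring
    _ ≤ _ := by
      apply Real.exp_le_exp.mpr
      gcongr
      have h1 : η / 2 * (4 * (1 - C) + e) ≤ η / 2 * 5 := by
        gcongr; linarith
      have h2 : (ℓ : ℝ) * (2 * C + 2 * e - 1 + η / 2 * (4 * (1 - C) + e)) ≤
          ℓ * (-(1 - 2 * C) / 4) := by
        gcongr
        linarith
      linarith

/-- Small proportional overlaps, bounding the number of intersections crudely by `2 ^ K`. -/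
lemma overlapProb_mul_tilt_le_of_large (h : AsympBounds C α n K γ e) {ℓ : ℕ} {η : ℝ}
    (hℓ : 5 * ℓ ≤ 2 * K) (hη0 : 0 < η) (hη : η * K ≤ ℓ)
    (he : 12 / 10 * e + e / η ≤ (1 - C) / 10) (hL : 60 ≤ (1 - C) * ℓ) :
    overlapProb n K ℓ * (((K.choose 2 : ℝ) + 1) ^ 2 *
      (1 + 4 * ((⌈γ * (K.choose 2 : ℝ)⌉₊ : ℝ) / (K.choose 2 : ℝ) - 1 / 2) ^ 2) ^ (ℓ.choose 2)) ≤
      Real.exp (-2 * Real.log n) := by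
  have hN := Real.log_natCast_nonneg n
  have hℓ0 : (0 : ℝ) ≤ ℓ := Nat.cast_nonneg ℓ
  have hK := h.K_pos
  have he0 := h.e_pos
  have hℓ' : (5 : ℝ) * ℓ ≤ 2 * K := by exact_mod_cast hℓ
  have hm : (ℓ.choose 2 : ℝ) ≤ (ℓ / 5) * K := by
    refine (cast_choose_two_le ℓ).trans ?_
    nlinarith
  have hc : (K.choose ℓ : ℝ) ≤ Real.exp (ℓ * (e / η * Real.log n)) := by
    have h1 : (K.choose ℓ : ℝ) ≤ 2 ^ K := by exact_mod_cast Nat.choose_le_two_pow K ℓ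
    have h2 : (2 : ℝ) ^ K ≤ Real.exp 1 ^ K := by
      gcongr
      linarith [Real.add_one_le_exp (1 : ℝ)]
    rw [← Real.exp_nat_mul] at h2
    refine (h1.trans h2).trans (Real.exp_le_exp.mpr ?_)
    have h3 : (K : ℝ) ≤ ℓ / η := by rw [le_div_iff₀ hη0]; linarith
    calc (K : ℝ) * 1 ≤ (ℓ / η) * (e * Real.log n) := by
          gcongr
          exact h.log_n_ge
      _ = _ := by ring
  have hF : overlapProb n K ℓ ≤ Real.exp (ℓ * ((e / η + (C + e - 1)) * Real.log n)) := by
    refine (overlapProb_le_choose_mul_exp h.one_le h.le_n (by omega)).trans ?_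
    calc _ ≤ Real.exp (ℓ * (e / η * Real.log n)) * Real.exp (ℓ * ((C + e - 1) * Real.log n)) := by
          gcongr
          linarith [h.log_K_le]
      _ = _ := by rw [← Real.exp_add]; congr 1; ring
  calc _ ≤ Real.exp (ℓ * ((e / η + (C + e - 1)) * Real.log n)) * (Real.exp (4 * Real.log n) *
        Real.exp ((ℓ / 5) * ((4 * (1 - C) + e) * Real.log n))) := by
        gcongr
        · exact h.choose_two_add_one_sq_le
        · exact h.tilt_pow_le _ hm
    _ = Real.exp ((ℓ * (e / η + (C + e - 1) + (4 * (1 - C) + e) / 5) + 4) * Real.log n) := by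
        rw [← Real.exp_add, ← Real.exp_add]; congr 1; ring
    _ ≤ _ := by
      apply Real.exp_le_exp.mpr
      gcongr
      have h2 : (ℓ : ℝ) * (e / η + (C + e - 1) + (4 * (1 - C) + e) / 5) ≤
          ℓ * (-(1 - C) / 10) := by
        gcongr
        linarith
      linarith

end AsympBounds

lemma DK_sq_le {K ℓ : ℕ} {γ δ κ : ℝ} (hγ : 0 ≤ γ) (hδ : 0 ≤ δ) (hℓ : ℓ ≤ K) (h1 : 1 + δ ≤ κ)
    (h2 : (ℓ : ℝ) < 2 * (K : ℝ) / 3 → 2 + δ ≤ κ) :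
    DK K ℓ γ δ ^ 2 ≤ 2 * γ * κ * ((K.choose 2 : ℝ) - (ℓ.choose 2 : ℝ)) *
      (Real.log (K.choose ℓ : ℝ) + 2 * Real.log K) := by
  have hl : 0 ≤ Real.log (K.choose ℓ : ℝ) + 2 * Real.log K := by
    have := log_choose_nonneg K ℓ
    have := Real.log_natCast_nonneg K
    positivity
  have hm := min_choose_two_nonneg hℓ
  have hm' : (0 : ℝ) ≤ (K.choose 2 : ℝ) - (ℓ.choose 2 : ℝ) := hm.trans (min_le_left _ _)
  have hκ : 0 ≤ κ := by linarith
  unfold DK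
  split_ifs with hc
  · rw [Real.sq_sqrt (by positivity)]
    have := h2 hc
    gcongr ?_ * ?_ * ?_ * _
    exact min_le_left _ _
  · rw [Real.sq_sqrt (by positivity)]
    gcongr ?_ * ?_ * ?_ * _
    exact min_le_left _ _

lemma choose_two_sub_choose_two {K ℓ : ℕ} (hℓ : ℓ ≤ K) :
    (K.choose 2 : ℝ) - (ℓ.choose 2 : ℝ) =
      ((K - ℓ : ℕ) : ℝ) * (2 * K - ((K - ℓ : ℕ) : ℝ) - 1) / 2 := by
  rw [Nat.cast_choose_two, Nat.cast_choose_two, Nat.cast_sub hℓ]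
  ring

namespace AsympBounds

variable {C α : ℝ} {n K : ℕ} {γ e : ℝ}

lemma overlapProb_mul_truncated_le (h : AsympBounds C α n K γ e) {ℓ : ℕ} {D : ℝ} (hℓ : ℓ ≤ K) :
    overlapProb n K ℓ * (((K.choose 2 : ℝ) + 1) ^ 2 *
      (odds ⌈γ * (K.choose 2 : ℝ)⌉₊ (K.choose 2) ^ ((⌈γ * (ℓ.choose 2 : ℝ)⌉₊ : ℝ) + D) *
        (2 / (1 + odds ⌈γ * (K.choose 2 : ℝ)⌉₊ (K.choose 2))) ^ (ℓ.choose 2))) ≤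
    Real.exp (Real.log (K.choose (K - ℓ) : ℝ) + Real.log (n.choose (K - ℓ) : ℝ) -
      ((K.choose 2 : ℝ) - (ℓ.choose 2 : ℝ)) * entDeficit γ - (K : ℝ) ^ α * Real.log n +
      D * Real.log (odds ⌈γ * (K.choose 2 : ℝ)⌉₊ (K.choose 2)) + 4 * Real.log n + 2) := by
  have hz := h.one_le_odds
  calc _ ≤ Real.exp (Real.log (K.choose (K - ℓ) : ℝ) +
      Real.log (n.choose (K - ℓ) : ℝ) - Real.log (n.choose K : ℝ)) * (Real.exp (4 * Real.log n) *
        Real.exp ((ℓ.choose 2 : ℕ) * entDeficit γ +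
          (2 + D) * Real.log (odds ⌈γ * (K.choose 2 : ℝ)⌉₊ (K.choose 2)))) := by
        gcongr
        · exact overlapProb_le_exp h.le_n hℓ
        · exact h.choose_two_add_one_sq_le
        · exact truncated_tilt_le h.ceil_lt h.gamma_ge h.gamma_lt rfl hz
            (Nat.choose_le_choose 2 hℓ)
    _ ≤ _ := by
      rw [← Real.exp_add, ← Real.exp_add, h.log_choose_eq]
      apply Real.exp_le_exp.mpr
      linarith [h.log_odds_le]

lemma truncation_mul_log_odds_le (h : AsympBounds C α n K γ e) {ℓ : ℕ} {D κ X : ℝ}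
    (hC : C < 1) (hκ : 0 ≤ κ)
    (hℓ : ℓ ≤ K) (hX : 0 ≤ X)
    (hD : D ^ 2 ≤ 2 * γ * κ * ((K.choose 2 : ℝ) - (ℓ.choose 2 : ℝ)) *
      (Real.log (K.choose ℓ : ℝ) + 2 * Real.log K))
    (hl : Real.log (K.choose (K - ℓ) : ℝ) + 2 * Real.log K ≤ X * Real.log n) :
    D * Real.log (odds ⌈γ * (K.choose 2 : ℝ)⌉₊ (K.choose 2)) ≤
      √((1 + e) * κ * ((K - ℓ : ℕ) : ℝ) * X * (16 * (1 - C) + e)) * Real.log n := by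
  have hN : 0 ≤ Real.log n := Real.log_natCast_nonneg n
  have hK := h.K_pos
  have he := h.e_pos
  have hlo := h.log_odds_nonneg
  have hsq := h.sq_log_odds_le
  have h2γ := h.gamma_le
  have hγ0 := h.gamma_ge
  rw [Nat.choose_symm hℓ] at hl
  set lo := Real.log (odds ⌈γ * (K.choose 2 : ℝ)⌉₊ (K.choose 2)) with hlo_def
  rw [choose_two_sub_choose_two hℓ] at hD
  have hyK : ((K - ℓ : ℕ) : ℝ) ≤ K := by exact_mod_cast Nat.sub_le K ℓ
  set y : ℝ := ((K - ℓ : ℕ) : ℝ) with hy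
  have hy0 : 0 ≤ y := Nat.cast_nonneg _
  have hl0 : 0 ≤ Real.log (K.choose ℓ : ℝ) + 2 * Real.log K := by
    have := log_choose_nonneg K ℓ
    have := Real.log_natCast_nonneg K
    positivity
  have hm : y * (2 * K - y - 1) / 2 ≤ y * K := by nlinarith
  have hD2 : D ^ 2 ≤ (1 + e) * κ * (y * K) * (X * Real.log n) := by
    refine hD.trans ?_
    calc _ ≤ 2 * γ * κ * (y * K) * (Real.log (K.choose ℓ : ℝ) + 2 * Real.log K) := by gcongr
      _ ≤ _ := by gcongr
  have h16 : 0 ≤ 16 * (1 - C) + e := by linarith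
  have hfin : (D * lo) ^ 2 ≤
      ((1 + e) * κ * y * X * (16 * (1 - C) + e)) * Real.log n ^ 2 := by
    calc (D * lo) ^ 2 = D ^ 2 * lo ^ 2 := by ring
      _ ≤ ((1 + e) * κ * (y * K) * (X * Real.log n)) * lo ^ 2 := by gcongr
      _ = ((1 + e) * κ * y * X * Real.log n) * (K * lo ^ 2) := by ring
      _ ≤ ((1 + e) * κ * y * X * Real.log n) * ((16 * (1 - C) + e) * Real.log n) := by gcongr
      _ = _ := by ring
  calc D * lo ≤ √(((1 + e) * κ * y * X * (16 * (1 - C) + e)) * Real.log n ^ 2) :=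
        Real.le_sqrt_of_sq_le hfin
    _ = _ := by rw [Real.sqrt_mul' _ (sq_nonneg _), Real.sqrt_sq hN]

/-- Almost complete overlaps. -/
lemma overlapProb_mul_truncated_le_of_near (h : AsympBounds C α n K γ e) {ℓ : ℕ} {δ : ℝ}
    (hC0 : 0 < C) (hC : C < 1) (hδ : 0 ≤ δ) (hδ1 : δ ≤ 1) (he : 14 * e ≤ 1)
    (hℓ : ℓ ≤ K) (hy : 40 * ((K - ℓ : ℕ) : ℝ) ≤ (K : ℝ) ^ α) :
    overlapProb n K ℓ * (((K.choose 2 : ℝ) + 1) ^ 2 *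
      (odds ⌈γ * (K.choose 2 : ℝ)⌉₊ (K.choose 2) ^
        ((⌈γ * (ℓ.choose 2 : ℝ)⌉₊ : ℝ) + DK K ℓ γ δ) *
        (2 / (1 + odds ⌈γ * (K.choose 2 : ℝ)⌉₊ (K.choose 2))) ^ (ℓ.choose 2))) ≤
    Real.exp (-2 * Real.log n) := by
  refine (h.overlapProb_mul_truncated_le hℓ).trans (Real.exp_le_exp.mpr ?_)
  have hN : 0 ≤ Real.log n := Real.log_natCast_nonneg n
  have hK := h.K_pos
  have he0 := h.e_pos
  have hI := h.entDeficit_nonneg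
  have hγ0 := h.gamma_ge
  have hlK : Real.log (K.choose (K - ℓ) : ℝ) ≤ ((K - ℓ : ℕ) : ℝ) * Real.log n :=
    (log_choose_le_mul_log (Nat.sub_le K ℓ)).trans
      (mul_le_mul_of_nonneg_left h.log_K_le_log_n (Nat.cast_nonneg _))
  have hln : Real.log (n.choose (K - ℓ) : ℝ) ≤ ((K - ℓ : ℕ) : ℝ) * Real.log n :=
    log_choose_le_mul_log ((Nat.sub_le K ℓ).trans h.le_n)
  have hD := h.truncation_mul_log_odds_le (X := ((K - ℓ : ℕ) : ℝ) + 2) hC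
    (by norm_num : (0 : ℝ) ≤ 3) hℓ (by positivity)
    (DK_sq_le (δ := δ) (by linarith) hδ hℓ (by linarith) (fun _ => by linarith))
    (by linarith [h.log_K_le_log_n])
  have hm : 0 ≤ ((K.choose 2 : ℝ) - (ℓ.choose 2 : ℝ)) * entDeficit γ :=
    mul_nonneg ((min_choose_two_nonneg hℓ).trans (min_le_left _ _)) hI
  have hy1 : ((K - ℓ : ℕ) : ℝ) * (((K - ℓ : ℕ) : ℝ) + 2) ≤ 3 * ((K - ℓ : ℕ) : ℝ) ^ 2 := by
    rcases Nat.eq_zero_or_pos (K - ℓ) with h0 | h0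
    · rw [h0]; norm_num
    · have : (1 : ℝ) ≤ ((K - ℓ : ℕ) : ℝ) := by exact_mod_cast h0
      nlinarith
  set y : ℝ := ((K - ℓ : ℕ) : ℝ) with hy_def
  have hy0 : 0 ≤ y := Nat.cast_nonneg _
  have hs : √((1 + e) * 3 * y * (y + 2) * (16 * (1 - C) + e)) ≤ 18 * y := by
    apply Real.sqrt_le_iff.mpr ⟨by positivity, ?_⟩
    calc (1 + e) * 3 * y * (y + 2) * (16 * (1 - C) + e)
        = (1 + e) * 3 * (y * (y + 2)) * (16 * (1 - C) + e) := by ring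
      _ ≤ (1 + 1) * 3 * (3 * y ^ 2) * 17 := by
          gcongr <;> linarith
      _ ≤ _ := by nlinarith [sq_nonneg y]
  have hD' := hD.trans (mul_le_mul_of_nonneg_right hs hN)
  have hα : 14 ≤ (K : ℝ) ^ α := by
    have h1 := h.rpow_ge
    have h2 : 0 < (K : ℝ) ^ α := by positivity
    nlinarith
  have h1 : (40 * y) * Real.log n ≤ (K : ℝ) ^ α * Real.log n := by gcongr
  have h2 : 14 * Real.log n ≤ (K : ℝ) ^ α * Real.log n := by gcongr
  have h3 : 2 ≤ Real.log n := by
    have := h.log_n_ge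
    nlinarith
  linarith

/-- Overlaps at distance between `1 / e` and `η * K` from complete. -/
lemma overlapProb_mul_truncated_le_of_far (h : AsympBounds C α n K γ e) {ℓ : ℕ} {δ κ Λ η : ℝ}
    (hC0 : 0 < C) (hC : C < 1) (hδ : 0 ≤ δ)
    (hℓ : ℓ ≤ K) (hκ1 : 1 + δ ≤ κ) (hκ2 : (ℓ : ℝ) < 2 * (K : ℝ) / 3 → 2 + δ ≤ κ)
    (hy1 : 1 ≤ e * ((K - ℓ : ℕ) : ℝ)) (hy2 : ((K - ℓ : ℕ) : ℝ) ≤ η * K)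
    (he : 2 * e ≤ 1 - C) (hηe : e ≤ 1 - η / 2)
    (hΛ : 1 + Real.log (K / ((K - ℓ : ℕ) : ℝ)) ≤ Λ * Real.log n)
    (hG : ((K - ℓ : ℕ) : ℝ) * (2 * Λ + (1 - C) + e - (1 - η / 2 - e) * (2 * (1 - C) - e) +
      √((1 + e) * κ * (Λ + 2 * e) * (16 * (1 - C) + e))) ≤ -7) :
    overlapProb n K ℓ * (((K.choose 2 : ℝ) + 1) ^ 2 *
      (odds ⌈γ * (K.choose 2 : ℝ)⌉₊ (K.choose 2) ^
        ((⌈γ * (ℓ.choose 2 : ℝ)⌉₊ : ℝ) + DK K ℓ γ δ) *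
        (2 / (1 + odds ⌈γ * (K.choose 2 : ℝ)⌉₊ (K.choose 2))) ^ (ℓ.choose 2))) ≤
    Real.exp (-2 * Real.log n) := by
  refine (h.overlapProb_mul_truncated_le hℓ).trans (Real.exp_le_exp.mpr ?_)
  have hN : 0 ≤ Real.log n := Real.log_natCast_nonneg n
  have hK := h.K_pos
  have he0 := h.e_pos
  have h2 : 2 ≤ Real.log n := by
    have h1 := h.log_n_ge
    have h3 := mul_nonneg (by linarith : 0 ≤ 1 / 2 - e) hN
    linarith
  have hI := h.entDeficit_nonneg
  have hγ0 := h.gamma_ge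
  have hn0 : (0 : ℝ) < n := by exact_mod_cast h.one_le.trans h.le_n
  have hy : 0 < K - ℓ := by
    by_contra h0
    rw [show K - ℓ = 0 by omega] at hy1
    norm_num at hy1
  have hyK : ((K - ℓ : ℕ) : ℝ) ≤ K := by exact_mod_cast Nat.sub_le K ℓ
  have hNpos : 0 < Real.log n := by linarith
  have hlK := log_choose_le hy (Nat.sub_le K ℓ)
  have hln := log_choose_le hy ((Nat.sub_le K ℓ).trans h.le_n)
  have hm := choose_two_sub_choose_two hℓ
  have hsq := DK_sq_le (δ := δ) (by linarith) hδ hℓ hκ1 hκ2 (γ := γ)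
  have hy0 : (0 : ℝ) < ((K - ℓ : ℕ) : ℝ) := by exact_mod_cast hy
  have hΛ0 : 0 ≤ Λ := by
    have h1 : 0 ≤ Real.log (K / ((K - ℓ : ℕ) : ℝ)) := by
      apply Real.log_nonneg
      rw [le_div_iff₀ hy0]; linarith
    by_contra h0
    nlinarith
  have hlK' : Real.log (K.choose (K - ℓ) : ℝ) ≤ ((K - ℓ : ℕ) : ℝ) * (Λ * Real.log n) :=
    hlK.trans (by gcongr)
  have hD := h.truncation_mul_log_odds_le (X := ((K - ℓ : ℕ) : ℝ) * (Λ + 2 * e)) hC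
    (by linarith : (0 : ℝ) ≤ κ) hℓ (by positivity) hsq (by
      have h1 : Real.log K ≤ (e * ((K - ℓ : ℕ) : ℝ)) * Real.log n := by
        refine h.log_K_le_log_n.trans ?_
        nlinarith
      nlinarith)
  set y : ℝ := ((K - ℓ : ℕ) : ℝ) with hy_def
  have hln' : Real.log (n.choose (K - ℓ) : ℝ) ≤
      y * ((Λ + (1 - C) + e) * Real.log n) := by
    refine hln.trans ?_
    gcongr
    have h1 : Real.log ((n : ℝ) / y) = Real.log (K / y) + (Real.log n - Real.log K) := by
      rw [Real.log_div hn0.ne' hy0.ne', Real.log_div hK.ne' hy0.ne']; ring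
    rw [h1]
    linarith [h.log_K_ge]
  have hs : √((1 + e) * κ * y * (y * (Λ + 2 * e)) * (16 * (1 - C) + e)) =
      y * √((1 + e) * κ * (Λ + 2 * e) * (16 * (1 - C) + e)) := by
    rw [show (1 + e) * κ * y * (y * (Λ + 2 * e)) * (16 * (1 - C) + e) =
      y ^ 2 * ((1 + e) * κ * (Λ + 2 * e) * (16 * (1 - C) + e)) by ring,
      Real.sqrt_mul (sq_nonneg _), Real.sqrt_sq hy0.le]
  rw [hs] at hD
  have hent : y * ((1 - η / 2 - e) * (2 * (1 - C) - e)) * Real.log n ≤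
      ((K.choose 2 : ℝ) - (ℓ.choose 2 : ℝ)) * entDeficit γ := by
    have h1 : y * (K * (1 - η / 2 - e)) ≤ (K.choose 2 : ℝ) - (ℓ.choose 2 : ℝ) := by
      rw [hm, mul_div_assoc]
      apply mul_le_mul_of_nonneg_left _ hy0.le
      linarith [h.K_ge]
    calc _ = y * (1 - η / 2 - e) * ((2 * (1 - C) - e) * Real.log n) := by ring
      _ ≤ y * (1 - η / 2 - e) * (K * entDeficit γ) := by
        apply mul_le_mul_of_nonneg_left h.entDeficit_ge
        apply mul_nonneg hy0.le; linarith
      _ = (y * (K * (1 - η / 2 - e))) * entDeficit γ := by ring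
      _ ≤ _ := by gcongr
  have hpow : 0 ≤ (K : ℝ) ^ α * Real.log n := by positivity
  have hfin := mul_le_mul_of_nonneg_right hG hN
  linarith

end AsympBounds

/-- An upper bound on the probability that two `K`-subsets meeting in `ℓ` points are both flat,
relative to `binProb ⌈γ * K.choose 2⌉₊ (K.choose 2) ^ 2`. -/
def pairBound (K : ℕ) (γ δ : ℝ) (L ℓ : ℕ) : ℝ :=
  if ℓ ≤ L then 2 ^ (ℓ.choose 2)
  else if 5 * ℓ ≤ 2 * K then ((K.choose 2 : ℝ) + 1) ^ 2 *
      (1 + 4 * ((⌈γ * (K.choose 2 : ℝ)⌉₊ : ℝ) / (K.choose 2 : ℝ) - 1 / 2) ^ 2) ^ (ℓ.choose 2)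
  else ((K.choose 2 : ℝ) + 1) ^ 2 *
      (odds ⌈γ * (K.choose 2 : ℝ)⌉₊ (K.choose 2) ^
        ((⌈γ * (ℓ.choose 2 : ℝ)⌉₊ : ℝ) + DK K ℓ γ δ) *
        (2 / (1 + odds ⌈γ * (K.choose 2 : ℝ)⌉₊ (K.choose 2))) ^ (ℓ.choose 2))

namespace AsympBounds

variable {C α : ℝ} {n K : ℕ} {γ e : ℝ}

lemma pairBound_nonneg (h : AsympBounds C α n K γ e) (δ : ℝ) (L ℓ : ℕ) :
    0 ≤ pairBound K γ δ L ℓ := by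
  have := h.one_le_odds
  unfold pairBound
  split_ifs <;> positivity

lemma choose_two_pos (h : AsympBounds C α n K γ e) : 0 < K.choose 2 :=
  (Nat.zero_le _).trans_lt h.ceil_lt

lemma erProb_flat_pair_le_pairBound (h : AsympBounds C α n K γ e) {δ : ℝ} (L : ℕ)
    {A B : Finset (Fin n)} (hA : A.card = K) (hB : B.card = K) (h2 : 2 ≤ (A ∩ B).card) :
    erProb n (fun g => IsFlatOn g K γ δ A ∧ IsFlatOn g K γ δ B) ≤
      pairBound K γ δ L (A ∩ B).card * binProb ⌈γ * (K.choose 2 : ℝ)⌉₊ (K.choose 2) ^ 2 := by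
  have hM := h.choose_two_pos
  have hγ := h.gamma_ge
  have h0 : 0 < ⌈γ * (K.choose 2 : ℝ)⌉₊ := Nat.ceil_pos.mpr (by positivity)
  have hSA : (edgeSlots A).card = K.choose 2 := by rw [card_edgeSlots, hA]
  have hSB : (edgeSlots B).card = K.choose 2 := by rw [card_edgeSlots, hB]
  unfold pairBound
  split_ifs with hL h5
  · refine (erProb_flat_pair_le A B).trans ?_
    rw [sq]
    gcongr
    · exact erProb_nonneg _
    · exact (binProb_pos h.ceil_lt.le).le
    · exact erProb_flat_le hA
    · exact erProb_flat_le hB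
  · have := erProb_pair_le_sq h0 h.ceil_lt hSA hSB
      (fun g => IsFlatOn g K γ δ A ∧ IsFlatOn g K γ δ B)
      (fun g hg => by
        rw [← edgeCount_eq_cnt, ← edgeCount_eq_cnt]
        exact ⟨hg.1.1, hg.2.1⟩)
    rw [tilt_sq_eq h.ceil_lt, edgeSlots_inter, card_edgeSlots] at this
    refine this.trans (le_of_eq ?_)
    ring
  · have := erProb_pair_le_truncated h0 h.ceil_lt h.one_le_odds hSA hSB
      ((⌈γ * ((A ∩ B).card.choose 2 : ℝ)⌉₊ : ℝ) + DK K (A ∩ B).card γ δ)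
      (fun g => IsFlatOn g K γ δ A ∧ IsFlatOn g K γ δ B)
      (fun g hg => by
        rw [edgeSlots_inter, ← edgeCount_eq_cnt, ← edgeCount_eq_cnt, ← edgeCount_eq_cnt]
        refine ⟨hg.1.1, hg.2.1, ?_⟩
        have hle : (A ∩ B).card ≤ K := hA ▸ Finset.card_le_card Finset.inter_subset_left
        rcases hle.eq_or_lt with he | hlt
        · have hAB : A ∩ B = A :=
            Finset.eq_of_subset_of_card_le Finset.inter_subset_left (by rw [he, hA])
          rw [hAB, hg.1.1, hA]
          linarith [DK_nonneg K K γ δ]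
        · exact hg.1.2 _ Finset.inter_subset_left h2 (by omega))
    rw [edgeSlots_inter, card_edgeSlots] at this
    refine this.trans (le_of_eq ?_)
    ring

end AsympBounds

/-- The exponential rate of the contribution of overlaps at distance at most `η * K` from
complete, when `log (K / distance) ≤ Λ * log n`. -/
def overlapRate (C κ Λ η e : ℝ) : ℝ :=
  2 * Λ + (1 - C) + e - (1 - η / 2 - e) * (2 * (1 - C) - e) +
    √((1 + e) * κ * (Λ + 2 * e) * (16 * (1 - C) + e))

namespace AsympBounds

variable {C α : ℝ} {n K : ℕ} {γ e : ℝ}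

/-- Overlaps at distance between `K ^ α / 40` and `x * K` from complete. -/
lemma overlapProb_mul_truncated_le_of_polynomial (h : AsympBounds C α n K γ e) {ℓ : ℕ} {x : ℝ}
    (hC : C ∈ Set.Ioo (0 : ℝ) (1 / 2)) (hα0 : 0 < α) (hα : α < 1) (hx0 : 0 < x)
    (hxd : 10 * x ≤ 1 - 2 * C) (hex : 40 * e ≤ x) (hℓ : ℓ ≤ K)
    (hy : (K : ℝ) ^ α < 40 * ((K - ℓ : ℕ) : ℝ)) (hη : ((K - ℓ : ℕ) : ℝ) ≤ x * K)
    (hG : ((K - ℓ : ℕ) : ℝ) * overlapRate C (1 + x) ((1 - α) * C + 6 * x) x x ≤ -7) :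
    overlapProb n K ℓ * (((K.choose 2 : ℝ) + 1) ^ 2 *
      (odds ⌈γ * (K.choose 2 : ℝ)⌉₊ (K.choose 2) ^
        ((⌈γ * (ℓ.choose 2 : ℝ)⌉₊ : ℝ) + DK K ℓ γ x) *
        (2 / (1 + odds ⌈γ * (K.choose 2 : ℝ)⌉₊ (K.choose 2))) ^ (ℓ.choose 2))) ≤
    Real.exp (-2 * Real.log n) := by
  obtain ⟨hC0, hC1⟩ := hC
  have hK := h.K_pos
  have he0 := h.e_pos
  have hN1 := h.log_n_ge
  have hKα : 0 < (K : ℝ) ^ α := by positivity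
  have hKα1 := h.rpow_ge
  have hcast : ((K - ℓ : ℕ) : ℝ) = K - ℓ := Nat.cast_sub hℓ
  have hy0 : (0 : ℝ) < ((K - ℓ : ℕ) : ℝ) := by linarith
  have hxy : 1 ≤ x * ((K - ℓ : ℕ) : ℝ) := by nlinarith
  refine (h.mono (by linarith : e ≤ x)).overlapProb_mul_truncated_le_of_far hC0 (by linarith)
    hx0.le hℓ le_rfl ?_ hxy hη (by linarith) (by linarith)
    (Λ := (1 - α) * C + 6 * x) ?_ hG
  · intro hc
    nlinarith
  · set y : ℝ := ((K - ℓ : ℕ) : ℝ) with hy_def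
    have h1 : Real.log (K / y) ≤ Real.log 40 + (1 - α) * Real.log K := by
      have : (K : ℝ) / y ≤ 40 * (K : ℝ) ^ (1 - α) := by
        rw [div_le_iff₀ hy0]
        calc (K : ℝ) = (K : ℝ) ^ (1 - α) * (K : ℝ) ^ α := by
              rw [← Real.rpow_add hK]; simp
          _ ≤ (K : ℝ) ^ (1 - α) * (40 * y) := by gcongr
          _ = _ := by ring
      calc Real.log (K / y) ≤ Real.log (40 * (K : ℝ) ^ (1 - α)) :=
            Real.log_le_log (by positivity) this
        _ = _ := by
          rw [Real.log_mul (by norm_num) (by positivity), Real.log_rpow hK]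
    have h40 : Real.log 40 ≤ 4 := by
      rw [Real.log_le_iff_le_exp (by norm_num)]
      have h3 : (2.7 : ℝ) ^ 4 ≤ Real.exp 1 ^ 4 := by
        gcongr
        linarith [Real.exp_one_gt_d9]
      rw [← Real.exp_nat_mul] at h3
      norm_num at h3
      linarith
    have h2 : (1 - α) * Real.log K ≤ (1 - α) * ((C + e) * Real.log n) :=
      mul_le_mul_of_nonneg_left h.log_K_le (by linarith)
    have hN : 0 ≤ Real.log n := Real.log_natCast_nonneg n
    have h3 : e * Real.log n ≤ x * Real.log n := by gcongr; linarith
    have h4 : 0 ≤ α * (e * Real.log n) := by positivity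
    linarith

/-- Overlaps at distance between `x * K` and `3 * K / 5` from complete. -/
lemma overlapProb_mul_truncated_le_of_linear (h : AsympBounds C α n K γ e) {ℓ : ℕ} {x w : ℝ}
    (hC : C ∈ Set.Ioo (0 : ℝ) (1 / 2)) (hx0 : 0 < x) (hx1 : x ≤ 1)
    (hwd : w ≤ 1 / 4) (hew : 40 * e ≤ w) (hℓ : ℓ ≤ K)
    (hey : 1 ≤ (40 * e) * ((K - ℓ : ℕ) : ℝ)) (h5 : (2 : ℝ) * K < 5 * ℓ)
    (hη : x * K ≤ ((K - ℓ : ℕ) : ℝ))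
    (hG : ((K - ℓ : ℕ) : ℝ) * overlapRate C 3 ((1 + 1 / x) * w) (3 / 5) w ≤ -7) :
    overlapProb n K ℓ * (((K.choose 2 : ℝ) + 1) ^ 2 *
      (odds ⌈γ * (K.choose 2 : ℝ)⌉₊ (K.choose 2) ^
        ((⌈γ * (ℓ.choose 2 : ℝ)⌉₊ : ℝ) + DK K ℓ γ x) *
        (2 / (1 + odds ⌈γ * (K.choose 2 : ℝ)⌉₊ (K.choose 2))) ^ (ℓ.choose 2))) ≤
    Real.exp (-2 * Real.log n) := by
  obtain ⟨hC0, hC1⟩ := hC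
  have hK := h.K_pos
  have he0 := h.e_pos
  have hN1 := h.log_n_ge
  have hcast : ((K - ℓ : ℕ) : ℝ) = K - ℓ := Nat.cast_sub hℓ
  have hy0 : (0 : ℝ) < ((K - ℓ : ℕ) : ℝ) := by nlinarith
  have hwy : 1 ≤ w * ((K - ℓ : ℕ) : ℝ) := by nlinarith
  refine (h.mono (by linarith : e ≤ w)).overlapProb_mul_truncated_le_of_far hC0 (by linarith)
    hx0.le hℓ (κ := 3) (η := 3 / 5) (by linarith) (fun _ => by linarith)
    hwy (by linarith) (by linarith) (by linarith)
    (Λ := (1 + 1 / x) * w) ?_ hG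
  have h1 : Real.log (K / ((K - ℓ : ℕ) : ℝ)) ≤ 1 / x := by
    have h2 : (K : ℝ) / ((K - ℓ : ℕ) : ℝ) ≤ 1 / x := by
      rw [div_le_div_iff₀ hy0 hx0]; linarith
    have h3 := Real.log_le_sub_one_of_pos (show (0 : ℝ) < K / ((K - ℓ : ℕ) : ℝ) by positivity)
    linarith
  calc 1 + Real.log (K / ((K - ℓ : ℕ) : ℝ)) ≤ (1 + 1 / x) * 1 := by linarith
    _ ≤ (1 + 1 / x) * (w * Real.log n) := by
      have hN : 0 ≤ Real.log n := Real.log_natCast_nonneg n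
      have : e * Real.log n ≤ w * Real.log n := by gcongr; linarith
      gcongr
      linarith
    _ = _ := by ring

end AsympBounds

open Topology in
lemma exists_overlapRate_neg_of_alpha {C α : ℝ} (hC : C ∈ Set.Ioo (0 : ℝ) (1 / 2))
    (hα : α < 1) (hα' : 1 - (5 / 2 - √6) * (1 - C) / C < α) {d : ℝ} (hd : 0 < d) :
    ∃ x, 0 < x ∧ x ≤ d ∧ overlapRate C (1 + x) ((1 - α) * C + 6 * x) x x < 0 := by
  obtain ⟨hC0, hC1⟩ := hC
  have hlim : Tendsto (fun x => overlapRate C (1 + x) ((1 - α) * C + 6 * x) x x) (𝓝[>] 0)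
      (𝓝 (overlapRate C (1 + 0) ((1 - α) * C + 6 * 0) 0 0)) := by
    have hc : Continuous (fun x => overlapRate C (1 + x) ((1 - α) * C + 6 * x) x x) := by
      unfold overlapRate; fun_prop
    exact (hc.tendsto 0).mono_left nhdsWithin_le_nhds
  have hneg : overlapRate C (1 + 0) ((1 - α) * C + 6 * 0) 0 0 < 0 := by
    set a := 1 - C with ha
    have ha0 : 0 < a := by linarith
    set b := (1 - α) * C with hb
    have hb0 : 0 < b := by apply mul_pos <;> linarith
    have hba : b < (5 / 2 - √6) * a := by
      have : 1 - α < (5 / 2 - √6) * a / C := by linarith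
      rwa [lt_div_iff₀ hC0] at this
    have h6 : √6 ^ 2 = 6 := Real.sq_sqrt (by norm_num)
    have h62 : 12 / 5 < √6 := by
      apply Real.lt_sqrt_of_sq_lt; norm_num
    have hs : √(b * (16 * a)) < a - 2 * b := by
      have h6u : √6 < 5 / 2 := by
        rw [Real.sqrt_lt' (by norm_num)]; norm_num
      apply (Real.sqrt_lt' (by nlinarith)).mpr
      have h1 : 0 < (5 / 2 - √6) * a - b := by linarith
      have h2 : 0 < (5 / 2 + √6) * a - b := by nlinarith
      nlinarith [mul_pos h1 h2]
    unfold overlapRate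
    rw [show (1 + 0) * (1 + 0) * (b + 6 * 0 + 2 * 0) * (16 * (1 - C) + 0) = b * (16 * a) by
      rw [ha]; ring]
    linarith
  have h1 := hlim.eventually_lt_const hneg
  have h2 : ∀ᶠ x : ℝ in 𝓝[>] 0, x ∈ Set.Ioo 0 d := Ioo_mem_nhdsGT hd
  obtain ⟨x, hx1, hx2⟩ := (h1.and h2).exists
  exact ⟨x, hx2.1, hx2.2.le, hx1⟩

open Topology in
lemma exists_overlapRate_neg {C c : ℝ} (hC : C < 1) {d : ℝ} (hd : 0 < d) :
    ∃ x, 0 < x ∧ x ≤ d ∧ overlapRate C 3 (c * x) (3 / 5) x < 0 := by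
  have hlim : Tendsto (fun x => overlapRate C 3 (c * x) (3 / 5) x) (𝓝[>] 0)
      (𝓝 (overlapRate C 3 (c * 0) (3 / 5) 0)) := by
    have hc : Continuous (fun x => overlapRate C 3 (c * x) (3 / 5) x) := by
      unfold overlapRate; fun_prop
    exact (hc.tendsto 0).mono_left nhdsWithin_le_nhds
  have hneg : overlapRate C 3 (c * 0) (3 / 5) 0 < 0 := by
    unfold overlapRate
    norm_num
    linarith
  have h1 := hlim.eventually_lt_const hneg
  have h2 : ∀ᶠ x : ℝ in 𝓝[>] 0, x ∈ Set.Ioo 0 d := Ioo_mem_nhdsGT hd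
  obtain ⟨x, hx1, hx2⟩ := (h1.and h2).exists
  exact ⟨x, hx2.1, hx2.2.le, hx1⟩

lemma exists_overlapProb_mul_pairBound_le {C α : ℝ} (hC : C ∈ Set.Ioo (0 : ℝ) (1 / 2))
    (hα0 : 0 < α) (hα : α < 1) (hα' : 1 - (5 / 2 - √6) * (1 - C) / C < α) :
    ∃ δ : ℝ, 0 < δ ∧ ∃ e : ℝ, 0 < e ∧ ∃ L : ℕ, ∀ n K : ℕ, ∀ γ : ℝ, AsympBounds C α n K γ e →
      (∀ ℓ, 2 ≤ ℓ → ℓ ≤ K → ℓ ≤ L → overlapProb n K ℓ * pairBound K γ δ L ℓ ≤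
        2 ^ (L ^ 2) * Real.exp (-(1 - 2 * C) * Real.log n)) ∧
      (∀ ℓ, ℓ ≤ K → L < ℓ → overlapProb n K ℓ * pairBound K γ δ L ℓ ≤
        Real.exp (-2 * Real.log n)) := by
  have ⟨hC0, hC1⟩ := hC
  obtain ⟨x, hx0, hxd, hx⟩ := exists_overlapRate_neg_of_alpha hC hα hα'
    (d := (1 - 2 * C) / 10) (by linarith)
  obtain ⟨w, hw0, hwd, hw⟩ := exists_overlapRate_neg (C := C) (c := 1 + 1 / x) (by linarith)
    (d := 1 / 4) (by norm_num)
  obtain ⟨L, hL⟩ := exists_nat_ge (max (24 / (1 - 2 * C)) (60 / (1 - C)))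
  have hL1 : 24 ≤ (1 - 2 * C) * L := by
    have := (le_max_left _ _).trans hL
    rwa [div_le_iff₀ (by linarith), mul_comm] at this
  have hL2 : 60 ≤ (1 - C) * L := by
    have := (le_max_right _ _).trans hL
    rwa [div_le_iff₀ (by linarith), mul_comm] at this
  have key : ∀ c d : ℝ, 0 < d → ∀ᶠ e : ℝ in nhdsWithin 0 (Set.Ioi 0), c * e < d := by
    intro c d hd
    have hc : Continuous (fun e : ℝ => c * e) := by fun_prop
    refine (((hc.tendsto 0).mono_left nhdsWithin_le_nhds).eventually_lt_const ?_)
    simpa using hd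
  obtain ⟨e, he0, he1, he2, he3, he4, he5, he6, he7⟩ :=
    ((show ∀ᶠ e : ℝ in nhdsWithin 0 (Set.Ioi 0), e ∈ Set.Ioi 0 from self_mem_nhdsWithin).and
    ((key 40 x hx0).and ((key 40 w hw0).and
    ((key 280 _ (neg_pos.mpr hx)).and ((key 280 _ (neg_pos.mpr hw)).and
    ((key 14 1 one_pos).and ((key 8 (1 - 2 * C) (by linarith)).and
    (key (12 / 10 + 1 / x) ((1 - C) / 10) (by linarith))))))))).exists
  have he0 : 0 < e := he0
  refine ⟨x, hx0, e, he0, L, fun n K γ h => ⟨fun ℓ h2 hℓ hℓL => ?_, fun ℓ hℓ hLℓ => ?_⟩⟩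
  · unfold pairBound
    rw [if_pos hℓL]
    exact h.overlapProb_mul_two_pow_le h2 hℓ hℓL (by linarith)
  have hK := h.K_pos
  have hLℓ' : (L : ℝ) ≤ ℓ := by exact_mod_cast hLℓ.le
  have hN1 := h.log_n_ge
  unfold pairBound
  rw [if_neg (by omega)]
  split_ifs with h5
  · rcases le_total (ℓ : ℝ) (x * K) with hη | hη
    · exact h.overlapProb_mul_tilt_le_of_small hC0 hℓ hx0.le hη (by linarith) (by linarith)
        (hL1.trans (mul_le_mul_of_nonneg_left hLℓ' (by linarith)))
    · refine h.overlapProb_mul_tilt_le_of_large h5 hx0 hη ?_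
        (hL2.trans (mul_le_mul_of_nonneg_left hLℓ' (by linarith)))
      rw [show e / x = 1 / x * e by ring]
      linarith
  · rcases le_or_gt (40 * ((K - ℓ : ℕ) : ℝ)) ((K : ℝ) ^ α) with hy | hy
    · exact h.overlapProb_mul_truncated_le_of_near hC0 (by linarith) hx0.le (by linarith)
        (by linarith) hℓ hy
    have hKα : 0 < (K : ℝ) ^ α := by positivity
    have hKα1 := h.rpow_ge
    have hey : 1 ≤ (40 * e) * ((K - ℓ : ℕ) : ℝ) := by nlinarith
    have hcast : ((K - ℓ : ℕ) : ℝ) = K - ℓ := Nat.cast_sub hℓ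
    have h5' : (2 : ℝ) * K < 5 * ℓ := by exact_mod_cast not_le.mp h5
    set y : ℝ := ((K - ℓ : ℕ) : ℝ) with hy_def
    have hy0 : 0 < y := by linarith
    rcases le_total y (x * K) with hη | hη
    · exact h.overlapProb_mul_truncated_le_of_polynomial hC hα0 hα hx0 (by linarith) (by linarith)
        hℓ hy hη (by nlinarith)
    · exact h.overlapProb_mul_truncated_le_of_linear hC hx0 (by linarith) hwd (by linarith)
        hℓ hey h5' hη (by nlinarith)

/-- The second moment of the flat count is bounded through the square of its first moment, up
to a vanishing error. -/
lemma exists_erExp_flatCount_sq_le {C α : ℝ} (hC : C ∈ Set.Ioo (0 : ℝ) (1 / 2))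
    (hα0 : 0 < α) (hα : α < 1) (hα' : 1 - (5 / 2 - √6) * (1 - C) / C < α) :
    ∃ δ : ℝ, 0 < δ ∧ ∃ e : ℝ, 0 < e ∧ ∃ L : ℝ, ∀ n K : ℕ, ∀ γ : ℝ, AsympBounds C α n K γ e →
      erExp n (fun g => (flatCount n K γ δ g : ℝ) ^ 2) ≤
        erExp n (fun g => (flatCount n K γ δ g : ℝ)) ^ 2 *
          (1 + 4 * (L * Real.exp (-(1 - 2 * C) * Real.log n) + Real.exp (-Real.log n))) := by
  obtain ⟨δ, hδ, e, he, L, hL⟩ := exists_overlapProb_mul_pairBound_le hC hα0 hα hα'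
  refine ⟨δ, hδ, e, he, (L + 1) * 2 ^ (L ^ 2), fun n K γ h => ?_⟩
  obtain ⟨h1, h2⟩ := hL n K γ h
  refine (erExp_flatCount_sq_le h.le_n h.gamma_ge hδ.le h.log_K_ge_const h.ceil_lt
    (h.pairBound_nonneg δ L) (fun A B hA hB hAB => h.erProb_flat_pair_le_pairBound L hA hB hAB)).trans ?_
  gcongr ?_ * (1 + 4 * ?_)
  have hn0 : (0 : ℝ) < n := by exact_mod_cast h.one_le.trans h.le_n
  calc ∑ ℓ ∈ Finset.Icc 2 K, overlapProb n K ℓ * pairBound K γ δ L ℓ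
      = ∑ ℓ ∈ (Finset.Icc 2 K).filter (· ≤ L), overlapProb n K ℓ * pairBound K γ δ L ℓ +
        ∑ ℓ ∈ (Finset.Icc 2 K).filter (fun ℓ => ¬ ℓ ≤ L),
          overlapProb n K ℓ * pairBound K γ δ L ℓ :=
        (Finset.sum_filter_add_sum_filter_not _ _ _).symm
    _ ≤ (L + 1) * (2 ^ (L ^ 2) * Real.exp (-(1 - 2 * C) * Real.log n)) +
        n * Real.exp (-2 * Real.log n) := by
      gcongr ?_ + ?_
      · refine (Finset.sum_le_card_nsmul _ _
          (2 ^ (L ^ 2) * Real.exp (-(1 - 2 * C) * Real.log n)) fun ℓ hℓ => ?_).trans ?_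
        · rw [Finset.mem_filter, Finset.mem_Icc] at hℓ
          exact h1 ℓ hℓ.1.1 hℓ.1.2 hℓ.2
        · rw [nsmul_eq_mul]
          gcongr
          have : ((Finset.Icc 2 K).filter (· ≤ L)).card ≤ (Finset.range (L + 1)).card := by
            apply Finset.card_le_card
            intro ℓ hℓ
            rw [Finset.mem_filter] at hℓ
            rw [Finset.mem_range]
            omega
          rw [Finset.card_range] at this
          exact_mod_cast this
      · refine (Finset.sum_le_card_nsmul _ _ (Real.exp (-2 * Real.log n)) fun ℓ hℓ => ?_).trans ?_
        · rw [Finset.mem_filter, Finset.mem_Icc] at hℓ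
          exact h2 ℓ hℓ.1.2 (by omega)
        · rw [nsmul_eq_mul]
          gcongr
          refine (Finset.card_filter_le _ _).trans ?_
          rw [Nat.card_Icc]
          have := h.le_n
          omega
    _ = _ := by
      have : (n : ℝ) * Real.exp (-2 * Real.log n) = Real.exp (-Real.log n) := by
        conv_lhs => rw [← Real.exp_log hn0]
        rw [← Real.exp_add, Real.log_exp]; congr 1; ring
      rw [this]; ring

lemma continuous_binEnt : Continuous binEnt := by
  have h1 := Real.continuous_mul_log
  have h2 : Continuous (fun x : ℝ => (1 - x) * Real.log (1 - x)) :=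
    Real.continuous_mul_log.comp (by fun_prop)
  unfold binEnt
  fun_prop

lemma binEnt_half : binEnt (1 / 2) = Real.log 2 := by
  unfold binEnt
  rw [show (1 - 1 / 2 : ℝ) = 1 / 2 by norm_num, one_div, Real.log_inv]
  ring

lemma binEnt_one : binEnt 1 = 0 := by simp [binEnt]

lemma binEntInv_mem_and_eq {v : ℝ} (h0 : 0 ≤ v) (h1 : v ≤ Real.log 2) :
    binEntInv v ∈ Set.Icc (1 / 2 : ℝ) 1 ∧ binEnt (binEntInv v) = v := by
  have h := intermediate_value_Icc' (by norm_num : (1 / 2 : ℝ) ≤ 1) continuous_binEnt.continuousOn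
  rw [binEnt_half, binEnt_one] at h
  have hv : v ∈ binEnt '' Set.Icc (1 / 2 : ℝ) 1 := h ⟨h0, h1⟩
  exact ⟨Function.invFunOn_mem hv, Function.invFunOn_eq hv⟩

open Topology in
/-- The consequences of `K = Θ(n ^ C)` on a logarithmic scale. -/
structure PolyGrowth (K : ℕ → ℕ) (C : ℝ) : Prop where
  tendsto_atTop : Tendsto (fun n => (K n : ℝ)) atTop atTop
  tendsto_log_div : Tendsto (fun n : ℕ => Real.log (K n) / Real.log n) atTop (𝓝 C)
  tendsto_div_log : Tendsto (fun n : ℕ => Real.log n / K n) atTop (𝓝 0)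

lemma tendsto_log_natCast : Tendsto (fun n : ℕ => Real.log n) atTop atTop :=
  Real.tendsto_log_atTop.comp tendsto_natCast_atTop_atTop

open Topology in
lemma polyGrowth_of_theta {K : ℕ → ℕ} {C : ℝ} (hC : 0 < C)
    (hK : ∃ c₁ c₂ : ℝ, 0 < c₁ ∧ 0 < c₂ ∧
      ∀ᶠ n : ℕ in atTop, c₁ * (n : ℝ) ^ C ≤ (K n : ℝ) ∧ (K n : ℝ) ≤ c₂ * (n : ℝ) ^ C) :
    PolyGrowth K C := by
  obtain ⟨c₁, c₂, hc₁, hc₂, hK⟩ := hK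
  have hpow : Tendsto (fun n : ℕ => (n : ℝ) ^ C) atTop atTop :=
    (tendsto_rpow_atTop hC).comp tendsto_natCast_atTop_atTop
  have hlog := tendsto_log_natCast
  refine ⟨?_, ?_, ?_⟩
  · exact tendsto_atTop_mono' _ (hK.mono fun n h => h.1) (hpow.const_mul_atTop hc₁)
  · have key : ∀ c : ℝ, Tendsto (fun n : ℕ => c / Real.log n + C) atTop (𝓝 C) := fun c => by
      simpa using (hlog.const_div_atTop c).add_const C
    apply tendsto_of_tendsto_of_tendsto_of_le_of_le' (key (Real.log c₁)) (key (Real.log c₂))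
    all_goals
      filter_upwards [hK, eventually_gt_atTop 0, hlog.eventually_gt_atTop 0] with n h hn hN
      have hn0 : (0 : ℝ) < n := by exact_mod_cast hn
      have hp : 0 < (n : ℝ) ^ C := by positivity
      have hK0 : (0 : ℝ) < K n := lt_of_lt_of_le (by positivity) h.1
    · rw [div_add' _ _ _ hN.ne']
      gcongr
      rw [← Real.log_rpow hn0, ← Real.log_mul hc₁.ne' hp.ne']
      exact Real.log_le_log (by positivity) h.1
    · rw [div_add' _ _ _ hN.ne']
      gcongr
      rw [← Real.log_rpow hn0, ← Real.log_mul hc₂.ne' hp.ne']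
      exact Real.log_le_log hK0 h.2
  · have h0 : Tendsto (fun n : ℕ => c₁⁻¹ * (Real.log n / (n : ℝ) ^ C)) atTop (𝓝 0) := by
      have := ((isLittleO_log_rpow_atTop hC).tendsto_div_nhds_zero.comp
        tendsto_natCast_atTop_atTop).const_mul c₁⁻¹
      simpa using this
    apply squeeze_zero' _ _ h0
    · filter_upwards [hlog.eventually_gt_atTop 0] with n hN
      positivity
    · filter_upwards [hK, eventually_gt_atTop 0, hlog.eventually_gt_atTop 0] with n h hn hN
      have hn0 : (0 : ℝ) < n := by exact_mod_cast hn
      have hp : 0 < (n : ℝ) ^ C := by positivity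
      calc Real.log n / K n ≤ Real.log n / (c₁ * (n : ℝ) ^ C) := by
            gcongr
            exact h.1
        _ = _ := by field_simp

namespace PolyGrowth

open Topology

variable {K : ℕ → ℕ} {C α : ℝ}

lemma eventually_two_le (h : PolyGrowth K C) : ∀ᶠ n in atTop, 2 ≤ K n := by
  filter_upwards [h.tendsto_atTop.eventually_ge_atTop 2] with n hn
  exact_mod_cast hn

lemma eventually_le (h : PolyGrowth K C) (hC : C < 1) : ∀ᶠ n in atTop, K n ≤ n := by
  filter_upwards [h.tendsto_log_div.eventually_lt_const hC, h.eventually_two_le,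
    tendsto_log_natCast.eventually_gt_atTop 0, eventually_gt_atTop 0] with n h1 h2 h3 h4
  rw [div_lt_one h3] at h1
  have h5 : (K n : ℝ) < n :=
    (Real.log_lt_log_iff (by exact_mod_cast (by omega : 0 < K n)) (by exact_mod_cast h4)).mp h1
  exact_mod_cast h5.le

lemma tendsto_log_choose_div (h : PolyGrowth K C) (hC : C < 1) :
    Tendsto (fun n : ℕ => Real.log (n.choose (K n) : ℝ) / (K n * Real.log n)) atTop
      (𝓝 (1 - C)) := by
  have h1 : Tendsto (fun n : ℕ => 1 - Real.log (K n) / Real.log n) atTop (𝓝 (1 - C)) :=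
    h.tendsto_log_div.const_sub 1
  have h2 : Tendsto (fun n : ℕ => 1 / Real.log n + (1 - Real.log (K n) / Real.log n)) atTop
      (𝓝 (1 - C)) := by
    simpa using (tendsto_log_natCast.const_div_atTop 1).add h1
  apply tendsto_of_tendsto_of_tendsto_of_le_of_le' h1 h2
  all_goals
    filter_upwards [h.eventually_le hC, h.eventually_two_le,
      tendsto_log_natCast.eventually_gt_atTop 0] with n hKn hK2 hN
    have hK0 : (0 : ℝ) < K n := by exact_mod_cast (by omega : 0 < K n)
    have hn0 : (0 : ℝ) < n := by exact_mod_cast (by omega : 0 < n)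
    have hl : Real.log ((n : ℝ) / K n) = Real.log n - Real.log (K n) :=
      Real.log_div hn0.ne' hK0.ne'
  · rw [le_div_iff₀ (by positivity)]
    refine le_trans (le_of_eq ?_) (mul_log_div_le_log_choose (by omega) hKn)
    rw [hl]; field_simp
  · rw [div_le_iff₀ (by positivity)]
    refine (log_choose_le (by omega) hKn).trans (le_of_eq ?_)
    rw [hl]; field_simp

/-- The excess `log (n.choose K) - K ^ α * log n` in the definition of the density threshold. -/
def excess (K : ℕ → ℕ) (α : ℝ) (n : ℕ) : ℝ :=
  Real.log (n.choose (K n) : ℝ) - (K n : ℝ) ^ α * Real.log n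

lemma tendsto_excess_div (h : PolyGrowth K C) (hC : C < 1) (hα : α < 1) :
    Tendsto (fun n : ℕ => excess K α n / (K n * Real.log n)) atTop (𝓝 (1 - C)) := by
  have h1 : Tendsto (fun n : ℕ => (K n : ℝ) ^ (-(1 - α))) atTop (𝓝 0) :=
    (tendsto_rpow_neg_atTop (by linarith)).comp h.tendsto_atTop
  have h2 := (h.tendsto_log_choose_div hC).sub h1
  rw [sub_zero] at h2
  refine h2.congr' ?_
  filter_upwards [h.eventually_two_le, tendsto_log_natCast.eventually_gt_atTop 0] with n hK2 hN
  have hK0 : (0 : ℝ) < K n := by exact_mod_cast (by omega : 0 < K n)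
  unfold excess
  rw [sub_div]
  congr 1
  rw [mul_div_mul_right _ _ hN.ne', neg_sub, Real.rpow_sub_one hK0.ne']

lemma tendsto_inv_pred (h : PolyGrowth K C) :
    Tendsto (fun n : ℕ => 1 / ((K n : ℝ) - 1)) atTop (𝓝 0) :=
  (tendsto_atTop_add_const_right _ (-1) h.tendsto_atTop).const_div_atTop 1

lemma tendsto_mul_excess_div (h : PolyGrowth K C) (hC : C < 1) (hα : α < 1) :
    Tendsto (fun n : ℕ => K n * (excess K α n / ((K n).choose 2 : ℝ)) / Real.log n) atTop
      (𝓝 (2 * (1 - C))) := by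
  have h1 := ((h.tendsto_excess_div hC hα).const_mul 2).mul (h.tendsto_inv_pred.const_add 1)
  rw [add_zero, mul_one] at h1
  refine h1.congr' ?_
  filter_upwards [h.eventually_two_le, tendsto_log_natCast.eventually_gt_atTop 0] with n hK2 hN
  have hK2' : (2 : ℝ) ≤ K n := by exact_mod_cast hK2
  have hK1 : (K n : ℝ) - 1 ≠ 0 := by linarith
  have hK0 : (K n : ℝ) ≠ 0 := by linarith
  rw [Nat.cast_choose_two]
  field_simp
  ring

lemma tendsto_excess_div_choose_two (h : PolyGrowth K C) (hC : C < 1) (hα : α < 1) :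
    Tendsto (fun n : ℕ => excess K α n / ((K n).choose 2 : ℝ)) atTop (𝓝 0) := by
  have h1 := (h.tendsto_mul_excess_div hC hα).mul h.tendsto_div_log
  rw [mul_zero] at h1
  refine h1.congr' ?_
  filter_upwards [h.eventually_two_le, tendsto_log_natCast.eventually_gt_atTop 0] with n hK2 hN
  have hK0 : (K n : ℝ) ≠ 0 := by
    have : (0 : ℝ) < K n := by exact_mod_cast (by omega : 0 < K n)
    exact this.ne'
  field_simp

lemma eventually_gammaSeq (h : PolyGrowth K C) (hC : C < 1) (hα : α < 1) :
    ∀ᶠ n in atTop, 1 / 2 ≤ gammaSeq K α n ∧ gammaSeq K α n < 1 ∧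
      entDeficit (gammaSeq K α n) = excess K α n / ((K n).choose 2 : ℝ) := by
  have hlog2 : 0 < Real.log 2 := Real.log_pos (by norm_num)
  filter_upwards [(h.tendsto_excess_div_choose_two hC hα).eventually_lt_const hlog2,
    (h.tendsto_mul_excess_div hC hα).eventually_const_lt (by linarith : 0 < 2 * (1 - C)),
    h.eventually_two_le, tendsto_log_natCast.eventually_gt_atTop 0] with n h1 h2 h3 h4
  have hK0 : (0 : ℝ) < K n := by exact_mod_cast (by omega : 0 < K n)
  have h5 : 0 < excess K α n / ((K n).choose 2 : ℝ) := by
    rw [lt_div_iff₀ h4, zero_mul] at h2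
    exact (mul_pos_iff_of_pos_left hK0).mp h2
  obtain ⟨h6, h7⟩ := binEntInv_mem_and_eq
    (v := Real.log 2 - excess K α n / ((K n).choose 2 : ℝ)) (by linarith) (by linarith)
  change gammaSeq K α n ∈ _ at h6
  change binEnt (gammaSeq K α n) = _ at h7
  refine ⟨h6.1, lt_of_le_of_ne h6.2 fun h8 => ?_, ?_⟩
  · rw [h8, binEnt_one] at h7
    linarith
  · rw [entDeficit, h7]; ring

lemma tendsto_gammaSeq (h : PolyGrowth K C) (hC : C < 1) (hα : α < 1) :
    Tendsto (gammaSeq K α) atTop (𝓝 (1 / 2)) := by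
  have h1 : Tendsto (fun n => √(excess K α n / ((K n).choose 2 : ℝ) / 2) + 1 / 2) atTop
      (𝓝 (1 / 2)) := by
    have := (((h.tendsto_excess_div_choose_two hC hα).div_const 2).sqrt).add_const (1 / 2)
    simpa using this
  apply tendsto_of_tendsto_of_tendsto_of_le_of_le' tendsto_const_nhds h1
  · exact (h.eventually_gammaSeq hC hα).mono fun n h => h.1
  · filter_upwards [h.eventually_gammaSeq hC hα] with n h2
    have h3 := two_mul_sq_le_entDeficit h2.1 h2.2.1
    rw [h2.2.2] at h3
    rw [← sub_le_iff_le_add]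
    apply Real.le_sqrt_of_sq_le
    linarith

/-- The exact edge density of a flat subgraph. -/
def density (K : ℕ → ℕ) (α : ℝ) (n : ℕ) : ℝ :=
  (⌈gammaSeq K α n * ((K n).choose 2 : ℝ)⌉₊ : ℝ) / ((K n).choose 2 : ℝ)

lemma tendsto_inv_choose_two (h : PolyGrowth K C) :
    Tendsto (fun n => 1 / ((K n).choose 2 : ℝ)) atTop (𝓝 0) := by
  have h1 : Tendsto (fun n => 2 * (1 / (K n : ℝ)) * (1 / ((K n : ℝ) - 1))) atTop (𝓝 0) := by
    have := ((h.tendsto_atTop.const_div_atTop 1).const_mul 2).mul h.tendsto_inv_pred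
    simpa using this
  refine h1.congr fun n => ?_
  rw [Nat.cast_choose_two]
  simp only [div_eq_mul_inv, mul_inv, inv_inv]
  ring

lemma eventually_density (h : PolyGrowth K C) (hC : C < 1) (hα : α < 1) :
    ∀ᶠ n in atTop, gammaSeq K α n ≤ density K α n ∧
      density K α n ≤ gammaSeq K α n + 1 / ((K n).choose 2 : ℝ) := by
  filter_upwards [h.eventually_gammaSeq hC hα, h.eventually_two_le] with n h1 h2
  have hM : (0 : ℝ) < (K n).choose 2 := by exact_mod_cast Nat.choose_pos h2
  have hγ : 0 ≤ gammaSeq K α n * ((K n).choose 2 : ℝ) := by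
    have := h1.1
    apply mul_nonneg _ hM.le
    linarith
  unfold density
  constructor
  · rw [le_div_iff₀ hM]; exact Nat.le_ceil _
  · rw [div_le_iff₀ hM, add_mul, one_div_mul_cancel hM.ne']
    exact (Nat.ceil_lt_add_one hγ).le

lemma tendsto_density (h : PolyGrowth K C) (hC : C < 1) (hα : α < 1) :
    Tendsto (density K α) atTop (𝓝 (1 / 2)) := by
  have h1 := (h.tendsto_gammaSeq hC hα).add h.tendsto_inv_choose_two
  rw [add_zero] at h1
  exact tendsto_of_tendsto_of_tendsto_of_le_of_le' (h.tendsto_gammaSeq hC hα) h1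
    ((h.eventually_density hC hα).mono fun n h => h.1)
    ((h.eventually_density hC hα).mono fun n h => h.2)

/-- The logarithm of the odds ratio of the density. -/
def logOdds (K : ℕ → ℕ) (α : ℝ) (n : ℕ) : ℝ :=
  Real.log (density K α n / (1 - density K α n))

lemma tendsto_logOdds (h : PolyGrowth K C) (hC : C < 1) (hα : α < 1) :
    Tendsto (logOdds K α) atTop (𝓝 0) := by
  have h1 := h.tendsto_density hC hα
  have h2 := (h1.div (h1.const_sub 1) (by norm_num)).log (by norm_num)
  norm_num at h2
  exact h2

/-- An asymptotically sharp upper bound for the normalized squared bias of the density. -/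
def biasBound (K : ℕ → ℕ) (α : ℝ) (n : ℕ) : ℝ :=
  2 * (K n * (excess K α n / ((K n).choose 2 : ℝ)) / Real.log n +
    2 * (1 / ((K n : ℝ) - 1)) * logOdds K α n * (1 / Real.log n))

lemma tendsto_biasBound (h : PolyGrowth K C) (hC : C < 1) (hα : α < 1) :
    Tendsto (biasBound K α) atTop (𝓝 (4 * (1 - C))) := by
  have h1 := ((h.tendsto_mul_excess_div hC hα).add
    (((h.tendsto_inv_pred.const_mul 2).mul (h.tendsto_logOdds hC hα)).mul
      (tendsto_log_natCast.const_div_atTop 1))).const_mul 2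
  rw [show 2 * (2 * (1 - C) + 2 * 0 * 0 * 0) = 4 * (1 - C) by ring] at h1
  exact h1

lemma eventually_sq_bias_le (h : PolyGrowth K C) (hC : C < 1) (hα : α < 1) :
    ∀ᶠ n : ℕ in atTop, K n * (4 * (density K α n - 1 / 2) ^ 2) / Real.log n ≤
      biasBound K α n := by
  filter_upwards [h.eventually_gammaSeq hC hα, h.eventually_two_le, h.eventually_density hC hα,
    (h.tendsto_density hC hα).eventually_lt_const (by norm_num : (1 / 2 : ℝ) < 1),
    tendsto_log_natCast.eventually_gt_atTop 0] with n h1 h2 h3 h4 h5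
  have hM : (0 : ℝ) < (K n).choose 2 := by exact_mod_cast Nat.choose_pos h2
  have hK2 : (2 : ℝ) ≤ K n := by exact_mod_cast h2
  have h6 := entDeficit_le_add (by linarith [h1.1] : 0 < gammaSeq K α n) h1.2.1
    (by linarith [h1.1] : 0 < density K α n) h4
  have h7 := two_mul_sq_le_entDeficit (h1.1.trans h3.1) h4
  have h8 : 0 ≤ logOdds K α n := by
    apply Real.log_nonneg
    rw [le_div_iff₀ (by linarith)]
    linarith [h1.1]
  have h9 : (density K α n - gammaSeq K α n) * logOdds K α n ≤
      1 / ((K n).choose 2 : ℝ) * logOdds K α n := by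
    gcongr
    linarith
  rw [h1.2.2] at h6
  have h10 : 4 * (density K α n - 1 / 2) ^ 2 ≤ 2 * (excess K α n / ((K n).choose 2 : ℝ) +
      1 / ((K n).choose 2 : ℝ) * logOdds K α n) := by
    unfold logOdds at h9 ⊢
    linarith
  calc _ ≤ K n * (2 * (excess K α n / ((K n).choose 2 : ℝ) +
      1 / ((K n).choose 2 : ℝ) * logOdds K α n)) / Real.log n := by gcongr
    _ = _ := by
      have hK1 : (K n : ℝ) - 1 ≠ 0 := by linarith
      have hK0 : (K n : ℝ) ≠ 0 := by linarith
      unfold biasBound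
      rw [Nat.cast_choose_two]
      field_simp

lemma eventually_sq_logOdds_le (h : PolyGrowth K C) (hC : C < 1) (hα : α < 1) :
    ∀ᶠ n : ℕ in atTop, K n * logOdds K α n ^ 2 / Real.log n ≤
      biasBound K α n * (1 / (1 - density K α n) ^ 2) := by
  filter_upwards [h.eventually_gammaSeq hC hα, h.eventually_sq_bias_le hC hα,
    h.eventually_density hC hα,
    (h.tendsto_density hC hα).eventually_lt_const (by norm_num : (1 / 2 : ℝ) < 1),
    tendsto_log_natCast.eventually_gt_atTop 0] with n h1 h2 h3 h4 h5
  have hp : 1 / 2 ≤ density K α n := h1.1.trans h3.1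
  have h8 : 0 ≤ logOdds K α n := by
    apply Real.log_nonneg
    rw [le_div_iff₀ (by linarith)]
    linarith
  have h9 : logOdds K α n ≤ 2 * (density K α n - 1 / 2) / (1 - density K α n) := by
    refine (Real.log_le_sub_one_of_pos (div_pos (by linarith) (by linarith))).trans (le_of_eq ?_)
    have : 1 - density K α n ≠ 0 := by linarith
    field_simp
    ring
  calc K n * logOdds K α n ^ 2 / Real.log n
      ≤ K n * (2 * (density K α n - 1 / 2) / (1 - density K α n)) ^ 2 / Real.log n := by gcongr
    _ = (K n * (4 * (density K α n - 1 / 2) ^ 2) / Real.log n) *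
        (1 / (1 - density K α n) ^ 2) := by rw [div_pow]; ring
    _ ≤ _ := by gcongr

lemma eventually_asympBounds (h : PolyGrowth K C) (hC0 : 0 < C) (hC : C < 1) (hα0 : 0 < α)
    (hα : α < 1) {e : ℝ} (he : 0 < e) :
    ∀ᶠ n in atTop, AsympBounds C α n (K n) (gammaSeq K α n) e := by
  have hlo := ((h.tendsto_biasBound hC hα).mul
    ((tendsto_const_nhds (x := (1 : ℝ))).div (((h.tendsto_density hC hα).const_sub 1).pow 2)
      (by norm_num)))
  have hlo' := hlo.eventually_lt_const
    (by norm_num; linarith : 4 * (1 - C) * (1 / (1 - 1 / 2) ^ 2) < 16 * (1 - C) + e)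
  filter_upwards [h.eventually_gammaSeq hC hα, h.eventually_sq_bias_le hC hα,
    h.eventually_sq_logOdds_le hC hα, h.eventually_density hC hα, h.eventually_two_le,
    h.eventually_le hC,
    (h.tendsto_density hC hα).eventually_lt_const (by norm_num : (1 / 2 : ℝ) < 1),
    (h.tendsto_gammaSeq hC hα).eventually_lt_const (by linarith : (1 / 2 : ℝ) < (1 + e) / 2),
    tendsto_log_natCast.eventually_gt_atTop 0,
    (tendsto_log_natCast.const_mul_atTop he).eventually_ge_atTop 1,
    (h.tendsto_atTop.const_mul_atTop he).eventually_ge_atTop 1,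
    (((tendsto_rpow_atTop hα0).comp h.tendsto_atTop).const_mul_atTop he).eventually_ge_atTop 1,
    (Real.tendsto_log_atTop.comp h.tendsto_atTop).eventually_ge_atTop 100,
    h.tendsto_log_div.eventually_lt_const (by linarith : C < C + e),
    h.tendsto_log_div.eventually_const_lt (by linarith : C - e < C),
    (h.tendsto_mul_excess_div hC hα).eventually_const_lt
      (by linarith : 2 * (1 - C) - e < 2 * (1 - C)),
    (h.tendsto_biasBound hC hα).eventually_lt_const
      (by linarith : 4 * (1 - C) < 4 * (1 - C) + e),
    (h.tendsto_logOdds hC hα).eventually_lt_const one_pos, hlo']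
    with n h1 h2 h3 h4 h5 h6 h7 h8 h9 h10 h11 h12 h13 h14 h15 h16 h17 h18 h19
  have hM : (0 : ℝ) < (K n).choose 2 := by exact_mod_cast Nat.choose_pos h5
  have hE : ⌈gammaSeq K α n * ((K n).choose 2 : ℝ)⌉₊ < (K n).choose 2 := by
    unfold density at h7
    rw [div_lt_one hM] at h7
    exact_mod_cast h7
  have hodds : Real.log (odds ⌈gammaSeq K α n * ((K n).choose 2 : ℝ)⌉₊ ((K n).choose 2)) =
      logOdds K α n := by rw [odds_eq hE]; rfl
  exact
    { e_pos := he
      one_le := by omega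
      le_n := h6
      log_K_ge_const := by simp only [Function.comp] at h13; linarith
      log_n_ge := h10
      rpow_ge := h12
      K_ge := h11
      log_K_ge := ((lt_div_iff₀ h9).mp h15).le
      log_K_le := ((div_lt_iff₀ h9).mp h14).le
      gamma_ge := h1.1
      gamma_lt := h1.2.1
      gamma_le := by linarith
      ceil_lt := hE
      log_choose_eq := by
        rw [h1.2.2, mul_div_cancel₀ _ hM.ne']
        unfold excess
        ring
      entDeficit_ge := by
        rw [h1.2.2]
        exact ((lt_div_iff₀ h9).mp h16).le
      one_le_odds := by
        rw [odds_eq hE]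
        change 1 ≤ density K α n / (1 - density K α n)
        rw [le_div_iff₀ (by linarith)]
        linarith [h1.1, h4.1]
      log_odds_le := by rw [hodds]; exact h18.le
      sq_log_odds_le := by
        rw [hodds]
        exact (div_le_iff₀ h9).mp (h3.trans h19.le)
      sq_bias_le := (div_le_iff₀ h9).mp (h2.trans h17.le) }

end PolyGrowth

lemma sq_erExp_le_erExp_sq {n : ℕ} (f : ERGraph n → ℝ) :
    erExp n f ^ 2 ≤ erExp n (fun g => f g ^ 2) := by
  have h := sq_erExp_le f (fun _ => True) (by simp)
  refine h.trans (mul_le_of_le_one_right ?_ (erProb_le_one _))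
  exact div_nonneg (Finset.sum_nonneg fun g _ => sq_nonneg _) (Nat.cast_nonneg _)

/-- (Conditional second moment method.) For `K = Θ(n^C)`,
`C ∈ (0,1/2)`, and `α ∈ (0,1)` with `α > 1 − (5/2 − √6)(1−C)/C`, there is `δ > 0`
with `E[Ẑ²]/E[Ẑ]² = 1 + o(1)`; in particular `Z_{K,γ} ≥ Ẑ_{K,γ,δ} ≥ 1` w.h.p. -/
theorem flat_second_moment
    (K : ℕ → ℕ) (C α : ℝ)
    (hC : C ∈ Set.Ioo (0 : ℝ) (1/2))
    (hK : ∃ c₁ c₂ : ℝ, 0 < c₁ ∧ 0 < c₂ ∧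
      ∀ᶠ n : ℕ in atTop, c₁ * (n : ℝ) ^ C ≤ (K n : ℝ) ∧ (K n : ℝ) ≤ c₂ * (n : ℝ) ^ C)
    (hα : α ∈ Set.Ioo (0 : ℝ) 1)
    (hα' : 1 - (5/2 - Real.sqrt 6) * (1 - C) / C < α) :
    ∃ δ : ℝ, 0 < δ ∧
      Tendsto (fun n : ℕ =>
        erExp n (fun g => (flatCount n (K n) (gammaSeq K α n) δ g : ℝ) ^ 2) /
          (erExp n (fun g => (flatCount n (K n) (gammaSeq K α n) δ g : ℝ))) ^ 2)
        atTop (nhds 1) ∧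
      Tendsto (fun n : ℕ =>
        erMeasure n {g : ERGraph n |
          1 ≤ flatCount n (K n) (gammaSeq K α n) δ g ∧
          flatCount n (K n) (gammaSeq K α n) δ g ≤ denseCount n (K n) (gammaSeq K α n) g})
        atTop (nhds 1) := by
  have ⟨hC0, hC1⟩ := hC
  obtain ⟨hα0, hα1⟩ := hα
  obtain ⟨δ, hδ, e, he, L, hL⟩ := exists_erExp_flatCount_sq_le hC hα0 hα1 hα'
  have hasymp := (polyGrowth_of_theta hC0 hK).eventually_asympBounds hC0 (by linarith) hα0 hα1 he
  have hpos : ∀ᶠ n in atTop,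
      0 < erExp n (fun g => (flatCount n (K n) (gammaSeq K α n) δ g : ℝ)) :=
    hasymp.mono fun n h =>
      erExp_flatCount_pos h.le_n h.gamma_ge hδ.le h.log_K_ge_const h.ceil_lt
  have hratio : Tendsto (fun n : ℕ =>
      erExp n (fun g => (flatCount n (K n) (gammaSeq K α n) δ g : ℝ) ^ 2) /
        (erExp n (fun g => (flatCount n (K n) (gammaSeq K α n) δ g : ℝ))) ^ 2)
      atTop (nhds 1) := by
    have hlim : Tendsto (fun n : ℕ => 1 + 4 * (L * Real.exp (-(1 - 2 * C) * Real.log n) +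
        Real.exp (-Real.log n))) atTop (nhds 1) := by
      have h1 : Tendsto (fun n : ℕ => Real.exp (-(1 - 2 * C) * Real.log n)) atTop (nhds 0) :=
        Real.tendsto_exp_atBot.comp
          (tendsto_log_natCast.const_mul_atTop_of_neg (by linarith))
      have h2 : Tendsto (fun n : ℕ => Real.exp (-Real.log n)) atTop (nhds 0) :=
        Real.tendsto_exp_atBot.comp (tendsto_neg_atTop_atBot.comp tendsto_log_natCast)
      simpa using (((h1.const_mul L).add h2).const_mul 4).const_add 1
    apply tendsto_of_tendsto_of_tendsto_of_le_of_le' tendsto_const_nhds hlim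
    · filter_upwards [hpos] with n h
      rw [one_le_div (by positivity)]
      exact sq_erExp_le_erExp_sq _
    · filter_upwards [hpos, hasymp] with n h h'
      rw [div_le_iff₀ (by positivity), mul_comm]
      exact hL n (K n) _ h'
  refine ⟨δ, hδ, hratio, ?_⟩
  simp_rw [erMeasure_eq_erProb]
  rw [← ENNReal.ofReal_one]
  apply ENNReal.tendsto_ofReal
  have hinv := hratio.inv₀ one_ne_zero
  rw [inv_one] at hinv
  apply tendsto_of_tendsto_of_tendsto_of_le_of_le' hinv tendsto_const_nhds
  · filter_upwards [hpos] with n h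
    have h1 := sq_erExp_le (fun g => (flatCount n (K n) (gammaSeq K α n) δ g : ℝ))
      (fun g => 1 ≤ flatCount n (K n) (gammaSeq K α n) δ g ∧
        flatCount n (K n) (gammaSeq K α n) δ g ≤ denseCount n (K n) (gammaSeq K α n) g)
      (fun g hg => by
        simp only [flatCount_le_denseCount, and_true, not_le, Nat.lt_one_iff] at hg
        simp [hg])
    have h2 := sq_erExp_le_erExp_sq
      (fun g => (flatCount n (K n) (gammaSeq K α n) δ g : ℝ))
    have h3 := sq_pos_of_pos h
    rw [inv_div, div_le_iff₀ (h3.trans_le h2), mul_comm]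
    exact h1
  · exact Eventually.of_forall fun n => erProb_le_one _

end
end

section
/- Let α ∈ (0,1) and suppose K = Θ(n^C) for some C ∈ (0,1). For any γ satisfying γ = h⁻¹(log 2 − (log binom(n,K) − O(K^α·log n))/binom(K,2)), it holds that γ = 1/2 + (1 + o(1))·√(log(n/K)/K) = 1/2 + Θ(√(log n / K)); furthermore r(γ,1/2) = log 2 − h(γ) = (1 + o(1))·(2·log(n/K))/K = Θ(log n / K). -/
open Filter

noncomputable section

lemma binEnt_eq_binEntropy : binEnt = Real.binEntropy := by
  ext x
  simp only [binEnt, Real.binEntropy, Real.log_inv]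
  ring

lemma binEntInv_mem_and_binEnt_binEntInv {y : ℝ} (h₀ : 0 ≤ y) (h₁ : y ≤ Real.log 2) :
    binEntInv y ∈ Set.Icc (1/2 : ℝ) 1 ∧ binEnt (binEntInv y) = y := by
  apply Function.invFunOn_pos
  have hcont : ContinuousOn Real.binEntropy (Set.Icc (1/2 : ℝ) 1) :=
    Real.binEntropy_continuous.continuousOn
  have := intermediate_value_Icc' (by norm_num : (1/2 : ℝ) ≤ 1) hcont
  rw [one_div, Real.binEntropy_two_inv, Real.binEntropy_one] at this
  rw [binEnt_eq_binEntropy, one_div]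
  exact this ⟨h₀, h₁⟩

lemma tendsto_log_two_sub_binEntropy_div_sq :
    Tendsto (fun x : ℝ => (Real.log 2 - Real.binEntropy (1/2 + x)) / x ^ 2)
      (nhdsWithin 0 {0}ᶜ) (nhds 2) := by
  have hnear : ∀ᶠ x : ℝ in nhds 0, x ∈ Set.Ioo (-1/2 : ℝ) (1/2) :=
    Ioo_mem_nhds (by norm_num) (by norm_num)
  refine HasDerivAt.lhopital_zero_nhdsNE
    (f' := fun x => Real.log (1/2 + x) - Real.log (1/2 - x)) (g' := fun x => 2 * x)
    ?_ ?_ ?_ ?_ ?_ ?_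
  · refine eventually_nhdsWithin_of_eventually_nhds (hnear.mono fun x hx => ?_)
    have h1 := Real.hasDerivAt_binEntropy (p := 1/2 + x) (by linarith [hx.1]) (by linarith [hx.2])
    convert! (h1.comp_const_add (1/2) x).const_sub (Real.log 2) using 1
    rw [show (1 : ℝ) - (1/2 + x) = 1/2 - x by ring]
    ring
  · refine Eventually.of_forall fun x => ?_
    simpa using hasDerivAt_pow 2 x
  · filter_upwards [self_mem_nhdsWithin] with x hx
    simpa using hx
  · refine tendsto_nhdsWithin_of_tendsto_nhds ?_
    have : Continuous fun x : ℝ => Real.log 2 - Real.binEntropy (1/2 + x) := by fun_prop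
    simpa using this.tendsto 0
  · refine tendsto_nhdsWithin_of_tendsto_nhds ?_
    simpa using (continuous_pow (M := ℝ) 2).tendsto 0
  · have h : HasDerivAt (fun x : ℝ => Real.log (1/2 + x) - Real.log (1/2 - x)) 4 0 := by
      convert! (((hasDerivAt_id (0 : ℝ)).const_add (1/2)).log (by norm_num)).sub
        (((hasDerivAt_id (0 : ℝ)).const_sub (1/2)).log (by norm_num)) using 1
      norm_num
    have h2 := (hasDerivAt_iff_tendsto_slope.mp h).div_const 2
    norm_num at h2
    refine h2.congr fun x => ?_
    simp [slope_def_field]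
    ring

lemma tendsto_of_tendsto_binEntropy {ι : Type*} {l : Filter ι} {g : ι → ℝ}
    (hmem : ∀ᶠ i in l, g i ∈ Set.Icc (1/2 : ℝ) 1)
    (h : Tendsto (fun i => Real.binEntropy (g i)) l (nhds (Real.log 2))) :
    Tendsto g l (nhds (1/2)) := by
  refine tendsto_order.mpr ⟨fun a ha => hmem.mono fun i hi => ha.trans_le hi.1, fun a ha => ?_⟩
  have hb : Real.binEntropy (min a 1) < Real.log 2 := by
    rw [Real.binEntropy_lt_log_two]
    have : (1/2 : ℝ) < min a 1 := lt_min ha (by norm_num)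
    rw [one_div] at this
    exact this.ne'
  filter_upwards [hmem, h.eventually_const_lt hb] with i hi hlt
  by_contra! hai
  have hanti := Real.binEntropy_strictAntiOn.antitoneOn (a := min a 1) (b := g i)
    ⟨by rw [← one_div]; exact le_min ha.le (by norm_num), min_le_right _ _⟩
    ⟨by rw [← one_div]; exact hi.1, hi.2⟩ ((min_le_left _ _).trans hai)
  linarith

lemma mul_log_sub_log_two_le_log_choose {n k : ℕ} (hk : 0 < k) (hkn : 2 * k ≤ n) :
    k * (Real.log ((n : ℝ) / k) - Real.log 2) ≤ Real.log (n.choose k : ℝ) := by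
  have hk' : (0 : ℝ) < k := by exact_mod_cast hk
  have hkn' : 2 * (k : ℝ) ≤ n := by exact_mod_cast hkn
  have hn' : (0 : ℝ) < n := by linarith
  rw [← Real.log_div (by positivity) two_ne_zero, ← Real.log_pow]
  apply Real.log_le_log (by positivity)
  refine le_trans ?_ (Nat.pow_le_choose k n)
  have hfac : (k.factorial : ℝ) ≤ (k : ℝ) ^ k := by exact_mod_cast Nat.factorial_le_pow k
  have hsub : (n : ℝ) / 2 ≤ ((n + 1 - k : ℕ) : ℝ) := by
    rw [Nat.cast_sub (by omega)]
    push_cast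
    linarith
  calc ((n : ℝ) / k / 2) ^ k = ((n : ℝ) / 2) ^ k / (k : ℝ) ^ k := by
        rw [← div_pow]; congr 1; ring
    _ ≤ ((n + 1 - k : ℕ) : ℝ) ^ k / (k.factorial : ℝ) := by gcongr

lemma log_choose_le_mul_log_add_one {n k : ℕ} (hk : 0 < k) (hkn : k ≤ n) :
    Real.log (n.choose k : ℝ) ≤ k * (Real.log ((n : ℝ) / k) + 1) := by
  have hk' : (0 : ℝ) < k := by exact_mod_cast hk
  have hn' : (0 : ℝ) < n := by exact_mod_cast hk.trans_le hkn
  have hpos : (0 : ℝ) < n.choose k := by exact_mod_cast Nat.choose_pos hkn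
  have h : (n.choose k : ℝ) ≤ ((n : ℝ) / k) ^ k * Real.exp k :=
    calc (n.choose k : ℝ) ≤ (n : ℝ) ^ k / k.factorial := Nat.choose_le_pow_div k n
      _ = ((n : ℝ) / k) ^ k * ((k : ℝ) ^ k / k.factorial) := by
        rw [div_pow]
        field_simp
      _ ≤ _ := by gcongr; exact Real.pow_div_factorial_le_exp _ hk'.le k
  calc Real.log (n.choose k : ℝ) ≤ Real.log (((n : ℝ) / k) ^ k * Real.exp k) :=
        Real.log_le_log hpos h
    _ = k * (Real.log ((n : ℝ) / k) + 1) := by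
        rw [Real.log_mul (by positivity) (by positivity), Real.log_pow, Real.log_exp]; ring

lemma exists_bounds_of_tendsto_div {ι : Type*} {l : Filter ι} {f g : ι → ℝ} {L : ℝ} (hL : 0 < L)
    (hg : ∀ᶠ i in l, 0 < g i) (h : Tendsto (fun i => f i / g i) l (nhds L)) :
    ∃ a b : ℝ, 0 < a ∧ 0 < b ∧ ∀ᶠ i in l, a * g i ≤ f i ∧ f i ≤ b * g i := by
  refine ⟨L / 2, 2 * L, by positivity, by positivity, ?_⟩
  filter_upwards [hg, h.eventually_const_lt (half_lt_self hL),
    h.eventually_lt_const (show L < 2 * L by linarith)] with i hi h1 h2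
  exact ⟨((lt_div_iff₀ hi).mp h1).le, ((div_lt_iff₀ hi).mp h2).le⟩

lemma tendsto_log_div_log_of_rpow_bounds {k : ℕ → ℝ} {C c₁ c₂ : ℝ} (h₁ : 0 < c₁) (h₂ : 0 < c₂)
    (hk : ∀ᶠ n : ℕ in atTop, c₁ * (n : ℝ) ^ C ≤ k n ∧ k n ≤ c₂ * (n : ℝ) ^ C) :
    Tendsto (fun n : ℕ => Real.log (k n) / Real.log n) atTop (nhds C) := by
  have hlog : Tendsto (fun n : ℕ => Real.log n) atTop atTop :=
    Real.tendsto_log_atTop.comp tendsto_natCast_atTop_atTop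
  have hlim (c : ℝ) : Tendsto (fun n : ℕ => Real.log c / Real.log n + C) atTop (nhds C) := by
    simpa using (hlog.const_div_atTop (Real.log c)).add_const C
  refine tendsto_of_tendsto_of_tendsto_of_le_of_le' (hlim c₁) (hlim c₂) ?_ ?_
  all_goals
    filter_upwards [hk, hlog.eventually_gt_atTop 0, eventually_gt_atTop 0] with n hn hl hn0
    have hn0' : (0 : ℝ) < n := by exact_mod_cast hn0
    have hp : (0 : ℝ) < (n : ℝ) ^ C := Real.rpow_pos_of_pos hn0' C
    have hkpos : 0 < k n := (mul_pos h₁ hp).trans_le hn.1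
    rw [div_add' _ _ _ hl.ne']
    gcongr
    rw [← Real.log_rpow hn0', ← Real.log_mul (by positivity) (by positivity)]
  · exact Real.log_le_log (by positivity) hn.1
  · exact Real.log_le_log hkpos hn.2

lemma tendsto_log_choose_div {k : ℕ → ℕ} (hk : ∀ᶠ n in atTop, 0 < k n)
    (hL : Tendsto (fun n : ℕ => Real.log ((n : ℝ) / k n)) atTop atTop) :
    Tendsto (fun n : ℕ => Real.log (n.choose (k n) : ℝ) / (k n * Real.log ((n : ℝ) / k n)))
      atTop (nhds 1) := by
  have hlow : Tendsto (fun n : ℕ => 1 - Real.log 2 / Real.log ((n : ℝ) / k n)) atTop (nhds 1) := by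
    simpa using (hL.const_div_atTop (Real.log 2)).const_sub 1
  have hupp : Tendsto (fun n : ℕ => 1 + 1 / Real.log ((n : ℝ) / k n)) atTop (nhds 1) := by
    simpa using (hL.const_div_atTop 1).const_add 1
  have hle : ∀ᶠ n in atTop, 2 * k n ≤ n := by
    filter_upwards [hk, hL.eventually_ge_atTop (Real.log 2), eventually_gt_atTop 0] with n hn hl hn0
    have hn' : (0 : ℝ) < k n := by exact_mod_cast hn
    have hn0' : (0 : ℝ) < n := by exact_mod_cast hn0
    have := (Real.log_le_log_iff two_pos (by positivity)).mp hl
    rw [le_div_iff₀ hn'] at this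
    exact_mod_cast this
  refine tendsto_of_tendsto_of_tendsto_of_le_of_le' hlow hupp ?_ ?_
  all_goals
    filter_upwards [hk, hL.eventually_gt_atTop 0, hle] with n hn hl hle
    have hn' : (0 : ℝ) < k n := by exact_mod_cast hn
  · rw [le_div_iff₀ (by positivity)]
    refine le_of_eq_of_le ?_ (mul_log_sub_log_two_le_log_choose hn hle)
    field_simp
  · rw [div_le_iff₀ (by positivity)]
    refine (log_choose_le_mul_log_add_one hn (by omega)).trans_eq ?_
    field_simp

/-- If `K = Θ(n^C)` for `C ∈ (0,1)`, `α ∈ (0,1)`, and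
`γ = h⁻¹(log 2 − (log C(n,K) − O(K^α log n))/C(K,2))`, then
`γ = 1/2 + (1 + o(1))√(log(n/K)/K) = 1/2 + Θ(√(log n / K))` and
`r(γ,1/2) = log 2 − h(γ) = (1 + o(1))·2 log(n/K)/K = Θ(log n / K)`. -/
theorem gamma_threshold_asymptotics
    (K : ℕ → ℕ) (C α : ℝ) (c : ℕ → ℝ) (γ : ℕ → ℝ)
    (hC : C ∈ Set.Ioo (0 : ℝ) 1) (hα : α ∈ Set.Ioo (0 : ℝ) 1)
    (hK : ∃ c₁ c₂ : ℝ, 0 < c₁ ∧ 0 < c₂ ∧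
      ∀ᶠ n : ℕ in atTop, c₁ * (n : ℝ) ^ C ≤ (K n : ℝ) ∧ (K n : ℝ) ≤ c₂ * (n : ℝ) ^ C)
    (hc : ∃ M : ℝ, ∀ᶠ n : ℕ in atTop, |c n| ≤ M * (K n : ℝ) ^ α * Real.log n)
    (hγ : ∀ n : ℕ, γ n =
      binEntInv (Real.log 2 -
        (Real.log (n.choose (K n) : ℝ) - c n) / ((K n).choose 2 : ℝ))) :
    Tendsto (fun n : ℕ =>
        (γ n - 1/2) / Real.sqrt (Real.log ((n : ℝ) / (K n : ℝ)) / (K n : ℝ)))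
      atTop (nhds 1) ∧
    (∃ a₁ a₂ : ℝ, 0 < a₁ ∧ 0 < a₂ ∧ ∀ᶠ n : ℕ in atTop,
      a₁ * Real.sqrt (Real.log n / (K n : ℝ)) ≤ γ n - 1/2 ∧
      γ n - 1/2 ≤ a₂ * Real.sqrt (Real.log n / (K n : ℝ))) ∧
    Tendsto (fun n : ℕ =>
        (Real.log 2 - binEnt (γ n)) / (2 * Real.log ((n : ℝ) / (K n : ℝ)) / (K n : ℝ)))
      atTop (nhds 1) ∧
    (∃ b₁ b₂ : ℝ, 0 < b₁ ∧ 0 < b₂ ∧ ∀ᶠ n : ℕ in atTop,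
      b₁ * (Real.log n / (K n : ℝ)) ≤ Real.log 2 - binEnt (γ n) ∧
      Real.log 2 - binEnt (γ n) ≤ b₂ * (Real.log n / (K n : ℝ))) := by
  obtain ⟨c₁, c₂, hc₁, hc₂, hK⟩ := hK
  obtain ⟨M, hM⟩ := hc
  have hlog : Tendsto (fun n : ℕ => Real.log n) atTop atTop :=
    Real.tendsto_log_atTop.comp tendsto_natCast_atTop_atTop
  have hKtop : Tendsto (fun n => (K n : ℝ)) atTop atTop := by
    refine tendsto_atTop_mono' atTop (hK.mono fun n hn => hn.1) ?_
    exact ((tendsto_rpow_atTop hC.1).comp tendsto_natCast_atTop_atTop).const_mul_atTop hc₁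
  have hKpos : ∀ᶠ n in atTop, (0 : ℝ) < K n := hKtop.eventually_gt_atTop 0
  have hLdiv : Tendsto (fun n : ℕ => Real.log ((n : ℝ) / K n) / Real.log n) atTop
      (nhds (1 - C)) := by
    refine ((tendsto_log_div_log_of_rpow_bounds hc₁ hc₂ hK).const_sub 1).congr' ?_
    filter_upwards [hKpos, hlog.eventually_gt_atTop 0, eventually_gt_atTop 0] with n hk hl hn0
    have hn0' : (0 : ℝ) < n := by exact_mod_cast hn0
    rw [Real.log_div hn0'.ne' hk.ne']
    field_simp
  have hC' : 0 < 1 - C := by linarith [hC.2]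
  have hL : Tendsto (fun n : ℕ => Real.log ((n : ℝ) / K n)) atTop atTop := by
    refine (hLdiv.pos_mul_atTop hC' hlog).congr' ?_
    filter_upwards [hlog.eventually_gt_atTop 0] with n hl
    field_simp
  have hLpos : ∀ᶠ n : ℕ in atTop, 0 < Real.log ((n : ℝ) / K n) := hL.eventually_gt_atTop 0
  have hchoose := tendsto_log_choose_div (hKpos.mono fun n h => by exact_mod_cast h) hL
  have herr : Tendsto (fun n : ℕ => c n / (K n * Real.log ((n : ℝ) / K n))) atTop (nhds 0) := by
    have hpow : Tendsto (fun n => (K n : ℝ) ^ (-(1 - α))) atTop (nhds 0) :=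
      (tendsto_rpow_neg_atTop (by linarith [hα.2])).comp hKtop
    have hbound := (hpow.const_mul M).mul (hLdiv.inv₀ hC'.ne')
    simp only [mul_zero, zero_mul] at hbound
    refine squeeze_zero_norm' ?_ hbound
    filter_upwards [hKpos, hLpos, hM] with n hk hl hcn
    have hden : 0 < (K n : ℝ) * Real.log ((n : ℝ) / K n) := by positivity
    rw [Real.norm_eq_abs, abs_div, abs_of_pos hden, div_le_iff₀ hden]
    refine hcn.trans_eq ?_
    rw [neg_sub, Real.rpow_sub_one hk.ne']
    field_simp
  set y : ℕ → ℝ := fun n =>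
    (Real.log (n.choose (K n) : ℝ) - c n) / ((K n).choose 2 : ℝ) with hy
  have hratio : Tendsto (fun n : ℕ => y n / (2 * Real.log ((n : ℝ) / K n) / K n))
      atTop (nhds 1) := by
    have hshift : Tendsto (fun n => (K n : ℝ) / (K n - 1)) atTop (nhds 1) := by
      have hinv : Tendsto (fun n => 1 - 1 / (K n : ℝ)) atTop (nhds 1) := by
        simpa using (hKtop.const_div_atTop 1).const_sub 1
      have := hinv.inv₀ one_ne_zero
      rw [inv_one] at this
      refine this.congr' ?_
      filter_upwards [hKtop.eventually_gt_atTop 1] with n hk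
      have : (K n : ℝ) - 1 ≠ 0 := by linarith
      have : (K n : ℝ) ≠ 0 := by linarith
      field_simp
    have := (hchoose.sub herr).mul hshift
    rw [sub_zero, mul_one] at this
    refine this.congr' ?_
    filter_upwards [hKtop.eventually_gt_atTop 1, hLpos] with n hk hl
    have : (K n : ℝ) - 1 ≠ 0 := by linarith
    have : (K n : ℝ) ≠ 0 := by linarith
    simp only [hy]
    rw [Nat.cast_choose_two]
    field_simp
  have hLK : Tendsto (fun n : ℕ => 2 * Real.log ((n : ℝ) / K n) / K n) atTop (nhds 0) := by
    have hlogK : Tendsto (fun n => Real.log (K n) / (K n : ℝ)) atTop (nhds 0) :=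
      (Real.isLittleO_log_id_atTop.tendsto_div_nhds_zero).comp hKtop
    have hlogK' := tendsto_log_div_log_of_rpow_bounds hc₁ hc₂ hK
    have := ((hLdiv.div hlogK' hC.1.ne').mul hlogK).const_mul 2
    rw [mul_zero, mul_zero] at this
    refine this.congr' ?_
    filter_upwards [hKtop.eventually_gt_atTop 1, hlog.eventually_gt_atTop 0] with n hk hl
    have : (K n : ℝ) ≠ 0 := by linarith
    have := (Real.log_pos hk).ne'
    simp only [Pi.div_apply]
    field_simp
  have hLKpos : ∀ᶠ n : ℕ in atTop, 0 < 2 * Real.log ((n : ℝ) / K n) / K n := by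
    filter_upwards [hKpos, hLpos] with n hk hl
    positivity
  have hlogKpos : ∀ᶠ n : ℕ in atTop, 0 < Real.log n / (K n : ℝ) := by
    filter_upwards [hKpos, hlog.eventually_gt_atTop 0] with n hk hl
    positivity
  have hy0 : Tendsto y atTop (nhds 0) := by
    have := hratio.mul hLK
    rw [mul_zero] at this
    refine this.congr' ?_
    filter_upwards [hLKpos] with n h
    exact div_mul_cancel₀ _ h.ne'
  have hypos : ∀ᶠ n in atTop, 0 < y n := by
    filter_upwards [hratio.eventually_const_lt one_pos, hLKpos] with n h h'
    exact (div_pos_iff_of_pos_right h').mp h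
  have hspec : ∀ᶠ n in atTop, γ n ∈ Set.Icc (1/2 : ℝ) 1 ∧ binEnt (γ n) = Real.log 2 - y n := by
    filter_upwards [hypos, hy0.eventually_lt_const (Real.log_pos one_lt_two)] with n h h'
    rw [hγ n]
    exact binEntInv_mem_and_binEnt_binEntInv (by linarith) (by linarith)
  have hr : Tendsto (fun n : ℕ =>
      (Real.log 2 - binEnt (γ n)) / (2 * Real.log ((n : ℝ) / (K n : ℝ)) / (K n : ℝ)))
      atTop (nhds 1) := by
    refine hratio.congr' ?_
    filter_upwards [hspec] with n h
    rw [h.2, sub_sub_cancel]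
  have hγlim : Tendsto γ atTop (nhds (1/2)) := by
    refine tendsto_of_tendsto_binEntropy (hspec.mono fun n h => h.1) ?_
    have := hy0.const_sub (Real.log 2)
    rw [sub_zero] at this
    refine this.congr' ?_
    filter_upwards [hspec] with n h
    rw [← binEnt_eq_binEntropy, h.2]
  have hxne : ∀ᶠ n in atTop, γ n - 1/2 ≠ 0 := by
    filter_upwards [hspec, hypos] with n h hpos h0
    have hhalf : γ n = 2⁻¹ := by linarith
    have h2 := h.2
    rw [hhalf, binEnt_eq_binEntropy, Real.binEntropy_two_inv] at h2
    linarith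
  have hx : Tendsto (fun n => γ n - 1/2) atTop (nhdsWithin 0 {0}ᶜ) :=
    tendsto_nhdsWithin_iff.mpr ⟨by simpa using hγlim.sub_const (1/2), hxne⟩
  have hquad := tendsto_log_two_sub_binEntropy_div_sq.comp hx
  have hsq : Tendsto (fun n : ℕ => (γ n - 1/2) ^ 2 / (Real.log ((n : ℝ) / K n) / K n))
      atTop (nhds 1) := by
    have := (hr.div hquad two_ne_zero).const_mul 2
    norm_num at this
    refine this.congr' ?_
    filter_upwards [hKpos, hLpos, hxne, hspec, hypos] with n hk hl hne hs hpos
    have hval : Real.log 2 - Real.binEntropy (γ n) = y n := by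
      rw [← binEnt_eq_binEntropy, hs.2, sub_sub_cancel]
    simp only [binEnt_eq_binEntropy, hval]
    set x := γ n - 1/2
    field_simp
  have hmain : Tendsto (fun n : ℕ =>
      (γ n - 1/2) / Real.sqrt (Real.log ((n : ℝ) / (K n : ℝ)) / (K n : ℝ))) atTop (nhds 1) := by
    have := hsq.sqrt
    rw [Real.sqrt_one] at this
    refine this.congr' ?_
    filter_upwards [hspec] with n h
    rw [Real.sqrt_div (sq_nonneg _), Real.sqrt_sq (by linarith [h.1.1])]
  refine ⟨hmain, ?_, hr, ?_⟩
  · refine exists_bounds_of_tendsto_div (L := Real.sqrt (1 - C)) (Real.sqrt_pos.mpr hC')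
      (hlogKpos.mono fun n h => Real.sqrt_pos.mpr h) ?_
    have := hmain.mul hLdiv.sqrt
    rw [one_mul] at this
    refine this.congr' ?_
    filter_upwards [hKpos, hLpos, hlog.eventually_gt_atTop 0] with n hk hl hln
    have h1 := (Real.sqrt_pos.mpr hk).ne'
    have h2 := (Real.sqrt_pos.mpr hl).ne'
    have h3 := (Real.sqrt_pos.mpr hln).ne'
    rw [Real.sqrt_div hl.le, Real.sqrt_div hl.le, Real.sqrt_div hln.le]
    field_simp
  · refine exists_bounds_of_tendsto_div (L := 2 * (1 - C)) (by positivity) hlogKpos ?_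
    have := (hr.mul hLdiv).const_mul 2
    rw [one_mul] at this
    refine this.congr' ?_
    filter_upwards [hKpos, hLpos, hlog.eventually_gt_atTop 0] with n hk hl hln
    field_simp

end
end
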